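/- Bogovskiĭ lemma (smooth data): let n ≥ 2, 1 < p < ∞, and let B_R(x₀) ⊂ ℝⁿ be a ball. For every g ∈ C_c^∞(B_R(x₀)) with ∫_{B_R(x₀)} g(x) dx = 0, there exists a smooth vector field w ∈ C_c^∞(B_R(x₀), ℝⁿ) such that div w = g on B_R(x₀) and ∫_{B_R(x₀)} |Dw(x)|^p dx ≤ c(n,p) ∫_{B_R(x₀)} |g(x)|^p dx, with a constant c(n,p) independent of g and R. Moreover, if the support of g is contained in B_r(x₀) for some 0 < r < R, then w can be chosen with support contained in B_r(x₀). -/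

import Mathlib

open MeasureTheory Metric

/-- The Jacobian matrix `Dw(x) ∈ ℝ^{n×n}` of a vector field `w : ℝⁿ → ℝⁿ`. -/
noncomputable def jacobian {n : ℕ} (w : EuclideanSpace ℝ (Fin n) → EuclideanSpace ℝ (Fin n))
    (x : EuclideanSpace ℝ (Fin n)) : Matrix (Fin n) (Fin n) ℝ :=
  fun i j => fderiv ℝ w x (EuclideanSpace.single j 1) i

/-- The Frobenius norm of a real `n × n` matrix. -/
noncomputable def frob {n : ℕ} (M : Matrix (Fin n) (Fin n) ℝ) : ℝ :=
  Real.sqrt (∑ i, ∑ j, M i j ^ 2)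

/-- The divergence `div w = trace(Dw)` of a vector field `w : ℝⁿ → ℝⁿ`. -/
noncomputable def diverg {n : ℕ} (w : EuclideanSpace ℝ (Fin n) → EuclideanSpace ℝ (Fin n))
    (x : EuclideanSpace ℝ (Fin n)) : ℝ :=
  ∑ i, fderiv ℝ w x (EuclideanSpace.single i 1) i

open scoped FourierTransform ENNReal NNReal RealInnerProductSpace ContDiff

section RapidDecay

variable {V : Type*} [NormedAddCommGroup V] [InnerProductSpace ℝ V] [FiniteDimensional ℝ V]
  [MeasurableSpace V] [BorelSpace V]

/-- Strongly measurable functions decaying faster than any power of the norm. -/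
structure RapidDecay (ψ : V → ℂ) : Prop where
  meas : AEStronglyMeasurable ψ volume
  decay : ∀ N : ℕ, ∃ C : ℝ, ∀ ξ, ‖ψ ξ‖ * (1 + ‖ξ‖) ^ N ≤ C

namespace RapidDecay

theorem of_norm_le {ψ χ : V → ℂ} (h : RapidDecay ψ) (hχ : AEStronglyMeasurable χ volume)
    {K : ℝ} (hK : 0 ≤ K) {m : ℕ} (hle : ∀ ξ, ‖χ ξ‖ ≤ K * (1 + ‖ξ‖) ^ m * ‖ψ ξ‖) :
    RapidDecay χ := by
  refine ⟨hχ, fun N => ?_⟩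
  obtain ⟨C, hC⟩ := h.decay (m + N)
  refine ⟨K * C, fun ξ => ?_⟩
  calc ‖χ ξ‖ * (1 + ‖ξ‖) ^ N ≤ K * (1 + ‖ξ‖) ^ m * ‖ψ ξ‖ * (1 + ‖ξ‖) ^ N := by
        gcongr; exact hle ξ
    _ = K * (‖ψ ξ‖ * (1 + ‖ξ‖) ^ (m + N)) := by ring
    _ ≤ K * C := by gcongr; exact hC ξ

theorem add {ψ χ : V → ℂ} (h : RapidDecay ψ) (h' : RapidDecay χ) :
    RapidDecay (fun ξ => ψ ξ + χ ξ) := by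
  refine ⟨h.meas.add h'.meas, fun N => ?_⟩
  obtain ⟨C, hC⟩ := h.decay N
  obtain ⟨C', hC'⟩ := h'.decay N
  refine ⟨C + C', fun ξ => ?_⟩
  calc ‖ψ ξ + χ ξ‖ * (1 + ‖ξ‖) ^ N ≤ (‖ψ ξ‖ + ‖χ ξ‖) * (1 + ‖ξ‖) ^ N := by
        gcongr; exact norm_add_le _ _
    _ ≤ C + C' := by rw [add_mul]; exact add_le_add (hC ξ) (hC' ξ)

theorem const_mul {ψ : V → ℂ} (h : RapidDecay ψ) (a : ℂ) : RapidDecay (fun ξ => a * ψ ξ) :=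
  h.of_norm_le (h.meas.const_mul a) (norm_nonneg a) (m := 0) (fun ξ => by simp)

theorem indicator {ψ : V → ℂ} (h : RapidDecay ψ) {s : Set V} (hs : MeasurableSet s) :
    RapidDecay (s.indicator ψ) :=
  h.of_norm_le (h.meas.indicator hs) zero_le_one (m := 0) (fun ξ => by
    simpa using norm_indicator_le_norm_self ψ ξ)

theorem integrable {ψ : V → ℂ} (h : RapidDecay ψ) : Integrable ψ := by
  obtain ⟨C, hC⟩ := h.decay (Module.finrank ℝ V + 1)
  have h1 : Integrable (fun ξ : V => C * (1 + ‖ξ‖) ^ (-((Module.finrank ℝ V + 1 : ℕ) : ℝ))) :=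
    (integrable_one_add_norm (by push_cast; linarith)).const_mul C
  refine h1.mono' h.meas (Filter.Eventually.of_forall fun ξ => ?_)
  have hp : (0 : ℝ) < 1 + ‖ξ‖ := by positivity
  rw [Real.rpow_neg hp.le, Real.rpow_natCast, ← div_eq_mul_inv, le_div_iff₀ (by positivity)]
  exact hC ξ

theorem bounded {ψ : V → ℂ} (h : RapidDecay ψ) : ∃ C, ∀ ξ, ‖ψ ξ‖ ≤ C := by
  obtain ⟨C, hC⟩ := h.decay 0
  exact ⟨C, fun ξ => by simpa using hC ξ⟩

theorem memLp_two {ψ : V → ℂ} (h : RapidDecay ψ) : MemLp ψ 2 := by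
  obtain ⟨C, hC⟩ := h.bounded
  rw [memLp_two_iff_integrable_sq_norm h.meas]
  refine (h.integrable.norm.const_mul C).mono' (h.meas.norm.pow 2)
    (Filter.Eventually.of_forall fun ξ => ?_)
  rw [Real.norm_of_nonneg (by positivity), sq]
  gcongr
  exact hC ξ

end RapidDecay

/-- The inverse Fourier integral of an integrable function is continuous. -/
theorem continuous_fourierInv_of_integrable {ψ : V → ℂ} (h : Integrable ψ) :
    Continuous (𝓕⁻ ψ) := by
  rw [Real.fourierInv_eq_fourier_comp_neg]
  exact VectorFourier.fourierIntegral_continuous Real.continuous_fourierChar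
    (by exact continuous_inner) h.comp_neg

theorem norm_fourierInv_le {ψ : V → ℂ} (x : V) : ‖𝓕⁻ ψ x‖ ≤ ∫ ξ, ‖ψ ξ‖ := by
  rw [Real.fourierInv_eq]
  refine (norm_integral_le_integral_norm _).trans_eq ?_
  simp

theorem fourierInv_toLp_ae_eq {ψ : V → ℂ} (h : Integrable ψ) (h2 : MemLp ψ 2) :
    ((𝓕⁻ (h2.toLp ψ) : Lp ℂ 2 (volume : Measure V)) : V → ℂ) =ᵐ[volume] 𝓕⁻ ψ := by
  refine ae_eq_of_integral_contDiff_smul_eq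
    ((Lp.memLp _).locallyIntegrable one_le_two)
    (continuous_fourierInv_of_integrable h).locallyIntegrable fun g hg hgs => ?_
  have hgs' : HasCompactSupport (fun x => (g x : ℂ)) := hgs.comp_left Complex.ofReal_zero
  have hgc : ContDiff ℝ ∞ (fun x => (g x : ℂ)) := Complex.ofRealCLM.contDiff.comp hg
  let G : SchwartzMap V ℂ := hgs'.toSchwartzMap hgc
  have hG : ∀ x, G x = (g x : ℂ) := fun x => rfl
  have e1 := congrArg (fun T : TemperedDistribution V ℂ => T G)
    (Lp.fourierInv_toTemperedDistribution_eq (h2.toLp ψ))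
  simp only [TemperedDistribution.fourierInv_apply, Lp.toTemperedDistribution_apply] at e1
  have e2 : ∫ x, (𝓕⁻ G) x • (h2.toLp ψ : V → ℂ) x = ∫ x, (𝓕⁻ G) x • ψ x :=
    integral_congr_ae (by filter_upwards [h2.coeFn_toLp] with x hx; rw [hx])
  rw [e2] at e1
  have e3 : ∫ x, G x • 𝓕⁻ ψ x = ∫ x, (𝓕⁻ G) x • ψ x := by
    have hc : Continuous fun p : V × V => ((-(innerₗ V)) p.1) p.2 := by
      have : Continuous fun p : V × V => -(inner ℝ p.1 p.2) := continuous_inner.neg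
      exact this
    have := VectorFourier.integral_fourierIntegral_smul_eq_flip (μ := (volume : Measure V))
      (ν := (volume : Measure V)) (f := fun x => (g x : ℂ)) (g := ψ) (L := -(innerₗ V))
      Real.continuous_fourierChar hc G.integrable h
    rw [SchwartzMap.fourierInv_coe]
    simp only [Real.fourierInv_eq]
    simp only [VectorFourier.fourierIntegral] at this
    refine Eq.trans ?_ (this.symm.trans ?_)
    · refine integral_congr_ae (Filter.Eventually.of_forall fun x => ?_)
      simp [hG, real_inner_comm]
    · refine integral_congr_ae (Filter.Eventually.of_forall fun x => ?_)
      simp [hG]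
  refine Eq.trans ?_ ((e1.symm.trans e3.symm).trans ?_)
  · refine integral_congr_ae (Filter.Eventually.of_forall fun x => ?_)
    simp [hG]
  · refine integral_congr_ae (Filter.Eventually.of_forall fun x => ?_)
    simp [hG]

theorem memLp_two_fourierInv {ψ : V → ℂ} (h : Integrable ψ) (h2 : MemLp ψ 2) :
    MemLp (𝓕⁻ ψ) 2 :=
  (memLp_congr_ae (fourierInv_toLp_ae_eq h h2)).1 (Lp.memLp _)

theorem eLpNorm_two_fourierInv {ψ : V → ℂ} (h : Integrable ψ) (h2 : MemLp ψ 2) :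
    eLpNorm (𝓕⁻ ψ) 2 = eLpNorm ψ 2 := by
  rw [← eLpNorm_congr_ae (fourierInv_toLp_ae_eq h h2), ← Lp.enorm_def]
  have := Lp.norm_fourier_eq (𝓕⁻ (h2.toLp ψ) : Lp ℂ 2 (volume : Measure V))
  rw [FourierTransform.fourier_fourierInv_eq] at this
  rw [← enorm_norm, ← this, enorm_norm, Lp.enorm_toLp]

theorem integral_sq_fourierInv {ψ : V → ℂ} (h : Integrable ψ) (h2 : MemLp ψ 2) :
    ∫ x, ‖𝓕⁻ ψ x‖ ^ 2 = ∫ ξ, ‖ψ ξ‖ ^ 2 := by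
  have e := eLpNorm_two_fourierInv h h2
  rw [(memLp_two_fourierInv h h2).eLpNorm_eq_integral_rpow_norm two_ne_zero ENNReal.ofNat_ne_top,
    h2.eLpNorm_eq_integral_rpow_norm two_ne_zero ENNReal.ofNat_ne_top,
    ENNReal.ofReal_eq_ofReal_iff (by positivity) (by positivity)] at e
  simp only [ENNReal.toReal_ofNat, Real.rpow_ofNat] at e
  exact (Real.rpow_left_inj (by positivity) (by positivity) (by norm_num)).1 e

end RapidDecay

section HalfSpace

variable {V : Type*} [NormedAddCommGroup V] [InnerProductSpace ℝ V] [FiniteDimensional ℝ V]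
  [MeasurableSpace V] [BorelSpace V]

theorem integral_sub_integral_eq_intervalIntegral {α : Type*} [MeasurableSpace α] {μ : Measure α}
    [SFinite μ] {f f' : α → ℝ → ℝ} {a b : ℝ} (hab : a ≤ b)
    (hc : ∀ x, ContinuousOn (f x) (Set.Icc a b))
    (hd : ∀ x, ∀ t ∈ Set.Ioo a b, HasDerivAt (f x) (f' x t) t)
    (hi : Integrable (Function.uncurry f') (μ.prod (volume.restrict (Set.Ioc a b))))
    (ha : Integrable (fun x => f x a) μ) (hb : Integrable (fun x => f x b) μ) :
    ∫ x, f x b ∂μ - ∫ x, f x a ∂μ = ∫ t in a..b, ∫ x, f' x t ∂μ := by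
  rw [← integral_sub hb ha, intervalIntegral.integral_of_le hab]
  have h1 := integral_integral_swap (f := f') hi
  rw [← h1]
  refine integral_congr_ae ?_
  filter_upwards [hi.prod_right_ae] with x hx
  have h2 := intervalIntegral.integral_eq_sub_of_hasDerivAt_of_le hab (hc x) (hd x)
    ((intervalIntegrable_iff_integrableOn_Ioc_of_le hab).2 hx)
  rw [← h2, intervalIntegral.integral_of_le hab]

/-- The Fourier multiplier `(2 π i ⟨ξ, θ⟩) ^ k * exp (2 π i ⟨ξ, θ⟩ z)` applied to `χ`. -/
noncomputable def halfSymbol (θ : V) (χ : V → ℂ) (k : ℕ) (z : ℂ) (ξ : V) : ℂ :=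
  Complex.exp (2 * Real.pi * Complex.I * (inner ℝ ξ θ : ℝ) * z) *
    ((2 * Real.pi * Complex.I * (inner ℝ ξ θ : ℝ)) ^ k * χ ξ)

variable {θ : V} {χ : V → ℂ}

theorem norm_exp_half (c : ℝ) (z : ℂ) :
    ‖Complex.exp (2 * Real.pi * Complex.I * c * z)‖ = Real.exp (-(2 * Real.pi * (c * z.im))) := by
  rw [Complex.norm_exp]
  congr 1
  simp
  ring

theorem norm_halfSymbol_le (hs : ∀ ξ, χ ξ ≠ 0 → 0 < inner ℝ ξ θ) (k : ℕ) {z : ℂ} (hz : 0 ≤ z.im)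
    (ξ : V) : ‖halfSymbol θ χ k z ξ‖ ≤ ‖(2 * Real.pi * Complex.I * (inner ℝ ξ θ : ℝ)) ^ k * χ
        ξ‖ := by
  rw [halfSymbol, norm_mul]
  by_cases h : χ ξ = 0
  · simp [h]
  · refine mul_le_of_le_one_left (norm_nonneg _) ?_
    rw [norm_exp_half, Real.exp_le_one_iff]
    have := mul_nonneg (hs ξ h).le hz
    have := Real.pi_pos
    nlinarith

theorem RapidDecay.inner_pow_mul (hχ : RapidDecay χ) (θ : V) (k : ℕ) :
    RapidDecay (fun ξ => (2 * Real.pi * Complex.I * (inner ℝ ξ θ : ℝ)) ^ k * χ ξ) := by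
  refine hχ.of_norm_le (K := (2 * Real.pi * ‖θ‖) ^ k) (m := k) ?_ (by positivity) fun ξ => ?_
  · refine AEStronglyMeasurable.mul (Continuous.aestronglyMeasurable ?_) hχ.meas
    fun_prop
  · rw [norm_mul, norm_pow]
    gcongr
    rw [← mul_pow]
    gcongr
    simp only [norm_mul, Complex.norm_real, Complex.norm_I, Complex.norm_ofNat, mul_one,
      Real.norm_eq_abs, abs_of_pos Real.pi_pos]
    have := abs_real_inner_le_norm ξ θ
    have h3 := norm_nonneg θ
    have h4 := norm_nonneg ξ
    have := Real.pi_pos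
    calc 2 * Real.pi * |inner ℝ ξ θ| ≤ 2 * Real.pi * (‖ξ‖ * ‖θ‖) := by gcongr
      _ ≤ 2 * Real.pi * ((1 + ‖ξ‖) * ‖θ‖) := by gcongr; linarith
      _ = _ := by ring

theorem RapidDecay.halfSymbol (hχ : RapidDecay χ) (hs : ∀ ξ, χ ξ ≠ 0 → 0 < inner ℝ ξ θ) (k : ℕ)
    {z : ℂ} (hz : 0 ≤ z.im) : RapidDecay (halfSymbol θ χ k z) := by
  refine (hχ.inner_pow_mul θ k).of_norm_le ?_ zero_le_one (m := 0) fun ξ => ?_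
  · unfold _root_.halfSymbol
    refine AEStronglyMeasurable.mul (Continuous.aestronglyMeasurable ?_)
      (hχ.inner_pow_mul θ k).meas
    fun_prop
  · simpa using norm_halfSymbol_le hs k hz ξ

/-- The extension of the `k`-th directional derivative of `𝓕⁻ χ` to complex times. -/
noncomputable def halfExt (θ : V) (χ : V → ℂ) (k : ℕ) (x : V) (z : ℂ) : ℂ :=
  𝓕⁻ (halfSymbol θ χ k z) x

theorem halfExt_eq (k : ℕ) (x : V) (z : ℂ) : halfExt θ χ k x z =
    ∫ ξ, Complex.exp (2 * Real.pi * Complex.I * (inner ℝ ξ x : ℝ)) * halfSymbol θ χ k z ξ := by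
  rw [halfExt, Real.fourierInv_eq]
  refine integral_congr_ae (Filter.Eventually.of_forall fun ξ => ?_)
  simp only [Circle.smul_def, Real.fourierChar_apply, smul_eq_mul]
  congr 2
  push_cast
  ring

theorem halfExt_add_smul (k : ℕ) (x : V) (z : ℂ) (s : ℝ) :
    halfExt θ χ k (x + s • θ) z = halfExt θ χ k x (z + s) := by
  rw [halfExt_eq, halfExt_eq]
  refine integral_congr_ae (Filter.Eventually.of_forall fun ξ => ?_)
  simp only [halfSymbol, ← mul_assoc, ← Complex.exp_add]
  congr 3
  rw [inner_add_right, inner_smul_right]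
  push_cast
  ring

theorem norm_expI (c : ℝ) : ‖Complex.exp (2 * Real.pi * Complex.I * c)‖ = 1 := by
  rw [Complex.norm_exp]
  simp

theorem hasDerivAt_halfExt (hχ : RapidDecay χ) (hs : ∀ ξ, χ ξ ≠ 0 → 0 < inner ℝ ξ θ) (k : ℕ)
    (x : V) {z : ℂ} (hz : 0 < z.im) :
    HasDerivAt (halfExt θ χ k x) (halfExt θ χ (k + 1) x z) z := by
  have e : halfExt θ χ k x = fun z => ∫ ξ, Complex.exp (2 * Real.pi * Complex.I *
      (inner ℝ ξ x : ℝ)) * halfSymbol θ χ k z ξ := funext fun z => halfExt_eq k x z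
  rw [e, halfExt_eq]
  have ho : {w : ℂ | 0 < w.im} ∈ nhds z :=
    (isOpen_lt continuous_const Complex.continuous_im).mem_nhds hz
  have hm : Continuous fun ξ : V => Complex.exp (2 * Real.pi * Complex.I *
      (inner ℝ ξ x : ℝ)) := by fun_prop
  refine (hasDerivAt_integral_of_dominated_loc_of_deriv_le (s := {w : ℂ | 0 < w.im})
    (bound := fun ξ => ‖(2 * Real.pi * Complex.I * (inner ℝ ξ θ : ℝ)) ^ (k + 1) * χ ξ‖)
    (F' := fun w ξ => Complex.exp (2 * Real.pi * Complex.I *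
      (inner ℝ ξ x : ℝ)) * halfSymbol θ χ (k + 1) w ξ) ho ?_ ?_ ?_ ?_ ?_ ?_).2
  · filter_upwards [ho] with w hw
    exact hm.aestronglyMeasurable.mul (hχ.halfSymbol hs k (le_of_lt hw)).meas
  · exact (hχ.halfSymbol hs k hz.le).integrable.bdd_mul hm.aestronglyMeasurable
      (c := 1) (Filter.Eventually.of_forall fun ξ => (norm_expI _).le)
  · exact hm.aestronglyMeasurable.mul (hχ.halfSymbol hs (k + 1) hz.le).meas
  · refine Filter.Eventually.of_forall fun ξ w hw => ?_
    rw [norm_mul, norm_expI, one_mul]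
    exact norm_halfSymbol_le hs (k + 1) (le_of_lt hw) ξ
  · exact (hχ.inner_pow_mul θ (k + 1)).integrable.norm
  · refine Filter.Eventually.of_forall fun ξ w hw => ?_
    refine HasDerivAt.const_mul _ ?_
    unfold halfSymbol
    have h1 := ((hasDerivAt_id w).const_mul
      (2 * Real.pi * Complex.I * (inner ℝ ξ θ : ℝ))).cexp.mul_const
      ((2 * Real.pi * Complex.I * (inner ℝ ξ θ : ℝ)) ^ k * χ ξ)
    refine h1.congr_deriv ?_
    simp only [id]
    ring

theorem continuous_halfExt (hχ : RapidDecay χ) (hs : ∀ ξ, χ ξ ≠ 0 → 0 < inner ℝ ξ θ) (k : ℕ) :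
    Continuous fun p : V × ℝ => halfExt θ χ k p.1 (Complex.I * (max p.2 0 : ℝ)) := by
  have hm (x : V) : Continuous fun ξ : V => Complex.exp (2 * Real.pi * Complex.I *
      (inner ℝ ξ x : ℝ)) := by fun_prop
  simp only [halfExt_eq]
  refine continuous_of_dominated (bound := fun ξ =>
    ‖(2 * Real.pi * Complex.I * (inner ℝ ξ θ : ℝ)) ^ k * χ ξ‖) (fun p => ?_) (fun p => ?_)
    (hχ.inner_pow_mul θ k).integrable.norm ?_
  · exact (hm _).aestronglyMeasurable.mul (hχ.halfSymbol hs k (by simp)).meas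
  · refine Filter.Eventually.of_forall fun ξ => ?_
    rw [norm_mul, norm_expI, one_mul]
    exact norm_halfSymbol_le hs k (by simp) ξ
  · refine Filter.Eventually.of_forall fun ξ => ?_
    unfold halfSymbol
    fun_prop

theorem hasDerivAt_halfExt_time (hχ : RapidDecay χ) (hs : ∀ ξ, χ ξ ≠ 0 → 0 < inner ℝ ξ θ) (k : ℕ)
    (x : V) {t : ℝ} (ht : 0 < t) :
    HasDerivAt (fun t : ℝ => halfExt θ χ k x (Complex.I * (max t 0 : ℝ)))
      (Complex.I * halfExt θ χ (k + 1) x (Complex.I * (max t 0 : ℝ))) t := by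
  have h0 : HasDerivAt (fun t : ℝ => Complex.I * (t : ℂ)) (Complex.I * 1) t :=
    Complex.ofRealCLM.hasDerivAt.const_mul Complex.I
  have h1 := (hasDerivAt_halfExt hχ hs k x (z := Complex.I * t) (by simpa)).comp_of_eq t h0 rfl
  rw [max_eq_left ht.le]
  refine HasDerivAt.congr_of_eventuallyEq (h1.congr_deriv (by ring)) ?_
  filter_upwards [lt_mem_nhds ht] with s hs
  simp [max_eq_left (le_of_lt hs)]

theorem hasLineDerivAt_halfExt (hχ : RapidDecay χ) (hs : ∀ ξ, χ ξ ≠ 0 → 0 < inner ℝ ξ θ) (k : ℕ)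
    (x : V) {t : ℝ} (ht : 0 < t) :
    HasLineDerivAt ℝ (fun x => halfExt θ χ k x (Complex.I * (max t 0 : ℝ)))
      (halfExt θ χ (k + 1) x (Complex.I * (max t 0 : ℝ))) x θ := by
  unfold HasLineDerivAt
  simp only [halfExt_add_smul]
  have h0 : HasDerivAt (fun s : ℝ => Complex.I * (max t 0 : ℝ) + (s : ℂ)) 1 0 :=
    Complex.ofRealCLM.hasDerivAt.const_add _
  have h1 := (hasDerivAt_halfExt hχ hs k x (z := Complex.I * (max t 0 : ℝ)) (by simpa)).comp_of_eq
    (0 : ℝ) h0 (by simp)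
  exact h1.congr_deriv (by simp)

end HalfSpace

section HalfSpace

variable {V : Type*} [NormedAddCommGroup V] [InnerProductSpace ℝ V] [FiniteDimensional ℝ V]
  [MeasurableSpace V] [BorelSpace V] {θ : V} {χ : V → ℂ}

/-- The `k`-th directional derivative of the Poisson-type extension of `𝓕⁻ χ`. -/
noncomputable def poissonExt (θ : V) (χ : V → ℂ) (k : ℕ) (x : V) (t : ℝ) : ℂ :=
  halfExt θ χ k x (Complex.I * (max t 0 : ℝ))

theorem exists_norm_poissonExt_le (hχ : RapidDecay χ) (hs : ∀ ξ, χ ξ ≠ 0 → 0 < inner ℝ ξ θ)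
    (k : ℕ) : ∃ B, ∀ x t, ‖poissonExt θ χ k x t‖ ≤ B := by
  refine ⟨_, fun x t => (norm_fourierInv_le _).trans
    (integral_mono (hχ.halfSymbol hs k (by simp)).integrable.norm
    (hχ.inner_pow_mul θ k).integrable.norm fun ξ => norm_halfSymbol_le hs k (by simp) ξ)⟩

theorem memLp_poissonExt (hχ : RapidDecay χ) (hs : ∀ ξ, χ ξ ≠ 0 → 0 < inner ℝ ξ θ)
    (k : ℕ) (t : ℝ) : MemLp (fun x => poissonExt θ χ k x t) 2 :=
  memLp_two_fourierInv (hχ.halfSymbol hs k (by simp)).integrable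
    (hχ.halfSymbol hs k (by simp)).memLp_two

theorem integral_sq_poissonExt (hχ : RapidDecay χ) (hs : ∀ ξ, χ ξ ≠ 0 → 0 < inner ℝ ξ θ)
    (k : ℕ) (t : ℝ) : ∫ x, ‖poissonExt θ χ k x t‖ ^ 2 =
      ∫ ξ, ‖halfSymbol θ χ k (Complex.I * (max t 0 : ℝ)) ξ‖ ^ 2 :=
  integral_sq_fourierInv (hχ.halfSymbol hs k (by simp)).integrable
    (hχ.halfSymbol hs k (by simp)).memLp_two

theorem integrable_sq_poissonExt (hχ : RapidDecay χ) (hs : ∀ ξ, χ ξ ≠ 0 → 0 < inner ℝ ξ θ)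
    (k : ℕ) (t : ℝ) : Integrable fun x => ‖poissonExt θ χ k x t‖ ^ 2 :=
  (memLp_two_iff_integrable_sq_norm (memLp_poissonExt hχ hs k t).1).1 (memLp_poissonExt hχ hs k t)

theorem continuous_poissonExt (hχ : RapidDecay χ) (hs : ∀ ξ, χ ξ ≠ 0 → 0 < inner ℝ ξ θ)
    (k : ℕ) : Continuous fun p : V × ℝ => poissonExt θ χ k p.1 p.2 :=
  continuous_halfExt hχ hs k

theorem continuous_poissonExt_space (hχ : RapidDecay χ) (hs : ∀ ξ, χ ξ ≠ 0 → 0 < inner ℝ ξ θ)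
    (k : ℕ) (t : ℝ) : Continuous fun x => poissonExt θ χ k x t := by
  have h1 : Continuous fun x : V => (x, t) := by fun_prop
  have h2 := (continuous_poissonExt hχ hs k).comp h1
  exact h2

theorem continuous_poissonExt_time (hχ : RapidDecay χ) (hs : ∀ ξ, χ ξ ≠ 0 → 0 < inner ℝ ξ θ)
    (k : ℕ) (x : V) : Continuous fun t => poissonExt θ χ k x t := by
  have h1 : Continuous fun t : ℝ => (x, t) := by fun_prop
  have h2 := (continuous_poissonExt hχ hs k).comp h1
  exact h2

theorem integrable_prod_sq_poissonExt (hχ : RapidDecay χ) (hs : ∀ ξ, χ ξ ≠ 0 → 0 < inner ℝ ξ θ)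
    (k : ℕ) (a b : ℝ) : Integrable (fun p : V × ℝ => ‖poissonExt θ χ k p.1 p.2‖ ^ 2)
      (volume.prod (volume.restrict (Set.Ioc a b))) := by
  have hc : Continuous fun p : V × ℝ => ‖poissonExt θ χ k p.1 p.2‖ ^ 2 :=
    (continuous_poissonExt hχ hs k).norm.pow 2
  have hm := hc.aestronglyMeasurable (μ := (volume : Measure V).prod
    (volume.restrict (Set.Ioc a b)))
  rw [integrable_prod_iff' hm]
  refine ⟨Filter.Eventually.of_forall fun t => integrable_sq_poissonExt hχ hs k t, ?_⟩
  refine Integrable.mono' (g := fun _ => ∫ ξ, ‖(2 * Real.pi * Complex.I * (inner ℝ ξ θ : ℝ)) ^ k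
    * χ ξ‖ ^ 2) (integrable_const _) hm.norm.prod_swap.integral_prod_right' ?_
  refine Filter.Eventually.of_forall fun t => ?_
  have hn : (0 : ℝ) ≤ ∫ x, ‖poissonExt θ χ k x t‖ ^ 2 := by positivity
  simp only [norm_pow, norm_norm]
  rw [Real.norm_of_nonneg hn, integral_sq_poissonExt hχ hs k t]
  refine integral_mono ((memLp_two_iff_integrable_sq_norm (hχ.halfSymbol hs k (by simp)).meas).1
    (hχ.halfSymbol hs k (by simp)).memLp_two) ((memLp_two_iff_integrable_sq_norm
    (hχ.inner_pow_mul θ k).meas).1 (hχ.inner_pow_mul θ k).memLp_two) fun ξ => ?_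
  dsimp only
  gcongr
  exact norm_halfSymbol_le hs k (by simp) ξ

theorem tendsto_integral_sq_poissonExt (hχ : RapidDecay χ)
    (hs : ∀ ξ, χ ξ ≠ 0 → 0 < inner ℝ ξ θ) :
    Filter.Tendsto (fun t => ∫ x, ‖poissonExt θ χ 0 x t‖ ^ 2) Filter.atTop (nhds 0) := by
  simp only [integral_sq_poissonExt hχ hs]
  rw [show nhds (0 : ℝ) = nhds (∫ _ : V, (0 : ℝ)) by simp]
  refine tendsto_integral_filter_of_dominated_convergence (fun ξ => ‖χ ξ‖ ^ 2) ?_ ?_ ?_ ?_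
  · exact Filter.Eventually.of_forall fun t => (hχ.halfSymbol hs 0 (by simp)).meas.norm.pow 2
  · refine Filter.Eventually.of_forall fun t => Filter.Eventually.of_forall fun ξ => ?_
    rw [norm_pow, norm_norm]
    gcongr
    simpa using norm_halfSymbol_le hs 0 (z := Complex.I * (max t 0 : ℝ)) (by simp) ξ
  · exact (memLp_two_iff_integrable_sq_norm hχ.meas).1 hχ.memLp_two
  · refine Filter.Eventually.of_forall fun ξ => ?_
    by_cases h : χ ξ = 0
    · simp [halfSymbol, h]
    · have hp := hs ξ h
      have e : ∀ t : ℝ, ‖halfSymbol θ χ 0 (Complex.I * (max t 0 : ℝ)) ξ‖ ^ 2 =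
          (Real.exp (-(2 * Real.pi * (inner ℝ ξ θ * max t 0))) * ‖χ ξ‖) ^ 2 := fun t => by
        rw [halfSymbol, norm_mul, norm_exp_half]
        simp
      simp only [e]
      have h1 : Filter.Tendsto (fun t : ℝ => 2 * Real.pi * (inner ℝ ξ θ * max t 0)) Filter.atTop
          Filter.atTop :=
        Filter.Tendsto.const_mul_atTop (by positivity) (Filter.Tendsto.const_mul_atTop hp
          (Filter.tendsto_atTop_mono (fun t => le_max_left t 0) Filter.tendsto_id))
      have h2 := ((Real.tendsto_exp_neg_atTop_nhds_zero.comp h1).mul_const ‖χ ξ‖).pow 2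
      simpa using h2

theorem poissonExt_zero (x : V) : poissonExt θ χ 0 x 0 = 𝓕⁻ χ x := by
  simp only [poissonExt, halfExt]
  have : halfSymbol θ χ 0 (Complex.I * (max 0 0 : ℝ)) = χ := funext fun ξ => by simp [halfSymbol]
  rw [this]

set_option maxHeartbeats 2000000 in
/-- A `C²` function on `ℂ` whose Hessian has nonpositive trace on complex lines integrates to
a nonpositive number along inverse Fourier transforms supported in a half-space. -/
theorem integral_comp_fourierInv_nonpos (hχ : RapidDecay χ)
    (hs : ∀ ξ, χ ξ ≠ 0 → 0 < inner ℝ ξ θ) {G : ℂ → ℝ} {Γ : ℂ → ℂ} {L : ℂ → ℂ →L[ℝ] ℂ}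
    (hG : ∀ ζ, HasFDerivAt G (innerSL ℝ (Γ ζ)) ζ) (hΓ : ∀ ζ, HasFDerivAt Γ (L ζ) ζ)
    (hL : Continuous L) (hG0 : G 0 = 0) (hΓ0 : Γ 0 = 0)
    (hneg : ∀ ζ v, inner ℝ (L ζ v) v + inner ℝ (L ζ (Complex.I * v)) (Complex.I * v) ≤ 0) :
    ∫ x, G (𝓕⁻ χ x) ≤ 0 := by
  obtain ⟨B, hB⟩ := exists_norm_poissonExt_le hχ hs 0
  have hB0 : 0 ≤ B := (norm_nonneg _).trans (hB 0 0)
  obtain ⟨K, hK⟩ := (isCompact_closedBall (0 : ℂ) B).exists_bound_of_continuousOn hL.continuousOn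
  have hKn : 0 ≤ K := (norm_nonneg _).trans (hK 0 (by simpa))
  have hΓK : ∀ ζ ∈ closedBall (0 : ℂ) B, ‖Γ ζ‖ ≤ K * ‖ζ‖ := fun ζ hζ => by
    have := (convex_closedBall (0 : ℂ) B).norm_image_sub_le_of_norm_hasFDerivWithin_le
      (fun z hz => (hΓ z).hasFDerivWithinAt) hK (mem_closedBall_self hB0) hζ
    simpa [hΓ0] using this
  have hGK : ∀ ζ ∈ closedBall (0 : ℂ) B, ‖G ζ‖ ≤ K * ‖ζ‖ ^ 2 := fun ζ hζ => by
    have hsub : closedBall (0 : ℂ) ‖ζ‖ ⊆ closedBall (0 : ℂ) B :=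
      closedBall_subset_closedBall (by simpa using hζ)
    have hb : ∀ z ∈ closedBall (0 : ℂ) ‖ζ‖, ‖Γ z‖ ≤ K * ‖ζ‖ := fun z hz =>
      (hΓK z (hsub hz)).trans (mul_le_mul_of_nonneg_left (by simpa using hz) hKn)
    have hb' : ∀ z ∈ closedBall (0 : ℂ) ‖ζ‖, ‖(innerSL ℝ (Γ z) : ℂ →L[ℝ] ℝ)‖ ≤ K * ‖ζ‖ :=
      fun z hz => (innerSL_apply_norm (𝕜 := ℝ) (Γ z)).trans_le (hb z hz)
    have := (convex_closedBall (0 : ℂ) ‖ζ‖).norm_image_sub_le_of_norm_hasFDerivWithin_le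
      (fun z hz => (hG z).hasFDerivWithinAt) hb' (mem_closedBall_self (norm_nonneg _))
      (y := ζ) (by simp)
    simpa [hG0, sq, mul_assoc] using this
  have hmem : ∀ x t, poissonExt θ χ 0 x t ∈ closedBall (0 : ℂ) B := fun x t => by
    simpa using hB x t
  have hGc : Continuous G := continuous_iff_continuousAt.2 fun z => (hG z).continuousAt
  have hΓc : Continuous Γ := continuous_iff_continuousAt.2 fun z => (hΓ z).continuousAt
  have hcD := fun k => continuous_poissonExt hχ hs k
  have hcx := fun k t => continuous_poissonExt_space hχ hs k t
  have hct := fun k x => continuous_poissonExt_time hχ hs k x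
  set D : ℕ → V → ℝ → ℂ := poissonExt θ χ with hD
  have hsq : ∀ k t, Integrable fun x => ‖D k x t‖ ^ 2 := fun k t =>
    integrable_sq_poissonExt hχ hs k t
  -- pointwise bounds
  have bG : ∀ x t, ‖G (D 0 x t)‖ ≤ K * ‖D 0 x t‖ ^ 2 := fun x t => hGK _ (hmem x t)
  have bI : ∀ (x : V) (t : ℝ) (w : ℂ), ‖(inner ℝ (Γ (D 0 x t)) w : ℝ)‖ ≤
      K * (‖D 0 x t‖ ^ 2 + ‖w‖ ^ 2) := fun x t w => by
    refine (norm_inner_le_norm _ _).trans ?_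
    calc ‖Γ (D 0 x t)‖ * ‖w‖ ≤ K * ‖D 0 x t‖ * ‖w‖ := by gcongr; exact hΓK _ (hmem x t)
      _ = K * (‖D 0 x t‖ * ‖w‖) := by ring
      _ ≤ _ := by
        gcongr
        nlinarith [sq_nonneg (‖D 0 x t‖ - ‖w‖), sq_nonneg (‖D 0 x t‖), sq_nonneg (‖w‖)]
  have bL : ∀ (x : V) (t : ℝ) (v w : ℂ), ‖(inner ℝ (L (D 0 x t) v) w : ℝ)‖ ≤
      K * (‖v‖ ^ 2 + ‖w‖ ^ 2) := fun x t v w => by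
    refine (norm_inner_le_norm _ _).trans ?_
    calc ‖L (D 0 x t) v‖ * ‖w‖ ≤ K * ‖v‖ * ‖w‖ := by
          gcongr; exact (L (D 0 x t)).le_of_opNorm_le (hK _ (hmem x t)) v
      _ = K * (‖v‖ * ‖w‖) := by ring
      _ ≤ _ := by
        gcongr
        nlinarith [sq_nonneg (‖v‖ - ‖w‖), sq_nonneg (‖v‖), sq_nonneg (‖w‖)]
  -- integrability at fixed time
  have iG : ∀ t, Integrable fun x => G (D 0 x t) := fun t =>
    ((hsq 0 t).const_mul K).mono' (hGc.comp (hcx 0 t)).aestronglyMeasurable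
      (Filter.Eventually.of_forall fun x => bG x t)
  have iI : ∀ k t (c : ℂ), ‖c‖ = 1 → Integrable fun x =>
      (inner ℝ (Γ (D 0 x t)) (c * D k x t) : ℝ) :=
    fun k t c hc => (((hsq 0 t).add (hsq k t)).const_mul K).mono'
      ((hΓc.comp (hcx 0 t)).inner (continuous_const.mul (hcx k t))).aestronglyMeasurable
      (Filter.Eventually.of_forall fun x => by simpa [hc] using bI x t (c * D k x t))
  have iL : ∀ t (c : ℂ), ‖c‖ = 1 → Integrable fun x =>
      (inner ℝ (L (D 0 x t) (c * D 1 x t)) (c * D 1 x t) : ℝ) :=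
    fun t c hc => (((hsq 1 t).add (hsq 1 t)).const_mul K).mono'
      (((hL.comp (hcx 0 t)).clm_apply (continuous_const.mul (hcx 1 t))).inner
        (continuous_const.mul (hcx 1 t))).aestronglyMeasurable
      (Filter.Eventually.of_forall fun x => by
        simpa [hc] using bL x t (c * D 1 x t) (c * D 1 x t))
  -- derivatives in time
  have dD : ∀ k x t, 0 < t → HasDerivAt (D k x) (Complex.I * D (k + 1) x t) t :=
    fun k x t ht => hasDerivAt_halfExt_time hχ hs k x ht
  have dG : ∀ x t, 0 < t → HasDerivAt (fun t => G (D 0 x t))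
      (inner ℝ (Γ (D 0 x t)) (Complex.I * D 1 x t)) t := fun x t ht =>
    (hG _).comp_hasDerivAt t (dD 0 x t ht)
  have dI : ∀ x t, 0 < t → HasDerivAt
      (fun t => (inner ℝ (Γ (D 0 x t)) (Complex.I * D 1 x t) : ℝ))
      (inner ℝ (L (D 0 x t) (Complex.I * D 1 x t)) (Complex.I * D 1 x t) +
        inner ℝ (Γ (D 0 x t)) (-1 * D 2 x t)) t := fun x t ht => by
    have h1 := ((hΓ _).comp_hasDerivAt t (dD 0 x t ht)).inner ℝ
      ((dD 1 x t ht).const_mul Complex.I)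
    refine h1.congr_deriv ?_
    rw [← mul_assoc, Complex.I_mul_I, add_comm]
    rfl
  set φ : ℝ → ℝ := fun t => ∫ x, G (D 0 x t) with hφ
  set ψ : ℝ → ℝ := fun t => ∫ x, (inner ℝ (Γ (D 0 x t)) (Complex.I * D 1 x t) : ℝ) with hψ
  have pI : ∀ (k : ℕ) (c : ℂ), ‖c‖ = 1 → ∀ a b, Integrable (fun p : V × ℝ =>
      (inner ℝ (Γ (D 0 p.1 p.2)) (c * D k p.1 p.2) : ℝ))
      (volume.prod (volume.restrict (Set.Ioc a b))) := fun k c hc a b =>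
    (((integrable_prod_sq_poissonExt hχ hs 0 a b).add
      (integrable_prod_sq_poissonExt hχ hs k a b)).const_mul K).mono'
      ((hΓc.comp (hcD 0)).inner (continuous_const.mul (hcD k))).aestronglyMeasurable
      (Filter.Eventually.of_forall fun p => by
        simpa [hc] using bI p.1 p.2 (c * D k p.1 p.2))
  have pL : ∀ a b, Integrable (fun p : V × ℝ =>
      (inner ℝ (L (D 0 p.1 p.2) (Complex.I * D 1 p.1 p.2)) (Complex.I * D 1 p.1 p.2) : ℝ))
      (volume.prod (volume.restrict (Set.Ioc a b))) := fun a b =>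
    (((integrable_prod_sq_poissonExt hχ hs 1 a b).add
      (integrable_prod_sq_poissonExt hχ hs 1 a b)).const_mul K).mono'
      (((hL.comp (hcD 0)).clm_apply (continuous_const.mul (hcD 1))).inner
        (continuous_const.mul (hcD 1))).aestronglyMeasurable
      (Filter.Eventually.of_forall fun p => by
        simpa using bL p.1 p.2 (Complex.I * D 1 p.1 p.2) (Complex.I * D 1 p.1 p.2))
  have fφ : ∀ a b, 0 ≤ a → a ≤ b → φ b - φ a = ∫ t in a..b, ψ t := fun a b ha hab =>
    integral_sub_integral_eq_intervalIntegral hab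
      (fun x => (hGc.comp (hct 0 x)).continuousOn)
      (fun x t ht => dG x t (ha.trans_lt ht.1))
      (pI 1 Complex.I (by simp) a b) (iG a) (iG b)
  have fψ : ∀ a b, 0 ≤ a → a ≤ b → ψ b - ψ a = ∫ t in a..b, ∫ x,
      ((inner ℝ (L (D 0 x t) (Complex.I * D 1 x t)) (Complex.I * D 1 x t) : ℝ) +
        inner ℝ (Γ (D 0 x t)) (-1 * D 2 x t)) := fun a b ha hab =>
    integral_sub_integral_eq_intervalIntegral hab
      (fun x => ((hΓc.comp (hct 0 x)).inner (continuous_const.mul (hct 1 x))).continuousOn)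
      (fun x t ht => dI x t (ha.trans_lt ht.1))
      ((pL a b).add (pI 2 (-1) (by simp) a b)) (iI 1 a _ (by simp)) (iI 1 b _ (by simp))
  have key : ∀ t, 0 < t → ∫ x,
      ((inner ℝ (L (D 0 x t) (Complex.I * D 1 x t)) (Complex.I * D 1 x t) : ℝ) +
        inner ℝ (Γ (D 0 x t)) (-1 * D 2 x t)) ≤ 0 := fun t ht => by
    have hx : ∀ k x, HasLineDerivAt ℝ (fun x => D k x t) (D (k + 1) x t) x θ := fun k x =>
      hasLineDerivAt_halfExt hχ hs k x ht
    have hxΓ : ∀ x, HasLineDerivAt ℝ (fun x => Γ (D 0 x t)) (L (D 0 x t) (D 1 x t)) x θ :=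
      fun x => by
      have h1 := hx 0 x
      unfold HasLineDerivAt at h1 ⊢
      exact (hΓ _).comp_hasDerivAt_of_eq (0 : ℝ) h1 (by simp)
    have j1 := iL t 1 (by simp)
    have j2 := iI 2 t 1 (by simp)
    have j3 := iI 1 t 1 (by simp)
    simp only [one_mul] at j1 j2 j3
    have ibp : ∫ x, (inner ℝ (Γ (D 0 x t)) (D 2 x t) : ℝ) =
        -∫ x, (inner ℝ (L (D 0 x t) (D 1 x t)) (D 1 x t) : ℝ) :=
      integral_bilinear_hasLineDerivAt_right_eq_neg_left_of_integrable
      (μ := (volume : Measure V))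
      (f := fun x => Γ (D 0 x t)) (g := fun x => D 1 x t) (B := innerSL ℝ)
      (v := θ) (f' := fun x => L (D 0 x t) (D 1 x t)) (g' := fun x => D 2 x t)
      j1 j2 j3 (fun x _ => hxΓ x) (fun x _ => hx 1 x)
    have i2 := iI 2 t (-1) (by simp)
    rw [integral_add (iL t _ (by simp)) i2]
    have e : ∫ x, (inner ℝ (Γ (D 0 x t)) (-1 * D 2 x t) : ℝ) =
        ∫ x, (inner ℝ (L (D 0 x t) (D 1 x t)) (D 1 x t) : ℝ) := by
      simp only [neg_one_mul, inner_neg_right]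
      rw [integral_neg, ibp, neg_neg]
    rw [e, ← integral_add (iL t _ (by simp)) j1]
    refine integral_nonpos fun x => ?_
    have := hneg (D 0 x t) (D 1 x t)
    simp only [Pi.zero_apply]
    linarith
  have hanti : ∀ a b, 0 ≤ a → a ≤ b → ψ b ≤ ψ a := fun a b ha hab => by
    have h1 := fψ a b ha hab
    rw [intervalIntegral.integral_of_le hab] at h1
    have h2 := setIntegral_nonpos (μ := (volume : Measure ℝ)) (measurableSet_Ioc (a := a) (b := b))
      fun t ht => key t (ha.trans_lt ht.1)
    linarith
  have hψi : ∀ a b, 0 ≤ a → a ≤ b → IntervalIntegrable ψ volume a b := fun a b ha hab => by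
    refine AntitoneOn.intervalIntegrable fun s hs t ht hst => hanti s t ?_ hst
    rw [Set.uIcc_of_le hab] at hs
    exact ha.trans hs.1
  have hφ0 : Filter.Tendsto φ Filter.atTop (nhds 0) := by
    have h1 := (tendsto_integral_sq_poissonExt hχ hs).const_mul K
    rw [mul_zero] at h1
    refine squeeze_zero_norm (fun t => ?_) h1
    rw [← integral_const_mul]
    exact norm_integral_le_of_norm_le ((hsq 0 t).const_mul K)
      (Filter.Eventually.of_forall fun x => bG x t)
  have hψ0 : ∀ t, 0 < t → 0 ≤ ψ t := fun t ht => by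
    by_contra! hlt
    have h1 : ∀ b, t ≤ b → φ b ≤ φ t + (b - t) * ψ t := fun b hb => by
      have h2 := fφ t b ht.le hb
      have h3 := intervalIntegral.integral_mono_on hb (hψi t b ht.le hb)
        (intervalIntegrable_const (c := ψ t)) fun s hs => hanti t s ht.le hs.1
      rw [intervalIntegral.integral_const, smul_eq_mul] at h3
      linarith
    have h4 : Filter.Tendsto (fun b => φ t + (b - t) * ψ t) Filter.atTop Filter.atBot :=
      Filter.tendsto_atBot_add_const_left _ _ ((Filter.tendsto_atTop_add_const_right _ (-t)
        Filter.tendsto_id).atTop_mul_const_of_neg hlt)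
    have h5 : Filter.Tendsto φ Filter.atTop Filter.atBot :=
      Filter.tendsto_atBot_mono' _ (Filter.eventually_atTop.2 ⟨t, h1⟩) h4
    exact not_tendsto_nhds_of_tendsto_atBot h5 0 hφ0
  have hmono : ∀ b, 0 ≤ b → φ 0 ≤ φ b := fun b hb => by
    have h1 := fφ 0 b le_rfl hb
    rw [intervalIntegral.integral_of_le hb] at h1
    have h2 := setIntegral_nonneg (μ := (volume : Measure ℝ)) (measurableSet_Ioc (a := 0) (b := b))
      fun t ht => hψ0 t ht.1
    linarith
  have hfin : φ 0 ≤ 0 := ge_of_tendsto hφ0 (Filter.eventually_atTop.2 ⟨0, hmono⟩)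
  simpa only [hφ, hD, poissonExt_zero] using hfin

end HalfSpace

section Potentials

variable {ε : ℝ}

theorem hasFDerivAt_rpow_add_norm_sq (hε : 0 < ε) (β : ℝ) (ζ : ℂ) :
    HasFDerivAt (fun ζ : ℂ => (ε + ‖ζ‖ ^ 2) ^ β)
      (innerSL ℝ ((2 * β * (ε + ‖ζ‖ ^ 2) ^ (β - 1)) • ζ)) ζ := by
  have h1 : HasFDerivAt (fun ζ : ℂ => ε + ‖ζ‖ ^ 2) (2 • innerSL ℝ ζ) ζ :=
    (hasStrictFDerivAt_norm_sq ζ).hasFDerivAt.const_add ε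
  have h2 := h1.rpow_const (p := β) (Or.inl (by positivity))
  refine h2.congr_fderiv ?_
  ext v
  simp
  ring

theorem hasFDerivAt_rpow_add_re_sq (hε : 0 < ε) (β : ℝ) (ζ : ℂ) :
    HasFDerivAt (fun ζ : ℂ => (ε + ζ.re ^ 2) ^ β)
      (innerSL ℝ ((2 * β * (ε + ζ.re ^ 2) ^ (β - 1) * ζ.re) • (1 : ℂ))) ζ := by
  have h1 : HasFDerivAt (fun ζ : ℂ => ε + ζ.re ^ 2) ((2 * ζ.re ^ 1) • Complex.reCLM) ζ := by
    simpa using! (Complex.reCLM.hasFDerivAt.pow 2).const_add ε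
  have h2 := h1.rpow_const (p := β) (Or.inl (by positivity))
  refine h2.congr_fderiv ?_
  ext v
  simp
  ring

theorem hasFDerivAt_re_sq (ζ : ℂ) :
    HasFDerivAt (fun ζ : ℂ => ζ.re ^ 2) (innerSL ℝ ((2 * ζ.re) • (1 : ℂ))) ζ := by
  refine (Complex.reCLM.hasFDerivAt.pow 2).congr_fderiv ?_
  ext v
  simp
  ring

theorem ofReal_sq_re (x : ℝ) : ((x : ℂ) ^ 2).re = x ^ 2 := by norm_cast

theorem ofReal_sq_im (x : ℝ) : ((x : ℂ) ^ 2).im = 0 := by norm_cast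

end Potentials

section HalfSpace

variable {V : Type*} [NormedAddCommGroup V] [InnerProductSpace ℝ V] [FiniteDimensional ℝ V]
  [MeasurableSpace V] [BorelSpace V] {θ : V} {χ : V → ℂ}

theorem integral_rpow_sub_nonpos_of_le_two (hχ : RapidDecay χ)
    (hs : ∀ ξ, χ ξ ≠ 0 → 0 < inner ℝ ξ θ) {α ε : ℝ} (hα : 1 / 2 < α) (hα1 : α ≤ 1) (hε : 0 < ε) :
    ∫ x, ((ε + ‖𝓕⁻ χ x‖ ^ 2) ^ α - ε ^ α -
      2 / (2 * α - 1) * ((ε + (𝓕⁻ χ x).re ^ 2) ^ α - ε ^ α)) ≤ 0 := by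
  set A : ℝ := 2 / (2 * α - 1) with hA
  have hAα : A * (2 * α - 1) = 2 := div_mul_cancel₀ _ (by linarith)
  have hA0 : 0 < A := div_pos two_pos (by linarith)
  have hS : ∀ ζ : ℂ, ε + ‖ζ‖ ^ 2 ≠ 0 := fun ζ => by positivity
  have hU : ∀ ζ : ℂ, ε + ζ.re ^ 2 ≠ 0 := fun ζ => by positivity
  refine integral_comp_fourierInv_nonpos hχ hs
    (G := fun ζ => (ε + ‖ζ‖ ^ 2) ^ α - ε ^ α - A * ((ε + ζ.re ^ 2) ^ α - ε ^ α))
    (Γ := fun ζ => (2 * α * (ε + ‖ζ‖ ^ 2) ^ (α - 1)) • ζ -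
      (A * (2 * α * (ε + ζ.re ^ 2) ^ (α - 1) * ζ.re)) • (1 : ℂ))
    (L := fun ζ => (2 * α * (ε + ‖ζ‖ ^ 2) ^ (α - 1)) • ContinuousLinearMap.id ℝ ℂ +
      ((2 * α) • (innerSL ℝ ((2 * (α - 1) * (ε + ‖ζ‖ ^ 2) ^ (α - 1 - 1)) • ζ) : ℂ →L[ℝ]
          ℝ)).smulRight ζ
      - (A • ((2 * α * (ε + ζ.re ^ 2) ^ (α - 1)) • Complex.reCLM + ζ.re • ((2 * α) •
        (innerSL ℝ ((2 * (α - 1) * (ε + ζ.re ^ 2) ^ (α - 1 - 1) * ζ.re) • (1 : ℂ)) : ℂ →L[ℝ]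
            ℝ)))).smulRight 1)
    ?_ ?_ ?_ ?_ ?_ ?_
  · intro ζ
    refine (((hasFDerivAt_rpow_add_norm_sq hε α ζ).sub_const _).sub
      (((hasFDerivAt_rpow_add_re_sq hε α ζ).sub_const _).const_mul A)).congr_fderiv ?_
    ext v
    simp
    ring
  · intro ζ
    exact (((hasFDerivAt_rpow_add_norm_sq hε (α - 1) ζ).const_mul (2 * α)).smul
      (hasFDerivAt_id ζ)).sub (((((hasFDerivAt_rpow_add_re_sq hε (α - 1) ζ).const_mul (2 * α)).mul
      Complex.reCLM.hasFDerivAt).const_mul A).smul_const 1)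
  · have c1 : ∀ β : ℝ, Continuous fun ζ : ℂ => (ε + ‖ζ‖ ^ 2) ^ β := fun β =>
      Continuous.rpow_const (by fun_prop) fun ζ => Or.inl (hS ζ)
    have c2 : ∀ β : ℝ, Continuous fun ζ : ℂ => (ε + ζ.re ^ 2) ^ β := fun β =>
      Continuous.rpow_const (by fun_prop) fun ζ => Or.inl (hU ζ)
    have := c1 (α - 1)
    have := c1 (α - 1 - 1)
    have := c2 (α - 1)
    have := c2 (α - 1 - 1)
    fun_prop
  · simp
  · simp
  · intro ζ v
    have e1 : (ε + ‖ζ‖ ^ 2) ^ (α - 1) = (ε + ‖ζ‖ ^ 2) ^ (α - 1 - 1) * (ε + ‖ζ‖ ^ 2) := by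
      rw [← Real.rpow_add_one (hS ζ)]; ring_nf
    have e2 : (ε + ζ.re ^ 2) ^ (α - 1) = (ε + ζ.re ^ 2) ^ (α - 1 - 1) * (ε + ζ.re ^ 2) := by
      rw [← Real.rpow_add_one (hU ζ)]; ring_nf
    have e3 : (ε + ‖ζ‖ ^ 2) ^ (α - 1) ≤ (ε + ζ.re ^ 2) ^ (α - 1) := by
      refine Real.rpow_le_rpow_of_nonpos (by positivity) ?_ (by linarith)
      rw [Complex.sq_norm, Complex.normSq_apply]
      nlinarith [sq_nonneg ζ.im]
    have p1 : 0 < (ε + ‖ζ‖ ^ 2) ^ (α - 1 - 1) := by positivity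
    have p2 : 0 < (ε + ζ.re ^ 2) ^ (α - 1 - 1) := by positivity
    have p3 : 0 < (ε + ζ.re ^ 2) ^ (α - 1) := by positivity
    generalize (ε + ‖ζ‖ ^ 2) ^ (α - 1 - 1) = P at *
    generalize (ε + ζ.re ^ 2) ^ (α - 1 - 1) = Q at *
    generalize (ε + ‖ζ‖ ^ 2) ^ (α - 1) = P' at *
    generalize (ε + ζ.re ^ 2) ^ (α - 1) = Q' at *
    have goal : (v.re ^ 2 + v.im ^ 2) * (4 * α * P' + 4 * α * (α - 1) * P * (ζ.re ^ 2 + ζ.im ^ 2)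
      - A * (2 * α * Q' + 4 * α * (α - 1) * Q * ζ.re ^ 2)) ≤ 0 := by
      refine mul_nonpos_of_nonneg_of_nonpos (by positivity) ?_
      have q1 : 4 * α * (α - 1) * P * (ζ.re ^ 2 + ζ.im ^ 2) ≤ 0 := by
        have : 0 ≤ 4 * α * (1 - α) * P * (ζ.re ^ 2 + ζ.im ^ 2) := by
          have : 0 ≤ 1 - α := by linarith
          have : 0 ≤ α := by linarith
          positivity
        linarith
      have q2 : 2 * α * (2 * α - 1) * Q' ≤ 2 * α * Q' + 4 * α * (α - 1) * Q * ζ.re ^ 2 := by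
        have : 0 ≤ 4 * α * (1 - α) * Q * ε := by
          have : 0 ≤ 1 - α := by linarith
          have : 0 ≤ α := by linarith
          positivity
        rw [e2]
        nlinarith
      have q3 := mul_le_mul_of_nonneg_left q2 hA0.le
      have q4 : A * (2 * α * (2 * α - 1) * Q') = 4 * α * Q' := by
        calc _ = A * (2 * α - 1) * (2 * α * Q') := by ring
          _ = _ := by rw [hAα]; ring
      have q5 : 4 * α * P' ≤ 4 * α * Q' := by gcongr
      linarith
    refine le_of_eq_of_le ?_ goal
    simp [Complex.inner]
    ring

theorem integral_rpow_sub_nonpos_of_two_le (hχ : RapidDecay χ)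
    (hs : ∀ ξ, χ ξ ≠ 0 → 0 < inner ℝ ξ θ) {α ε : ℝ} (hα : 1 ≤ α) (hε : 0 < ε) :
    ∫ x, ((ε + ‖𝓕⁻ χ x‖ ^ 2) ^ α - ε ^ α -
      2 * α ^ 2 * ((ε + ‖𝓕⁻ χ x‖ ^ 2) ^ (α - 1) * (𝓕⁻ χ x).re ^ 2)) ≤ 0 := by
  set K : ℝ := 2 * α ^ 2 with hK
  have hS : ∀ ζ : ℂ, ε + ‖ζ‖ ^ 2 ≠ 0 := fun ζ => by positivity
  refine integral_comp_fourierInv_nonpos hχ hs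
    (G := fun ζ => (ε + ‖ζ‖ ^ 2) ^ α - ε ^ α - K * ((ε + ‖ζ‖ ^ 2) ^ (α - 1) * ζ.re ^ 2))
    (Γ := fun ζ => (2 * α * (ε + ‖ζ‖ ^ 2) ^ (α - 1)) • ζ -
      ((K * (2 * (α - 1)) * ((ε + ‖ζ‖ ^ 2) ^ (α - 1 - 1) * ζ.re ^ 2)) • ζ +
      (2 * K * ((ε + ‖ζ‖ ^ 2) ^ (α - 1) * ζ.re)) • (1 : ℂ)))
    (L := fun ζ => (2 * α * (ε + ‖ζ‖ ^ 2) ^ (α - 1)) • ContinuousLinearMap.id ℝ ℂ +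
      ((2 * α) • (innerSL ℝ ((2 * (α - 1) * (ε + ‖ζ‖ ^ 2) ^ (α - 1 - 1)) • ζ) : ℂ →L[ℝ]
          ℝ)).smulRight ζ
      - (((K * (2 * (α - 1)) * ((ε + ‖ζ‖ ^ 2) ^ (α - 1 - 1) * ζ.re ^ 2)) •
          ContinuousLinearMap.id ℝ ℂ +
        ((K * (2 * (α - 1))) • (((ε + ‖ζ‖ ^ 2) ^ (α - 1 - 1)) •
          (innerSL ℝ ((2 * ζ.re) • (1 : ℂ)) : ℂ →L[ℝ] ℝ) + ζ.re ^ 2 •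
          (innerSL ℝ ((2 * (α - 1 - 1) * (ε + ‖ζ‖ ^ 2) ^ (α - 1 - 1 - 1)) • ζ) : ℂ →L[ℝ]
              ℝ))).smulRight ζ) +
      ((2 * K) • (((ε + ‖ζ‖ ^ 2) ^ (α - 1)) • Complex.reCLM + ζ.re •
        (innerSL ℝ ((2 * (α - 1) * (ε + ‖ζ‖ ^ 2) ^ (α - 1 - 1)) • ζ) : ℂ →L[ℝ] ℝ))).smulRight 1))
    ?_ ?_ ?_ ?_ ?_ ?_
  · intro ζ
    refine (((hasFDerivAt_rpow_add_norm_sq hε α ζ).sub_const _).sub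
      (((hasFDerivAt_rpow_add_norm_sq hε (α - 1) ζ).mul (hasFDerivAt_re_sq ζ)).const_mul
        K)).congr_fderiv ?_
    ext v
    simp [ofReal_sq_re, ofReal_sq_im]
    ring
  · intro ζ
    exact (((hasFDerivAt_rpow_add_norm_sq hε (α - 1) ζ).const_mul (2 * α)).smul
      (hasFDerivAt_id ζ)).sub (((((hasFDerivAt_rpow_add_norm_sq hε (α - 1 - 1) ζ).mul
      (hasFDerivAt_re_sq ζ)).const_mul (K * (2 * (α - 1)))).smul (hasFDerivAt_id ζ)).add
      ((((hasFDerivAt_rpow_add_norm_sq hε (α - 1) ζ).mul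
      Complex.reCLM.hasFDerivAt).const_mul (2 * K)).smul_const 1))
  · have c1 : ∀ β : ℝ, Continuous fun ζ : ℂ => (ε + ‖ζ‖ ^ 2) ^ β := fun β =>
      Continuous.rpow_const (by fun_prop) fun ζ => Or.inl (hS ζ)
    have := c1 (α - 1)
    have := c1 (α - 1 - 1)
    have := c1 (α - 1 - 1 - 1)
    fun_prop
  · simp
  · simp
  · intro ζ v
    have e1 : (ε + ‖ζ‖ ^ 2) ^ (α - 1) = (ε + ‖ζ‖ ^ 2) ^ (α - 1 - 1) * (ε + ‖ζ‖ ^ 2) := by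
      rw [← Real.rpow_add_one (hS ζ)]; ring_nf
    have e2 : (ε + ‖ζ‖ ^ 2) ^ (α - 1 - 1) = (ε + ‖ζ‖ ^ 2) ^ (α - 1 - 1 - 1) * (ε + ‖ζ‖ ^ 2) := by
      rw [← Real.rpow_add_one (hS ζ)]; ring_nf
    have p1 : 0 < (ε + ‖ζ‖ ^ 2) ^ (α - 1 - 1 - 1) := by positivity
    have e3 : ‖ζ‖ ^ 2 = ζ.re ^ 2 + ζ.im ^ 2 := by
      rw [Complex.sq_norm, Complex.normSq_apply]; ring
    simp only [e1, e2]
    generalize (ε + ‖ζ‖ ^ 2) ^ (α - 1 - 1 - 1) = Q at *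
    rw [e3]
    have goal : (v.re ^ 2 + v.im ^ 2) * (Q * (4 * α * (ε + (ζ.re ^ 2 + ζ.im ^ 2)) ^ 2 +
      4 * α * (α - 1) * (ε + (ζ.re ^ 2 + ζ.im ^ 2)) * (ζ.re ^ 2 + ζ.im ^ 2) -
      K * (12 * (α - 1) * (ε + (ζ.re ^ 2 + ζ.im ^ 2)) * ζ.re ^ 2 + 4 * (α - 1) * (α - 2) *
      ζ.re ^ 2 * (ζ.re ^ 2 + ζ.im ^ 2) + 2 * (ε + (ζ.re ^ 2 + ζ.im ^ 2)) ^ 2))) ≤ 0 := by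
      refine mul_nonpos_of_nonneg_of_nonpos (by positivity)
        (mul_nonpos_of_nonneg_of_nonpos p1.le ?_)
      have hα1 : 0 ≤ α - 1 := by linarith
      set r := ζ.re ^ 2 + ζ.im ^ 2 with hr
      have hr0 : 0 ≤ r := by positivity
      have q1 : 4 * α * (α - 1) * (ε + r) * r ≤ 4 * α * (α - 1) * (ε + r) ^ 2 := by
        rw [sq, ← mul_assoc]; gcongr; linarith
      have q2 : 2 * (ε + r) ^ 2 ≤ 12 * (α - 1) * (ε + r) * ζ.re ^ 2 + 4 * (α - 1) * (α - 2) *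
          ζ.re ^ 2 * r + 2 * (ε + r) ^ 2 := by
        have a1 : 0 ≤ (α - 1) * ε * ζ.re ^ 2 := by positivity
        have a2 : 0 ≤ (α - 1) * r * ζ.re ^ 2 := by positivity
        have a3 : 0 ≤ (α - 1) * (α - 1) * r * ζ.re ^ 2 := by positivity
        nlinarith
      have q3 := mul_le_mul_of_nonneg_left q2 (show 0 ≤ K by positivity)
      have q4 : K * (2 * (ε + r) ^ 2) = 4 * α * (ε + r) ^ 2 + 4 * α * (α - 1) * (ε + r) ^ 2 := by
        rw [hK]; ring
      linarith
    refine le_of_eq_of_le ?_ goal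
    simp [Complex.inner, ofReal_sq_re, ofReal_sq_im]
    ring

end HalfSpace

section HalfSpace

theorem rpow_add_sub_le {α ε s : ℝ} (hα0 : 0 ≤ α) (hα1 : α ≤ 1) (hε : 0 < ε) (hs : 0 ≤ s) :
    (ε + s) ^ α - ε ^ α ≤ ε ^ (α - 1) * s := by
  have h := rpow_one_add_le_one_add_mul_self (s := s / ε) (by
    have : 0 ≤ s / ε := by positivity
    linarith) hα0 hα1
  have e : (ε + s) ^ α = ε ^ α * (1 + s / ε) ^ α := by
    rw [← Real.mul_rpow hε.le (by positivity)]
    congr 1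
    field_simp
  have e2 : ε ^ (α - 1) * s = ε ^ α * (s / ε) := by
    rw [Real.rpow_sub_one hε.ne']
    ring
  have h0 : 0 ≤ s / ε := by positivity
  have h2 : α * (s / ε) ≤ s / ε := mul_le_of_le_one_left h0 hα1
  have h3 : 0 < ε ^ α := by positivity
  rw [e, e2]
  nlinarith

theorem rpow_add_sub_nonneg {α ε s : ℝ} (hα0 : 0 ≤ α) (hε : 0 < ε) (hs : 0 ≤ s) :
    0 ≤ (ε + s) ^ α - ε ^ α :=
  sub_nonneg.2 (Real.rpow_le_rpow hε.le (by linarith) hα0)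

theorem sq_rpow_half {a α : ℝ} (ha : 0 ≤ a) : (a ^ 2) ^ α = a ^ (2 * α) := by
  rw [← Real.rpow_natCast, ← Real.rpow_mul ha]
  norm_num

variable {V : Type*} [NormedAddCommGroup V] [InnerProductSpace ℝ V] [FiniteDimensional ℝ V]
  [MeasurableSpace V] [BorelSpace V] {θ : V} {χ : V → ℂ}

theorem lintegral_rpow_fourierInv_le_of_le_two (hχ : RapidDecay χ)
    (hs : ∀ ξ, χ ξ ≠ 0 → 0 < inner ℝ ξ θ) {α : ℝ} (hα : 1 / 2 < α) (hα1 : α ≤ 1) :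
    ∫⁻ x, ENNReal.ofReal (‖𝓕⁻ χ x‖ ^ (2 * α)) ≤
      ENNReal.ofReal (2 / (2 * α - 1)) * ∫⁻ x, ENNReal.ofReal (|(𝓕⁻ χ x).re| ^ (2 * α)) := by
  set F : V → ℂ := 𝓕⁻ χ with hF
  set A : ℝ := 2 / (2 * α - 1) with hA
  have hA0 : 0 < A := div_pos two_pos (by linarith)
  have hFc : Continuous F := continuous_fourierInv_of_integrable hχ.integrable
  have hF2 : MemLp F 2 := memLp_two_fourierInv hχ.integrable hχ.memLp_two
  have hsq : Integrable fun x => ‖F x‖ ^ 2 := (memLp_two_iff_integrable_sq_norm hF2.1).1 hF2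
  have hα0 : 0 ≤ α := by linarith
  have hre : ∀ x, (F x).re ^ 2 ≤ ‖F x‖ ^ 2 := fun x => by
    rw [← sq_abs]
    gcongr
    exact Complex.abs_re_le_norm _
  have key : ∀ ε : ℝ, 0 < ε → ∫⁻ x, ENNReal.ofReal ((ε + ‖F x‖ ^ 2) ^ α - ε ^ α) ≤
      ENNReal.ofReal A * ∫⁻ x, ENNReal.ofReal (|(F x).re| ^ (2 * α)) := fun ε hε => by
    have h1 := integral_rpow_sub_nonpos_of_le_two hχ hs hα hα1 hε
    have i1 : Integrable fun x => (ε + ‖F x‖ ^ 2) ^ α - ε ^ α := by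
      refine (hsq.const_mul (ε ^ (α - 1))).mono' (Continuous.aestronglyMeasurable ?_)
        (Filter.Eventually.of_forall fun x => ?_)
      · exact (Continuous.rpow_const (by fun_prop) fun x => Or.inr hα0).sub continuous_const
      · rw [Real.norm_of_nonneg (rpow_add_sub_nonneg hα0 hε (by positivity))]
        exact rpow_add_sub_le hα0 hα1 hε (by positivity)
    have i2 : Integrable fun x => (ε + (F x).re ^ 2) ^ α - ε ^ α := by
      refine (hsq.const_mul (ε ^ (α - 1))).mono' (Continuous.aestronglyMeasurable ?_)
        (Filter.Eventually.of_forall fun x => ?_)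
      · exact (Continuous.rpow_const (by fun_prop) fun x => Or.inr hα0).sub continuous_const
      · rw [Real.norm_of_nonneg (rpow_add_sub_nonneg hα0 hε (by positivity))]
        exact (rpow_add_sub_le hα0 hα1 hε (by positivity)).trans
          (mul_le_mul_of_nonneg_left (hre x) (by positivity))
    rw [integral_sub i1 (i2.const_mul A), integral_const_mul, sub_nonpos] at h1
    rw [← ofReal_integral_eq_lintegral_ofReal i1 (Filter.Eventually.of_forall fun x =>
      rpow_add_sub_nonneg hα0 hε (by positivity))]
    refine (ENNReal.ofReal_le_ofReal h1).trans ?_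
    rw [ENNReal.ofReal_mul hA0.le, ofReal_integral_eq_lintegral_ofReal i2
      (Filter.Eventually.of_forall fun x => rpow_add_sub_nonneg hα0 hε (by positivity))]
    gcongr with x
    rw [← sq_rpow_half (abs_nonneg _), sq_abs, sub_le_iff_le_add, add_comm]
    have := Real.rpow_add_le_add_rpow (sq_nonneg (F x).re) hε.le hα0 hα1
    linarith
  have hlim : ∀ x, Filter.Tendsto (fun n : ℕ => ENNReal.ofReal
      ((1 / ((n : ℝ) + 1) + ‖F x‖ ^ 2) ^ α - (1 / ((n : ℝ) + 1)) ^ α)) Filter.atTop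
      (nhds (ENNReal.ofReal (‖F x‖ ^ (2 * α)))) := fun x => by
    have h0 := tendsto_one_div_add_atTop_nhds_zero_nat (𝕜 := ℝ)
    have h1 := (h0.add_const (‖F x‖ ^ 2)).rpow_const (p := α) (Or.inr hα0)
    have h2 := h0.rpow_const (p := α) (Or.inr hα0)
    have h3 := ENNReal.tendsto_ofReal (h1.sub h2)
    rwa [Real.zero_rpow (by linarith), sub_zero, zero_add, sq_rpow_half (norm_nonneg _)] at h3
  calc _ = ∫⁻ x, Filter.liminf (fun n : ℕ => ENNReal.ofReal
      ((1 / ((n : ℝ) + 1) + ‖F x‖ ^ 2) ^ α - (1 / ((n : ℝ) + 1)) ^ α)) Filter.atTop := by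
        simp only [fun x => (hlim x).liminf_eq]
    _ ≤ Filter.liminf (fun n : ℕ => ∫⁻ x, ENNReal.ofReal
      ((1 / ((n : ℝ) + 1) + ‖F x‖ ^ 2) ^ α - (1 / ((n : ℝ) + 1)) ^ α)) Filter.atTop := by
        refine lintegral_liminf_le fun n => ?_
        have hc := hFc.measurable
        fun_prop
    _ ≤ _ := by
        refine (Filter.liminf_le_liminf (Filter.Eventually.of_forall fun n : ℕ =>
          key (1 / ((n : ℝ) + 1)) (by positivity))).trans ?_
        simp

theorem rpow_add_sub_le_of_one_le {α ε s M : ℝ} (hα : 1 ≤ α) (hε : 0 ≤ ε) (hs : 0 ≤ s)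
    (hM : ε + s ≤ M) : (ε + s) ^ α - ε ^ α ≤ α * M ^ (α - 1) * s := by
  have h := (convex_Icc 0 M).norm_image_sub_le_of_norm_hasDerivWithin_le
    (f := fun x : ℝ => x ^ α) (f' := fun x => α * x ^ (α - 1)) (C := α * M ^ (α - 1))
    (x := ε) (y := ε + s)
    (fun x _ => (Real.hasDerivAt_rpow_const (Or.inr hα)).hasDerivWithinAt) (fun x hx => by
      rw [Real.norm_of_nonneg (by have := hx.1; positivity)]
      have := hx.1
      have := hx.2
      gcongr) ⟨hε, by linarith⟩ ⟨by linarith, hM⟩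
  rw [add_sub_cancel_left, Real.norm_of_nonneg hs] at h
  exact (le_abs_self _).trans h

theorem lintegral_rpow_fourierInv_le_of_two_le (hχ : RapidDecay χ)
    (hs : ∀ ξ, χ ξ ≠ 0 → 0 < inner ℝ ξ θ) {α : ℝ} (hα : 1 ≤ α) :
    ∫⁻ x, ENNReal.ofReal (‖𝓕⁻ χ x‖ ^ (2 * α)) ≤
      ENNReal.ofReal (2 * (2 * α ^ 2 * (2 * (2 * α ^ 2)) ^ (α - 1))) *
        ∫⁻ x, ENNReal.ofReal (|(𝓕⁻ χ x).re| ^ (2 * α)) := by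
  set F : V → ℂ := 𝓕⁻ χ with hF
  set K : ℝ := 2 * α ^ 2 with hK
  have hK0 : 0 < K := by positivity
  have hα0 : 0 ≤ α - 1 := by linarith
  have hFc : Continuous F := continuous_fourierInv_of_integrable hχ.integrable
  have hF2 : MemLp F 2 := memLp_two_fourierInv hχ.integrable hχ.memLp_two
  have hsq : Integrable fun x => ‖F x‖ ^ 2 := (memLp_two_iff_integrable_sq_norm hF2.1).1 hF2
  obtain ⟨B, hB⟩ : ∃ B, ∀ x, ‖F x‖ ≤ B := ⟨_, fun x => norm_fourierInv_le x⟩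
  have hre : ∀ x, (F x).re ^ 2 ≤ ‖F x‖ ^ 2 := fun x => by
    rw [← sq_abs]
    gcongr
    exact Complex.abs_re_le_norm _
  have hB2 : ∀ x, ‖F x‖ ^ 2 ≤ B ^ 2 := fun x => by gcongr; exact hB x
  set M : ℝ := 1 + B ^ 2 with hM
  have hM0 : 0 < M := by positivity
  have b1 : ∀ ε x, 0 ≤ ε → ε ≤ 1 → (ε + ‖F x‖ ^ 2) ^ α - ε ^ α ≤
      α * M ^ (α - 1) * ‖F x‖ ^ 2 := fun ε x h0 h1 =>
    rpow_add_sub_le_of_one_le hα h0 (by positivity) (add_le_add h1 (hB2 x))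
  have b2 : ∀ ε x, 0 ≤ ε → ε ≤ 1 → (ε + ‖F x‖ ^ 2) ^ (α - 1) * (F x).re ^ 2 ≤
      M ^ (α - 1) * ‖F x‖ ^ 2 := fun ε x h0 h1 =>
    mul_le_mul (Real.rpow_le_rpow (by positivity) (add_le_add h1 (hB2 x)) hα0) (hre x)
      (by positivity) (by positivity)
  have hlim1 : ∀ x, Filter.Tendsto (fun n : ℕ =>
      (1 / ((n : ℝ) + 1) + ‖F x‖ ^ 2) ^ α - (1 / ((n : ℝ) + 1)) ^ α -
      K * ((1 / ((n : ℝ) + 1) + ‖F x‖ ^ 2) ^ (α - 1) * (F x).re ^ 2)) Filter.atTop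
      (nhds (‖F x‖ ^ (2 * α) - K * (‖F x‖ ^ (2 * (α - 1)) * (F x).re ^ 2))) := fun x => by
    have h0 := tendsto_one_div_add_atTop_nhds_zero_nat (𝕜 := ℝ)
    have h1 := (h0.add_const (‖F x‖ ^ 2)).rpow_const (p := α) (Or.inr (by linarith))
    have h2 := h0.rpow_const (p := α) (Or.inr (by linarith))
    have h4 := (h0.add_const (‖F x‖ ^ 2)).rpow_const (p := α - 1) (Or.inr hα0)
    have h3 := (h1.sub h2).sub ((h4.mul_const ((F x).re ^ 2)).const_mul K)
    rwa [Real.zero_rpow (by linarith), sub_zero, zero_add, sq_rpow_half (norm_nonneg _),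
      sq_rpow_half (norm_nonneg _)] at h3
  have hn1 : ∀ n : ℕ, (0 : ℝ) < 1 / ((n : ℝ) + 1) := fun n => by positivity
  have hn2 : ∀ n : ℕ, 1 / ((n : ℝ) + 1) ≤ 1 := fun n => by
    rw [div_le_one (by positivity)]; linarith [n.cast_nonneg (α := ℝ)]
  have hlim := tendsto_integral_of_dominated_convergence (μ := (volume : Measure V))
    (F := fun (n : ℕ) x => (1 / ((n : ℝ) + 1) + ‖F x‖ ^ 2) ^ α - (1 / ((n : ℝ) + 1)) ^ α -
      K * ((1 / ((n : ℝ) + 1) + ‖F x‖ ^ 2) ^ (α - 1) * (F x).re ^ 2))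
    (fun x => (α * M ^ (α - 1) + K * M ^ (α - 1)) * ‖F x‖ ^ 2)
    (fun n : ℕ => Continuous.aestronglyMeasurable (μ := (volume : Measure V)) (((
      Continuous.rpow_const (f := fun x => 1 / ((n : ℝ) + 1) + ‖F x‖ ^ 2) (by fun_prop) fun x =>
        Or.inr (show 0 ≤ α by linarith)).sub continuous_const).sub
      (continuous_const.mul ((Continuous.rpow_const (by fun_prop) fun x => Or.inr hα0).mul
        (by fun_prop)))))
    (hsq.const_mul _) (fun n => Filter.Eventually.of_forall fun x => by
      have h1 := b1 _ x (hn1 n).le (hn2 n)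
      have h2 := b2 _ x (hn1 n).le (hn2 n)
      have h3 := rpow_add_sub_nonneg (α := α) (by linarith) (hn1 n) (sq_nonneg (‖F x‖))
      have h4 : 0 ≤ (1 / ((n : ℝ) + 1) + ‖F x‖ ^ 2) ^ (α - 1) * (F x).re ^ 2 := by positivity
      have h5 := mul_le_mul_of_nonneg_left h2 hK0.le
      have h6 := mul_nonneg hK0.le h4
      rw [Real.norm_eq_abs, abs_le]
      have h7 : 0 ≤ α * M ^ (α - 1) * ‖F x‖ ^ 2 := by positivity
      constructor <;> linarith) (Filter.Eventually.of_forall hlim1)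
  have hfin := le_of_tendsto hlim (Filter.Eventually.of_forall fun n : ℕ =>
    integral_rpow_sub_nonpos_of_two_le hχ hs hα (hn1 n))
  have hpc : ∀ β : ℝ, 0 ≤ β → Continuous fun x => ‖F x‖ ^ β := fun β hβ =>
    hFc.norm.rpow_const fun x => Or.inr hβ
  have i1 : Integrable fun x => ‖F x‖ ^ (2 * α) := by
    refine (hsq.const_mul (α * M ^ (α - 1))).mono' (hpc _ (by linarith)).aestronglyMeasurable
      (Filter.Eventually.of_forall fun x => ?_)
    rw [Real.norm_of_nonneg (by positivity)]
    have := b1 0 x le_rfl zero_le_one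
    rwa [Real.zero_rpow (by linarith), sub_zero, zero_add, sq_rpow_half (norm_nonneg _)] at this
  have i2 : Integrable fun x => ‖F x‖ ^ (2 * (α - 1)) * (F x).re ^ 2 := by
    refine (hsq.const_mul (M ^ (α - 1))).mono' ((hpc _ (by linarith)).mul
      (by fun_prop)).aestronglyMeasurable (Filter.Eventually.of_forall fun x => ?_)
    rw [Real.norm_of_nonneg (by positivity)]
    have := b2 0 x le_rfl zero_le_one
    rwa [zero_add, sq_rpow_half (norm_nonneg _)] at this
  have i3 : Integrable fun x => |(F x).re| ^ (2 * α) := by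
    refine i1.mono' (Continuous.aestronglyMeasurable ?_) (Filter.Eventually.of_forall fun x => ?_)
    · exact Continuous.rpow_const (by fun_prop) fun x => Or.inr (by linarith)
    · rw [Real.norm_of_nonneg (by positivity)]
      gcongr
      exact Complex.abs_re_le_norm _
  have pw : ∀ x, K * (‖F x‖ ^ (2 * (α - 1)) * (F x).re ^ 2) ≤
      ‖F x‖ ^ (2 * α) / 2 + K * (2 * K) ^ (α - 1) * |(F x).re| ^ (2 * α) := fun x => by
    rw [← sq_rpow_half (norm_nonneg _), ← sq_rpow_half (norm_nonneg _),
      ← sq_rpow_half (abs_nonneg _), sq_abs]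
    have hF0 : 0 ≤ ‖F x‖ ^ 2 := by positivity
    have hu0 : 0 ≤ (F x).re ^ 2 := by positivity
    generalize ‖F x‖ ^ 2 = a at *
    generalize (F x).re ^ 2 = u at *
    have e : ∀ b : ℝ, 0 ≤ b → b ^ α = b ^ (α - 1) * b := fun b hb => by
      have := Real.rpow_add_one' hb (y := α - 1) (by linarith)
      rwa [sub_add_cancel] at this
    by_cases hc : K * u ≤ a / 2
    · have : a ^ (α - 1) * (K * u) ≤ a ^ (α - 1) * (a / 2) := by gcongr
      have h3 : 0 ≤ K * (2 * K) ^ (α - 1) * u ^ α := by positivity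
      rw [e a hF0]
      linarith
    · have h1 : a ^ (α - 1) ≤ (2 * K * u) ^ (α - 1) := by
        gcongr; linarith
      rw [Real.mul_rpow (by positivity) hu0] at h1
      have h2 : 0 ≤ a ^ α / 2 := by positivity
      have h3 : K * (a ^ (α - 1) * u) ≤ K * ((2 * K) ^ (α - 1) * u ^ (α - 1) * u) := by gcongr
      rw [e u hu0]
      linarith
  have hI := integral_mono (i2.const_mul K) ((i1.div_const 2).add
    (i3.const_mul (K * (2 * K) ^ (α - 1)))) pw
  simp only [Pi.add_apply] at hI
  rw [integral_add (i1.div_const 2) (i3.const_mul _), integral_div, integral_const_mul,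
      integral_const_mul] at hI
  rw [integral_sub i1 (i2.const_mul K), integral_const_mul] at hfin
  rw [← ofReal_integral_eq_lintegral_ofReal i1 (Filter.Eventually.of_forall fun x => by positivity),
    ← ofReal_integral_eq_lintegral_ofReal i3 (Filter.Eventually.of_forall fun x => by positivity),
    ← ENNReal.ofReal_mul (by positivity)]
  refine ENNReal.ofReal_le_ofReal ?_
  linarith

theorem exists_eLpNorm_fourierInv_le_re {p : ℝ} (hp : 1 < p) :
    ∃ C : ℝ≥0, ∀ (θ : V) (χ : V → ℂ), RapidDecay χ → (∀ ξ, χ ξ ≠ 0 → 0 < inner ℝ ξ θ) →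
      eLpNorm (𝓕⁻ χ) (ENNReal.ofReal p) ≤
        C * eLpNorm (fun x => (𝓕⁻ χ x).re) (ENNReal.ofReal p) := by
  obtain ⟨c, hc⟩ : ∃ c : ℝ≥0, ∀ (θ : V) (χ : V → ℂ), RapidDecay χ →
      (∀ ξ, χ ξ ≠ 0 → 0 < inner ℝ ξ θ) →
      ∫⁻ x, ENNReal.ofReal (‖𝓕⁻ χ x‖ ^ p) ≤
        c * ∫⁻ x, ENNReal.ofReal (|(𝓕⁻ χ x).re| ^ p) := by
    obtain ⟨α, rfl⟩ : ∃ α, p = 2 * α := ⟨p / 2, by ring⟩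
    rcases le_total (2 * α) 2 with h | h
    · exact ⟨Real.toNNReal _, fun θ χ hχ hs =>
        lintegral_rpow_fourierInv_le_of_le_two hχ hs (by linarith) (by linarith)⟩
    · exact ⟨Real.toNNReal _, fun θ χ hχ hs =>
        lintegral_rpow_fourierInv_le_of_two_le hχ hs (by linarith)⟩
  have hp0 : 0 < p := by linarith
  refine ⟨c ^ (1 / p), fun θ χ hχ hs => ?_⟩
  have h := hc θ χ hχ hs
  have ep : ENNReal.ofReal p ≠ 0 := by simpa using hp0
  rw [eLpNorm_eq_lintegral_rpow_enorm_toReal ep ENNReal.ofReal_ne_top,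
    eLpNorm_eq_lintegral_rpow_enorm_toReal ep ENNReal.ofReal_ne_top,
    ENNReal.toReal_ofReal hp0.le]
  have e1 : ∀ z : ℂ, ‖z‖ₑ ^ p = ENNReal.ofReal (‖z‖ ^ p) := fun z => by
    rw [← ofReal_norm, ENNReal.ofReal_rpow_of_nonneg (norm_nonneg _) hp0.le]
  have e2 : ∀ z : ℝ, ‖z‖ₑ ^ p = ENNReal.ofReal (|z| ^ p) := fun z => by
    rw [← ofReal_norm, ENNReal.ofReal_rpow_of_nonneg (norm_nonneg _) hp0.le,
      Real.norm_eq_abs]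
  simp only [e1, e2]
  rw [ENNReal.coe_rpow_of_nonneg _ (by positivity), ← ENNReal.mul_rpow_of_nonneg _ _
      (by positivity)]
  gcongr

end HalfSpace

section HalfSpaceProjection

variable {V : Type*} [NormedAddCommGroup V] [InnerProductSpace ℝ V] [FiniteDimensional ℝ V]
  [MeasurableSpace V] [BorelSpace V]

theorem integrable_fourierChar_inner_smul {ψ : V → ℂ} (h : Integrable ψ) (x : V) :
    Integrable fun ξ => Real.fourierChar (inner ℝ ξ x) • ψ ξ :=
  ((Real.fourierIntegral_convergent_iff (f := ψ) (-x)).2 h).congr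
    (Filter.Eventually.of_forall fun ξ => by simp)

theorem fourierInv_add_apply {ψ χ : V → ℂ} (h : Integrable ψ) (h' : Integrable χ) (x : V) :
    𝓕⁻ (fun ξ => ψ ξ + χ ξ) x = 𝓕⁻ ψ x + 𝓕⁻ χ x := by
  simp only [Real.fourierInv_eq, smul_add]
  refine integral_add ?_ ?_
  · exact integrable_fourierChar_inner_smul h x
  · exact integrable_fourierChar_inner_smul h' x

theorem fourierInv_const_mul_apply (a : ℂ) (ψ : V → ℂ) (x : V) :
    𝓕⁻ (fun ξ => a * ψ ξ) x = a * 𝓕⁻ ψ x := by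
  simp only [Real.fourierInv_eq]
  rw [← integral_const_mul]
  congr 1 with ξ
  simp only [Circle.smul_def, smul_eq_mul]
  ring

theorem fourierInv_conj_neg_apply (ψ : V → ℂ) (x : V) :
    𝓕⁻ (fun ξ => starRingEnd ℂ (ψ (-ξ))) x = starRingEnd ℂ (𝓕⁻ ψ x) := by
  simp only [Real.fourierInv_eq]
  rw [← integral_conj, ← integral_neg_eq_self]
  congr 1 with ξ
  simp only [Circle.smul_def, smul_eq_mul, map_mul, inner_neg_left, neg_neg]
  congr 1
  rw [← Circle.coe_inv_eq_conj, AddChar.map_neg_eq_inv]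

theorem RapidDecay.conj_neg {ψ : V → ℂ} (h : RapidDecay ψ) :
    RapidDecay (fun ξ => starRingEnd ℂ (ψ (-ξ))) := by
  refine ⟨?_, fun N => ?_⟩
  · exact Complex.continuous_conj.comp_aestronglyMeasurable
      (h.meas.comp_quasiMeasurePreserving
        (Measure.measurePreserving_neg (volume : Measure V)).quasiMeasurePreserving)
  · obtain ⟨C, hC⟩ := h.decay N
    exact ⟨C, fun ξ => by simpa using hC (-ξ)⟩

theorem measurableSet_inner_pos (θ : V) : MeasurableSet {ξ : V | 0 < inner ℝ ξ θ} :=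
  measurableSet_lt measurable_const (by fun_prop)

theorem volume_inner_eq_zero {θ : V} (hθ : θ ≠ 0) :
    volume {ξ : V | inner ℝ ξ θ = 0} = 0 := by
  have h := Measure.addHaar_submodule (volume : Measure V) (LinearMap.ker (innerₗ V θ)) (by
    intro h
    have : θ ∈ LinearMap.ker (innerₗ V θ) := h ▸ Submodule.mem_top
    simp at this
    exact hθ this)
  convert h using 2
  ext ξ
  simp [real_inner_comm]

theorem re_fourierInv_indicator {ψ : V → ℂ} (h : RapidDecay ψ) {θ : V} (hθ : θ ≠ 0) (x : V) :
    (𝓕⁻ ({ξ | 0 < inner ℝ ξ θ}.indicator (fun ξ => ψ ξ + starRingEnd ℂ (ψ (-ξ)))) x).re =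
      (𝓕⁻ ψ x).re := by
  set χ : V → ℂ := {ξ | 0 < inner ℝ ξ θ}.indicator (fun ξ => ψ ξ + starRingEnd ℂ (ψ (-ξ))) with hχ
  have hχr : RapidDecay χ := (h.add h.conj_neg).indicator (measurableSet_inner_pos θ)
  have e1 : (fun ξ => χ ξ + starRingEnd ℂ (χ (-ξ))) =ᵐ[volume]
      fun ξ => ψ ξ + starRingEnd ℂ (ψ (-ξ)) := by
    have : ∀ᵐ ξ : V, inner ℝ ξ θ ≠ 0 := by
      rw [ae_iff]; simpa using volume_inner_eq_zero hθ
    filter_upwards [this] with ξ hξ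
    rcases lt_or_gt_of_ne hξ with h0 | h0
    · simp [hχ, h0, h0.not_gt, add_comm]
    · simp [hχ, h0, h0.not_gt]
  have e2 : 𝓕⁻ (fun ξ => χ ξ + starRingEnd ℂ (χ (-ξ))) x =
      𝓕⁻ (fun ξ => ψ ξ + starRingEnd ℂ (ψ (-ξ))) x := by
    simp only [Real.fourierInv_eq]
    refine integral_congr_ae ?_
    filter_upwards [e1] with ξ hξ
    rw [hξ]
  rw [fourierInv_add_apply hχr.integrable hχr.conj_neg.integrable,
    fourierInv_add_apply h.integrable h.conj_neg.integrable, fourierInv_conj_neg_apply,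
    fourierInv_conj_neg_apply, Complex.add_conj, Complex.add_conj] at e2
  have := Complex.ofReal_injective e2
  linarith

theorem fourierInv_indicator_halfSpace {ψ : V → ℂ} (hψ : RapidDecay ψ) (θ : V) :
    𝓕⁻ ({ξ | 0 < inner ℝ ξ θ}.indicator ψ) =
      (1 / 2 : ℂ) • (𝓕⁻ ({ξ : V | 0 < inner ℝ ξ θ}.indicator
        (fun ξ => ψ ξ + starRingEnd ℂ (ψ (-ξ)))) +
      Complex.I • 𝓕⁻ ({ξ : V | 0 < inner ℝ ξ θ}.indicator (fun ξ => -Complex.I * ψ ξ +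
        starRingEnd ℂ (-Complex.I * ψ (-ξ))))) := by
  set χ₁ := {ξ : V | 0 < inner ℝ ξ θ}.indicator (fun ξ => ψ ξ + starRingEnd ℂ (ψ (-ξ))) with h₁
  set χ₂ := {ξ : V | 0 < inner ℝ ξ θ}.indicator (fun ξ => -Complex.I * ψ ξ +
    starRingEnd ℂ (-Complex.I * ψ (-ξ))) with h₂
  have r₁ : RapidDecay χ₁ := (hψ.add hψ.conj_neg).indicator (measurableSet_inner_pos θ)
  have r₂ : RapidDecay χ₂ := ((hψ.const_mul _).add (hψ.const_mul _).conj_neg).indicator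
      (measurableSet_inner_pos θ)
  ext x
  have : {ξ : V | 0 < inner ℝ ξ θ}.indicator ψ =
      fun ξ => (1 / 2 : ℂ) * (χ₁ ξ + Complex.I * χ₂ ξ) := by
    ext ξ
    by_cases h0 : 0 < inner ℝ ξ θ
    · simp only [h₁, h₂, Set.indicator, Set.mem_ofPred_eq, h0, if_true, map_mul, map_neg,
        Complex.conj_I]
      linear_combination (1 / 2 * ψ ξ - 1 / 2 * starRingEnd ℂ (ψ (-ξ))) * Complex.I_mul_I
    · simp [h₁, h₂, Set.indicator, h0]
  rw [this, fourierInv_const_mul_apply,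
    fourierInv_add_apply r₁.integrable (r₂.const_mul _).integrable, fourierInv_const_mul_apply]
  simp

theorem exists_eLpNorm_fourierInv_halfSpace_le {p : ℝ} (hp : 1 < p) :
    ∃ C : ℝ≥0, ∀ (θ : V) (ψ : V → ℂ), RapidDecay ψ →
      eLpNorm (𝓕⁻ ({ξ | 0 < inner ℝ ξ θ}.indicator ψ)) (ENNReal.ofReal p) ≤
        C * eLpNorm (𝓕⁻ ψ) (ENNReal.ofReal p) := by
  obtain ⟨C, hC⟩ := exists_eLpNorm_fourierInv_le_re (V := V) hp
  refine ⟨C, fun θ ψ hψ => ?_⟩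
  rcases eq_or_ne θ 0 with rfl | hθ
  · have : 𝓕⁻ ({ξ : V | 0 < inner ℝ ξ 0}.indicator ψ) = 0 := by
      ext x
      simp [Real.fourierInv_eq]
    rw [this]; simp
  have key : ∀ φ : V → ℂ, RapidDecay φ → eLpNorm (𝓕⁻ ({ξ | 0 < inner ℝ ξ θ}.indicator
      (fun ξ => φ ξ + starRingEnd ℂ (φ (-ξ))))) (ENNReal.ofReal p) ≤
        C * eLpNorm (𝓕⁻ φ) (ENNReal.ofReal p) := fun φ hφ => by
    refine (hC θ _ ((hφ.add hφ.conj_neg).indicator (measurableSet_inner_pos θ)) ?_).trans ?_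
    · intro ξ hξ
      exact Set.mem_of_indicator_ne_zero (s := {ξ : V | 0 < inner ℝ ξ θ}) hξ
    · gcongr
      refine eLpNorm_mono fun x => ?_
      rw [re_fourierInv_indicator hφ hθ]
      exact Complex.abs_re_le_norm _
  have hφr : RapidDecay (fun ξ => -Complex.I * ψ ξ) := hψ.const_mul _
  have m : ∀ φ : V → ℂ, RapidDecay φ → AEStronglyMeasurable (𝓕⁻ φ) volume := fun φ hφ =>
    (continuous_fourierInv_of_integrable hφ.integrable).aestronglyMeasurable
  have hψφ : eLpNorm (𝓕⁻ fun ξ => -Complex.I * ψ ξ) (ENNReal.ofReal p) = eLpNorm (𝓕⁻ ψ)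
      (ENNReal.ofReal p) := by
    refine eLpNorm_congr_norm_ae (Filter.Eventually.of_forall fun x => ?_)
    rw [fourierInv_const_mul_apply]
    simp
  have p1 : 1 ≤ ENNReal.ofReal p := by simpa using hp.le
  rw [fourierInv_indicator_halfSpace hψ, eLpNorm_const_smul]
  have hI : ‖Complex.I‖ₑ = 1 := by rw [← ofReal_norm]; simp
  have h2 : ‖(1 / 2 : ℂ)‖ₑ = 2⁻¹ := by rw [← ofReal_norm]; simp
  have k1 := key ψ hψ
  have k2 := key _ hφr
  rw [hψφ] at k2
  have m1 := m _ ((hψ.add hψ.conj_neg).indicator (measurableSet_inner_pos θ))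
  have m2 := (m _ ((hφr.add hφr.conj_neg).indicator (measurableSet_inner_pos θ))).const_smul
    Complex.I
  have k3 := eLpNorm_add_le m1 m2 p1
  rw [eLpNorm_const_smul, hI, one_mul] at k3
  rw [h2]
  refine (mul_le_mul_right (k3.trans (add_le_add k1 k2)) _).trans_eq ?_
  rw [← two_mul, ← mul_assoc, ENNReal.inv_mul_cancel (by simp) (by simp), one_mul]

theorem RapidDecay.comp_add_right {ψ : V → ℂ} (h : RapidDecay ψ) (ξ₀ : V) :
    RapidDecay (fun ξ => ψ (ξ + ξ₀)) := by
  refine ⟨h.meas.comp_quasiMeasurePreserving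
    (measurePreserving_add_right (volume : Measure V) ξ₀).quasiMeasurePreserving, fun N => ?_⟩
  obtain ⟨C, hC⟩ := h.decay N
  refine ⟨C * (1 + ‖ξ₀‖) ^ N, fun ξ => ?_⟩
  have h1 : 1 + ‖ξ‖ ≤ (1 + ‖ξ + ξ₀‖) * (1 + ‖ξ₀‖) := by
    have : ‖ξ‖ ≤ ‖ξ + ξ₀‖ + ‖ξ₀‖ := by simpa using norm_sub_le (ξ + ξ₀) ξ₀
    nlinarith [norm_nonneg (ξ + ξ₀), norm_nonneg ξ₀]
  calc ‖ψ (ξ + ξ₀)‖ * (1 + ‖ξ‖) ^ N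
      ≤ ‖ψ (ξ + ξ₀)‖ * ((1 + ‖ξ + ξ₀‖) * (1 + ‖ξ₀‖)) ^ N := by gcongr
    _ = ‖ψ (ξ + ξ₀)‖ * (1 + ‖ξ + ξ₀‖) ^ N * (1 + ‖ξ₀‖) ^ N := by
        rw [mul_pow]; ring
    _ ≤ C * (1 + ‖ξ₀‖) ^ N := by gcongr; exact hC _

theorem norm_fourierInv_comp_add_right (ψ : V → ℂ) (ξ₀ x : V) :
    ‖𝓕⁻ (fun ξ => ψ (ξ + ξ₀)) x‖ = ‖𝓕⁻ ψ x‖ := by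
  have : 𝓕⁻ ψ x = Real.fourierChar (inner ℝ ξ₀ x) • 𝓕⁻ (fun ξ => ψ (ξ + ξ₀)) x := by
    simp only [Real.fourierInv_eq]
    rw [← integral_add_right_eq_self _ ξ₀, Circle.smul_def, ← integral_smul]
    congr 1 with ξ
    rw [inner_add_left, AddChar.map_add_eq_mul, ← Circle.smul_def, smul_smul, mul_comm]
  rw [this, Circle.norm_smul]

theorem exists_eLpNorm_fourierInv_affine_halfSpace_le {p : ℝ} (hp : 1 < p) :
    ∃ C : ℝ≥0, ∀ (θ : V) (c : ℝ) (ψ : V → ℂ), RapidDecay ψ →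
      eLpNorm (𝓕⁻ ({ξ | c < inner ℝ ξ θ}.indicator ψ)) (ENNReal.ofReal p) ≤
        C * eLpNorm (𝓕⁻ ψ) (ENNReal.ofReal p) := by
  obtain ⟨C, hC⟩ := exists_eLpNorm_fourierInv_halfSpace_le (V := V) hp
  refine ⟨C + 1, fun θ c ψ hψ => ?_⟩
  rcases eq_or_ne θ 0 with rfl | hθ
  · have h1 : eLpNorm (𝓕⁻ ({ξ : V | c < inner ℝ ξ 0}.indicator ψ)) (ENNReal.ofReal p) ≤
        eLpNorm (𝓕⁻ ψ) (ENNReal.ofReal p) := by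
      by_cases h : c < 0
      · simp [h]
      · have : 𝓕⁻ ({ξ : V | c < inner ℝ ξ 0}.indicator ψ) = 0 := by
          ext x
          simp [Real.fourierInv_eq, h]
        rw [this]; simp
    exact h1.trans (le_mul_of_one_le_left (by positivity) (by simp))
  · set ξ₀ : V := (c / ‖θ‖ ^ 2) • θ with hξ₀
    have e0 : inner ℝ ξ₀ θ = c := by
      rw [hξ₀, real_inner_smul_left, real_inner_self_eq_norm_sq]
      field_simp
    have e1 : (fun ξ => {ξ | c < inner ℝ ξ θ}.indicator ψ (ξ + ξ₀)) =
        {ξ | 0 < inner ℝ ξ θ}.indicator (fun ξ => ψ (ξ + ξ₀)) := by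
      ext ξ
      simp [Set.indicator, inner_add_left, e0]
    have e2 := eLpNorm_congr_norm_ae (p := ENNReal.ofReal p) (Filter.Eventually.of_forall
      (norm_fourierInv_comp_add_right ({ξ | c < inner ℝ ξ θ}.indicator ψ) ξ₀))
      (μ := (volume : Measure V))
    have e3 := eLpNorm_congr_norm_ae (p := ENNReal.ofReal p) (Filter.Eventually.of_forall
      (norm_fourierInv_comp_add_right ψ ξ₀)) (μ := (volume : Measure V))
    have e4 := hC θ _ (hψ.comp_add_right ξ₀)
    rw [← e1, e2, e3] at e4
    refine e4.trans ?_
    gcongr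
    simp

theorem measurableSet_lt_inner (θ : V) (c : ℝ) : MeasurableSet {ξ : V | c < inner ℝ ξ θ} :=
  measurableSet_lt measurable_const (by fun_prop)

/-- Fourier projections onto intersections of `m` open affine half-spaces are bounded on `Lᵖ`,
uniformly in the half-spaces. -/
theorem exists_eLpNorm_fourierInv_iInter_halfSpace_le {p : ℝ} (hp : 1 < p) :
    ∃ C : ℝ≥0, ∀ {ι : Type} (s : Finset ι) (θ : ι → V) (c : ι → ℝ) (ψ : V → ℂ), RapidDecay ψ →
      eLpNorm (𝓕⁻ ({ξ | ∀ k ∈ s, c k < inner ℝ ξ (θ k)}.indicator ψ)) (ENNReal.ofReal p) ≤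
        C ^ s.card * eLpNorm (𝓕⁻ ψ) (ENNReal.ofReal p) := by
  classical
  obtain ⟨C, hC⟩ := exists_eLpNorm_fourierInv_affine_halfSpace_le (V := V) hp
  refine ⟨C, fun {ι} s θ c => ?_⟩
  induction s using Finset.induction_on with
  | empty => intro ψ _; simp
  | insert a s ha ih =>
    intro ψ hψ
    have e : {ξ | ∀ k ∈ insert a s, c k < inner ℝ ξ (θ k)}.indicator ψ =
        {ξ | ∀ k ∈ s, c k < inner ℝ ξ (θ k)}.indicator
          ({ξ | c a < inner ℝ ξ (θ a)}.indicator ψ) := by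
      rw [Set.indicator_indicator]
      congr 1
      ext ξ
      simp [and_comm]
    rw [e, Finset.card_insert_of_notMem ha, pow_succ, mul_assoc]
    refine (ih _ (hψ.indicator (measurableSet_lt_inner _ _))).trans ?_
    gcongr
    exact hC _ _ _ hψ

end HalfSpaceProjection

section Minkowski

variable {α β : Type*} [MeasurableSpace α] [MeasurableSpace β] {μ : Measure α} {ν : Measure β}

theorem lintegral_mul_rpow_le {W H : β → ℝ≥0∞} (hW : AEMeasurable W ν) (hH : AEMeasurable H ν)
    {p : ℝ} (hp : 1 < p) :
    (∫⁻ l, W l * H l ∂ν) ^ p ≤ (∫⁻ l, W l ∂ν) ^ (p - 1) * ∫⁻ l, W l * H l ^ p ∂ν := by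
  have hp0 : 0 < p := by linarith
  have hpq := Real.HolderConjugate.conjExponent hp
  set q := p.conjExponent with hq
  have hq0 : 0 < q := hpq.symm.pos
  have e1 : 1 / q = (p - 1) / p := by
    rw [hq, Real.conjExponent]; field_simp
  have h := ENNReal.lintegral_mul_le_Lp_mul_Lq ν hpq.symm (f := fun l => W l ^ (1 / q))
    (g := fun l => W l ^ (1 / p) * H l) (by fun_prop) (by fun_prop)
  have e2 : ∀ l, ((fun l => W l ^ (1 / q)) * fun l => W l ^ (1 / p) * H l) l = W l * H l := by
    intro l
    have : 1 / q + 1 / p = 1 := by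
      simpa using hpq.symm.inv_add_inv_eq_one
    simp only [Pi.mul_apply]
    rw [← mul_assoc, ← ENNReal.rpow_add_of_nonneg _ _ (by positivity) (by positivity), this,
      ENNReal.rpow_one]
  have e3 : ∀ l, (W l ^ (1 / q)) ^ q = W l := fun l => by
    rw [← ENNReal.rpow_mul, one_div_mul_cancel hq0.ne', ENNReal.rpow_one]
  have e4 : ∀ l, (W l ^ (1 / p) * H l) ^ p = W l * H l ^ p := fun l => by
    rw [ENNReal.mul_rpow_of_nonneg _ _ hp0.le, ← ENNReal.rpow_mul, one_div_mul_cancel hp0.ne',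
      ENNReal.rpow_one]
  simp only [e2, e3, e4] at h
  calc (∫⁻ l, W l * H l ∂ν) ^ p
      ≤ ((∫⁻ l, W l ∂ν) ^ (1 / q) * (∫⁻ l, W l * H l ^ p ∂ν) ^ (1 / p)) ^ p := by gcongr
    _ = _ := by
        rw [ENNReal.mul_rpow_of_nonneg _ _ hp0.le, ← ENNReal.rpow_mul, ← ENNReal.rpow_mul,
          one_div_mul_cancel hp0.ne', ENNReal.rpow_one, e1, div_mul_cancel₀ _ (ne_of_gt hp0)]

/-- Minkowski's integral inequality for superpositions of functions with a common `Lᵖ` bound. -/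
theorem lintegral_rpow_lintegral_mul_le [SFinite μ] [SFinite ν] {W : β → ℝ≥0∞} (hW : Measurable W)
    {H : α → β → ℝ≥0∞} (hH : Measurable (Function.uncurry H)) {p : ℝ} (hp : 1 < p) {K : ℝ≥0∞}
    (hK : ∀ l, ∫⁻ x, H x l ^ p ∂μ ≤ K) :
    ∫⁻ x, (∫⁻ l, W l * H x l ∂ν) ^ p ∂μ ≤ (∫⁻ l, W l ∂ν) ^ p * K := by
  have hm : Measurable fun z : α × β => W z.2 * H z.1 z.2 ^ p :=
    (hW.comp measurable_snd).mul (hH.pow_const p)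
  calc ∫⁻ x, (∫⁻ l, W l * H x l ∂ν) ^ p ∂μ
      ≤ ∫⁻ x, (∫⁻ l, W l ∂ν) ^ (p - 1) * ∫⁻ l, W l * H x l ^ p ∂ν ∂μ :=
        lintegral_mono fun x => lintegral_mul_rpow_le hW.aemeasurable
          (hH.comp measurable_prodMk_left).aemeasurable hp
    _ = (∫⁻ l, W l ∂ν) ^ (p - 1) * ∫⁻ x, ∫⁻ l, W l * H x l ^ p ∂ν ∂μ :=
        lintegral_const_mul _ hm.lintegral_prod_right'
    _ = (∫⁻ l, W l ∂ν) ^ (p - 1) * ∫⁻ l, W l * ∫⁻ x, H x l ^ p ∂μ ∂ν := by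
        rw [lintegral_lintegral_swap hm.aemeasurable]
        congr 2 with l
        exact lintegral_const_mul _ ((hH.comp measurable_prodMk_right).pow_const p)
    _ ≤ (∫⁻ l, W l ∂ν) ^ (p - 1) * ∫⁻ l, W l * K ∂ν := by
        gcongr with l
        exact hK l
    _ = (∫⁻ l, W l ∂ν) ^ (p - 1) * (∫⁻ l, W l ∂ν) * K := by
        rw [lintegral_mul_const _ hW, mul_assoc]
    _ = (∫⁻ l, W l ∂ν) ^ p * K := by
        congr 1
        have := ENNReal.rpow_add_of_nonneg (x := ∫⁻ l, W l ∂ν) (p - 1) 1 (by linarith) zero_le_one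
        rw [ENNReal.rpow_one, sub_add_cancel] at this
        exact this.symm

end Minkowski

section BoxRepresentation

open Filter Topology Set

theorem eq_integral_sign_mul_deriv {Φ Φ' : ℝ → ℂ} (hΦ : ∀ ζ, HasDerivAt Φ (Φ' ζ) ζ)
    (hi : Integrable Φ') (ht : Tendsto Φ atTop (𝓝 0)) (hb : Tendsto Φ atBot (𝓝 0)) {ζ : ℝ}
    (hζ : ζ ≠ 0) :
    Φ ζ = ∫ σ, {σ : ℝ | 0 < ζ * σ ∧ |ζ| < |σ|}.indicator
      (fun σ => -((SignType.sign σ : ℝ) : ℂ) * Φ' σ) σ := by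
  rcases lt_or_gt_of_ne hζ with h | h
  · have e : ∀ σ, {σ : ℝ | 0 < ζ * σ ∧ |ζ| < |σ|}.indicator
        (fun σ => -((SignType.sign σ : ℝ) : ℂ) * Φ' σ) σ = (Iio ζ).indicator Φ' σ := fun σ => by
      by_cases hs : σ < ζ
      · have h0 : σ < 0 := hs.trans h
        have : 0 < ζ * σ ∧ |ζ| < |σ| := ⟨by nlinarith, by
          rw [abs_of_neg h, abs_of_neg h0]; linarith⟩
        simp [hs, this, h0]
      · have : ¬ (0 < ζ * σ ∧ |ζ| < |σ|) := fun ⟨h1, h2⟩ => by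
          have h0 : σ < 0 := by nlinarith
          rw [abs_of_neg h, abs_of_neg h0] at h2
          linarith
        simp [hs, this]
    rw [integral_congr_ae (Eventually.of_forall e), integral_indicator measurableSet_Iio,
      ← integral_Iic_eq_integral_Iio,
      integral_Iic_of_hasDerivAt_of_tendsto' (fun x _ => hΦ x) hi.integrableOn hb, sub_zero]
  · have e : ∀ σ, {σ : ℝ | 0 < ζ * σ ∧ |ζ| < |σ|}.indicator
        (fun σ => -((SignType.sign σ : ℝ) : ℂ) * Φ' σ) σ =
        (Ioi ζ).indicator (fun σ => -Φ' σ) σ := fun σ => by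
      by_cases hs : ζ < σ
      · have h0 : 0 < σ := h.trans hs
        have : 0 < ζ * σ ∧ |ζ| < |σ| := ⟨by positivity, by
          rwa [abs_of_pos h, abs_of_pos h0]⟩
        simp [hs, this, h0]
      · have : ¬ (0 < ζ * σ ∧ |ζ| < |σ|) := fun ⟨h1, h2⟩ => by
          have h0 : 0 < σ := by nlinarith
          rw [abs_of_pos h, abs_of_pos h0] at h2
          exact hs h2
        simp [hs, this]
    rw [integral_congr_ae (Eventually.of_forall e), integral_indicator measurableSet_Ioi,
      integral_neg,
      integral_Ioi_of_hasDerivAt_of_tendsto' (fun x _ => hΦ x) hi.integrableOn ht]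
    simp

variable {n : ℕ}

/-- The parameter measure `ds dσ` on `(0, ∞) × ℝⁿ`. -/
noncomputable def boxMeasure (n : ℕ) : Measure (ℝ × (Fin n → ℝ)) :=
  (volume.restrict (Ioi 0)).prod volume

instance : SFinite (boxMeasure n) := by unfold boxMeasure; infer_instance

/-- The set of frequencies `ξ` in the orthant of `σ` lying in the polyhedral cone determined by
`(s, σ)`. -/
def coneSet (j : Fin n) (l : ℝ × (Fin n → ℝ)) : Set (Fin n → ℝ) :=
  {ξ | l.1 < SignType.sign (l.2 j) * ξ j ∧ ∀ k, 0 < l.2 k * ξ k ∧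
    l.1 * (SignType.sign (l.2 k) * ξ k) < |l.2 k| * (SignType.sign (l.2 j) * ξ j)}

theorem integrable_boxWeight {A : ℝ → ℝ} (hA0 : ∀ σ, 0 ≤ A σ) (hAm : Measurable A)
    (hA : Integrable A) (hA' : Integrable fun σ => |σ| * A σ) (j : Fin n) :
    Integrable (fun l : ℝ × (Fin n → ℝ) => {l : ℝ × (Fin n → ℝ) | l.1 < |l.2 j|}.indicator
      (fun l => ∏ k, A (l.2 k)) l) (boxMeasure n) := by
  have hms : MeasurableSet {l : ℝ × (Fin n → ℝ) | l.1 < |l.2 j|} :=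
    measurableSet_lt measurable_fst (by fun_prop)
  have hm : Measurable fun l : ℝ × (Fin n → ℝ) => {l : ℝ × (Fin n → ℝ) | l.1 < |l.2 j|}.indicator
      (fun l => ∏ k, A (l.2 k)) l := by
    refine Measurable.indicator ?_ hms
    fun_prop
  unfold boxMeasure
  rw [integrable_prod_iff' hm.aestronglyMeasurable]
  have e : ∀ σ : Fin n → ℝ, ∀ s, {l : ℝ × (Fin n → ℝ) | l.1 < |l.2 j|}.indicator
      (fun l => ∏ k, A (l.2 k)) (s, σ) = (Iio |σ j|).indicator (fun _ => ∏ k, A (σ k)) s :=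
    fun σ s => by simp [indicator]
  have hfin : ∀ σ : Fin n → ℝ, volume (Iio |σ j| ∩ Ioi 0) < ⊤ := fun σ =>
    (measure_mono (show Iio |σ j| ∩ Ioi 0 ⊆ Ioo 0 |σ j| from fun x hx => ⟨hx.2, hx.1⟩)).trans_lt
      (by simp)
  constructor
  · refine Eventually.of_forall fun σ => ?_
    simp only [e]
    rw [integrable_indicator_iff measurableSet_Iio]
    refine integrableOn_const ?_ (by finiteness)
    rw [Measure.restrict_apply measurableSet_Iio]
    exact (hfin σ).ne
  · have e2 : ∀ σ : Fin n → ℝ, ∫ s in Ioi (0 : ℝ), ‖{l : ℝ × (Fin n → ℝ) | l.1 < |l.2 j|}.indicator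
        (fun l => ∏ k, A (l.2 k)) (s, σ)‖ =
        ∏ k, (if k = j then fun t => |t| * A t else A) (σ k) := fun σ => by
      have h0 : 0 ≤ ∏ k, A (σ k) := Finset.prod_nonneg fun k _ => hA0 _
      have : ∀ s, ‖{l : ℝ × (Fin n → ℝ) | l.1 < |l.2 j|}.indicator
        (fun l => ∏ k, A (l.2 k)) (s, σ)‖ = (Iio |σ j|).indicator (fun _ => ∏ k, A (σ k)) s := by
        intro s
        rw [e, Real.norm_of_nonneg (indicator_nonneg (fun _ _ => h0) _)]
      simp only [this]
      rw [integral_indicator measurableSet_Iio, Measure.restrict_restrict measurableSet_Iio,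
        inter_comm, Ioi_inter_Iio, setIntegral_const]
      rw [← Finset.mul_prod_erase _ (fun k => A (σ k)) (Finset.mem_univ j),
        ← Finset.mul_prod_erase _ (fun k => (if k = j then fun t => |t| * A t else A) (σ k))
          (Finset.mem_univ j)]
      simp only [if_true, smul_eq_mul]
      rw [mul_assoc]
      congr 1
      · simp
      · congr 1
        symm
        refine Finset.prod_congr rfl fun k hk => ?_
        rw [if_neg (Finset.ne_of_mem_erase hk)]
    simp only [e2]
    refine Integrable.fintype_prod (f := fun k => if k = j then fun t => |t| * A t else A)
      fun k => ?_
    by_cases h : k = j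
    · simpa [h] using hA'
    · simpa [h] using hA

theorem mem_coneSet_iff {j : Fin n} {ξ σ : Fin n → ℝ} {s : ℝ} (hs : 0 < s) (hξ : ξ j ≠ 0) :
    (s < |σ j| ∧ ξ ∈ coneSet j (s, σ)) ↔
      s < |ξ j| ∧ ∀ k, 0 < s / |ξ j| * ξ k * σ k ∧ |s / |ξ j| * ξ k| < |σ k| := by
  have hj : 0 < |ξ j| := abs_pos.2 hξ
  have hsg : ∀ k, 0 < σ k * ξ k → (SignType.sign (σ k) : ℝ) * ξ k = |ξ k| := fun k hk => by
    rcases pos_and_pos_or_neg_and_neg_of_mul_pos hk with h | h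
    · simp [h.1, abs_of_pos h.2]
    · simp [h.1, abs_of_neg h.2]
  have hq : 0 < s / |ξ j| := by positivity
  have h1 : ∀ k, 0 < s / |ξ j| * ξ k * σ k ↔ 0 < σ k * ξ k := fun k => by
    rw [mul_assoc, mul_pos_iff_of_pos_left hq, mul_comm]
  have h2 : ∀ k, |s / |ξ j| * ξ k| < |σ k| ↔ s * |ξ k| < |σ k| * |ξ j| := fun k => by
    rw [abs_mul, abs_of_pos hq, div_mul_eq_mul_div, div_lt_iff₀ hj]
  simp only [h1, h2]
  constructor
  · rintro ⟨-, hlt, hk⟩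
    simp only at hlt hk
    rw [hsg j (hk j).1] at hlt
    refine ⟨hlt, fun k => ⟨(hk k).1, ?_⟩⟩
    have := (hk k).2
    rwa [hsg j (hk j).1, hsg k (hk k).1] at this
  · rintro ⟨hlt, hk⟩
    refine ⟨?_, ?_, fun k => ⟨(hk k).1, ?_⟩⟩
    · have := (hk j).2
      exact lt_of_mul_lt_mul_right this hj.le
    · rw [hsg j (hk j).1]; exact hlt
    · simp only
      rw [hsg j (hk j).1, hsg k (hk k).1]
      exact (hk k).2

theorem measurable_real_sign : Measurable fun t : ℝ => (SignType.sign t : ℝ) := by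
  have : (fun t : ℝ => (SignType.sign t : ℝ)) =
      fun t => if 0 < t then 1 else if t < 0 then -1 else 0 := by
    ext t
    rcases lt_trichotomy t 0 with h | h | h
    · simp [h, h.not_gt]
    · simp [h]
    · simp [h]
  rw [this]
  exact Measurable.ite measurableSet_Ioi measurable_const
    (Measurable.ite measurableSet_Iio measurable_const measurable_const)

theorem measurableSet_coneSet (j : Fin n) :
    MeasurableSet {z : (Fin n → ℝ) × (ℝ × (Fin n → ℝ)) | z.1 ∈ coneSet j z.2} := by
  have hs := fun k : Fin n => measurable_real_sign.comp
    (show Measurable fun z : (Fin n → ℝ) × (ℝ × (Fin n → ℝ)) => z.2.2 k by fun_prop)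
  have hx := fun k : Fin n =>
    show Measurable fun z : (Fin n → ℝ) × (ℝ × (Fin n → ℝ)) => z.1 k by fun_prop
  have h1 := measurableSet_lt
    (show Measurable fun z : (Fin n → ℝ) × (ℝ × (Fin n → ℝ)) => z.2.1 by fun_prop)
    ((hs j).mul (hx j))
  have h2 := fun k : Fin n => measurableSet_lt (measurable_const (a := (0 : ℝ)))
    (show Measurable fun z : (Fin n → ℝ) × (ℝ × (Fin n → ℝ)) => z.2.2 k * z.1 k by fun_prop)
  have h3 := fun k : Fin n => measurableSet_lt
    ((show Measurable fun z : (Fin n → ℝ) × (ℝ × (Fin n → ℝ)) => z.2.1 by fun_prop).mul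
      ((hs k).mul (hx k)))
    ((show Measurable fun z : (Fin n → ℝ) × (ℝ × (Fin n → ℝ)) => |z.2.2 k| by fun_prop).mul
      ((hs j).mul (hx j)))
  have := h1.inter (MeasurableSet.iInter fun k => (h2 k).inter (h3 k))
  convert this using 1
  ext z
  simp [coneSet]

/-- The weight of the cone projection with parameters `(s, σ)`. -/
noncomputable def boxKernel (Φ' : Fin n → ℝ → ℂ) (j : Fin n) (l : ℝ × (Fin n → ℝ)) : ℂ :=
  {l : ℝ × (Fin n → ℝ) | l.1 < |l.2 j|}.indicator (fun l => ((SignType.sign (l.2 j) : ℝ) : ℂ) *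
    ∏ k, (-((SignType.sign (l.2 k) : ℝ) : ℂ) * Φ' k (l.2 k))) l

theorem measurable_boxKernel {Φ' : Fin n → ℝ → ℂ} (hΦ : ∀ k, Measurable (Φ' k)) (j : Fin n) :
    Measurable (boxKernel Φ' j) := by
  have hs := fun k : Fin n => Complex.measurable_ofReal.comp (measurable_real_sign.comp
    (show Measurable fun l : ℝ × (Fin n → ℝ) => l.2 k by fun_prop))
  have hms : MeasurableSet {l : ℝ × (Fin n → ℝ) | l.1 < |l.2 j|} :=
    measurableSet_lt measurable_fst (by fun_prop)
  refine Measurable.indicator ((hs j).mul (Finset.measurable_fun_prod _ fun k _ =>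
    (hs k).neg.mul ((hΦ k).comp (by fun_prop)))) hms

theorem norm_sign_le_one (t : ℝ) : ‖((SignType.sign t : ℝ) : ℂ)‖ ≤ 1 := by
  rcases lt_trichotomy t 0 with h | h | h <;> simp [h]

theorem norm_boxKernel_le {Φ' : Fin n → ℝ → ℂ} {A : ℝ → ℝ} (hΦA : ∀ k σ, ‖Φ' k σ‖ ≤ A σ)
    (j : Fin n) (l : ℝ × (Fin n → ℝ)) :
    ‖boxKernel Φ' j l‖ ≤ {l : ℝ × (Fin n → ℝ) | l.1 < |l.2 j|}.indicator
      (fun l => ∏ k, A (l.2 k)) l := by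
  unfold boxKernel
  rw [norm_indicator_eq_indicator_norm]
  refine indicator_le_indicator' fun _ => ?_
  rw [norm_mul, norm_prod]
  calc _ ≤ 1 * ∏ k, A (l.2 k) := by
        refine mul_le_mul (norm_sign_le_one _) ?_ (by positivity) zero_le_one
        refine Finset.prod_le_prod (fun _ _ => norm_nonneg _) fun k _ => ?_
        rw [norm_mul, norm_neg]
        exact (mul_le_of_le_one_left (norm_nonneg _) (norm_sign_le_one _)).trans (hΦA k _)
    _ = _ := one_mul _

theorem mul_integral_prod_eq_integral_coneSet {Φ Φ' : Fin n → ℝ → ℂ}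
    (hΦ : ∀ k ζ, HasDerivAt (Φ k) (Φ' k ζ) ζ) (hm : ∀ k, Measurable (Φ' k))
    (ht : ∀ k, Tendsto (Φ k) atTop (𝓝 0)) (hb : ∀ k, Tendsto (Φ k) atBot (𝓝 0))
    {A : ℝ → ℝ} (hAm : Measurable A) (hA : Integrable A) (hA' : Integrable fun σ => |σ| * A σ)
    (hΦA : ∀ k σ, ‖Φ' k σ‖ ≤ A σ) {ξ : Fin n → ℝ} (hξ : ∀ k, ξ k ≠ 0) (j : Fin n) :
    (ξ j : ℂ) * ∫ r in (0 : ℝ)..1, ∏ k, Φ k (r * ξ k) =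
      ∫ l, boxKernel Φ' j l * (coneSet j l).indicator (fun _ => 1) ξ ∂(boxMeasure n) := by
  have hA0 : ∀ σ, 0 ≤ A σ := fun σ => (norm_nonneg _).trans (hΦA j σ)
  have hms : MeasurableSet {l : ℝ × (Fin n → ℝ) | ξ ∈ coneSet j l} :=
    (measurableSet_coneSet j).preimage measurable_prodMk_left
  have hmeas : Measurable fun l => boxKernel Φ' j l * (coneSet j l).indicator (fun _ => (1 : ℂ))
      ξ := by
    refine (measurable_boxKernel hm j).mul ?_
    exact (measurable_const (a := (1 : ℂ))).indicator hms
  have hInt : Integrable (fun l => boxKernel Φ' j l * (coneSet j l).indicator (fun _ => (1 : ℂ)) ξ)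
      (boxMeasure n) := by
    refine (integrable_boxWeight hA0 hAm hA hA' j).mono' hmeas.aestronglyMeasurable
      (Eventually.of_forall fun l => ?_)
    rw [norm_mul]
    refine (mul_le_of_le_one_right (norm_nonneg _) ?_).trans (norm_boxKernel_le hΦA j l)
    exact (norm_indicator_le_norm_self _ _).trans (by simp)
  have hj : 0 < |ξ j| := abs_pos.2 (hξ j)
  have hΦi : ∀ k, Integrable (Φ' k) := fun k =>
    hA.mono' (hm k).aestronglyMeasurable (Eventually.of_forall (hΦA k))
  have key : ∀ s ∈ Ioi (0 : ℝ),
      ∫ σ, boxKernel Φ' j (s, σ) * (coneSet j (s, σ)).indicator (fun _ => (1 : ℂ)) ξ =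
        (Iio |ξ j|).indicator
          (fun s => ((SignType.sign (ξ j) : ℝ) : ℂ) * ∏ k, Φ k (s / |ξ j| * ξ k)) s := by
    intro s hs
    have hs0 : 0 < s := hs
    by_cases hlt : s < |ξ j|
    · have e : ∀ σ : Fin n → ℝ,
          boxKernel Φ' j (s, σ) * (coneSet j (s, σ)).indicator (fun _ => (1 : ℂ)) ξ =
          ((SignType.sign (ξ j) : ℝ) : ℂ) * ∏ k, {σ : ℝ | 0 < s / |ξ j| * ξ k * σ ∧
            |s / |ξ j| * ξ k| < |σ|}.indicator
              (fun σ => -((SignType.sign σ : ℝ) : ℂ) * Φ' k σ) (σ k) := fun σ => by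
        have hiff := mem_coneSet_iff (σ := σ) hs0 (hξ j)
        by_cases hc : ∀ k, 0 < s / |ξ j| * ξ k * σ k ∧ |s / |ξ j| * ξ k| < |σ k|
        · have h2 := hiff.2 ⟨hlt, hc⟩
          have hsg : SignType.sign (σ j) = SignType.sign (ξ j) := by
            have := (h2.2.2 j).1
            rcases pos_and_pos_or_neg_and_neg_of_mul_pos this with h | h
            · simp [h.1, h.2]
            · simp [h.1, h.2]
          have h3 : ∀ k, σ k ∈ {σ : ℝ | 0 < s / |ξ j| * ξ k * σ ∧ |s / |ξ j| * ξ k| < |σ|} := hc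
          rw [boxKernel, indicator_of_mem (show (s, σ) ∈ {l : ℝ × (Fin n → ℝ) | l.1 < |l.2 j|}
            from h2.1), indicator_of_mem h2.2, mul_one]
          simp only [hsg]
          congr 1
          exact Finset.prod_congr rfl fun k _ =>
            (indicator_of_mem (h3 k) fun σ => -((SignType.sign σ : ℝ) : ℂ) * Φ' k σ).symm
        · have h2 : ¬ (s < |σ j| ∧ ξ ∈ coneSet j (s, σ)) := fun h => hc (hiff.1 h).2
          have hl : boxKernel Φ' j (s, σ) *
              (coneSet j (s, σ)).indicator (fun _ => (1 : ℂ)) ξ = 0 := by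
            by_cases h4 : s < |σ j|
            · rw [indicator_of_notMem (fun h => h2 ⟨h4, h⟩), mul_zero]
            · rw [boxKernel, indicator_of_notMem (show (s, σ) ∉
                {l : ℝ × (Fin n → ℝ) | l.1 < |l.2 j|} from h4), zero_mul]
          rw [hl]
          push Not at hc
          obtain ⟨k, hk⟩ := hc
          rw [Finset.prod_eq_zero (Finset.mem_univ k), mul_zero]
          exact indicator_of_notMem (fun h => (hk h.1).not_gt h.2) _
      simp only [e]
      rw [integral_const_mul, indicator_of_mem (show s ∈ Iio |ξ j| from hlt)]
      congr 1
      rw [integral_fintype_prod_volume_eq_prod]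
      refine Finset.prod_congr rfl fun k _ => ?_
      exact (eq_integral_sign_mul_deriv (hΦ k) (hΦi k) (ht k) (hb k)
        (mul_ne_zero (div_pos hs0 hj).ne' (hξ k))).symm
    · rw [indicator_of_notMem (show s ∉ Iio |ξ j| from hlt)]
      rw [integral_eq_zero_of_ae (Eventually.of_forall fun σ => ?_)]
      have h2 : ¬ (s < |σ j| ∧ ξ ∈ coneSet j (s, σ)) := fun h =>
        hlt ((mem_coneSet_iff hs0 (hξ j)).1 h).1
      by_cases h4 : s < |σ j|
      · simp only [Pi.zero_apply]
        rw [indicator_of_notMem (fun h => h2 ⟨h4, h⟩), mul_zero]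
      · simp only [Pi.zero_apply]
        rw [boxKernel, indicator_of_notMem (show (s, σ) ∉
          {l : ℝ × (Fin n → ℝ) | l.1 < |l.2 j|} from h4), zero_mul]
  unfold boxMeasure at hInt ⊢
  rw [integral_prod _ hInt, setIntegral_congr_fun measurableSet_Ioi key,
    integral_indicator measurableSet_Iio, Measure.restrict_restrict measurableSet_Iio, inter_comm,
    Ioi_inter_Iio, ← integral_Ioc_eq_integral_Ioo, ← intervalIntegral.integral_of_le hj.le,
    intervalIntegral.integral_const_mul,
    intervalIntegral.integral_comp_div (fun r => ∏ k, Φ k (r * ξ k)) hj.ne', zero_div,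
    div_self hj.ne', Complex.real_smul, ← mul_assoc, ← Complex.ofReal_mul, sign_mul_abs]

end BoxRepresentation

section Modulation

open Filter Topology
open scoped SchwartzMap

/-- The affine family of Schwartz functions `P + x Q`, modulated by the frequency `x`. -/
noncomputable def modulation (P Q : 𝓢(ℝ, ℂ)) (x ζ : ℝ) : ℂ :=
  Complex.exp (2 * Real.pi * Complex.I * x * ζ) * (P ζ + x * Q ζ)

/-- The derivative of `modulation` in the second variable. -/
noncomputable def modulationDeriv (P Q : 𝓢(ℝ, ℂ)) (x ζ : ℝ) : ℂ :=
  Complex.exp (2 * Real.pi * Complex.I * x * ζ) *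
    (2 * Real.pi * Complex.I * x * (P ζ + x * Q ζ) + (deriv P ζ + x * deriv Q ζ))

/-- A majorant of `modulationDeriv` for `|x| ≤ 1`. -/
noncomputable def modulationBound (P Q : 𝓢(ℝ, ℂ)) (ζ : ℝ) : ℝ :=
  2 * Real.pi * (‖P ζ‖ + ‖Q ζ‖) + (‖deriv P ζ‖ + ‖deriv Q ζ‖)

theorem norm_exp_two_pi_I_mul_mul (x ζ : ℝ) :
    ‖Complex.exp (2 * Real.pi * Complex.I * x * ζ)‖ = 1 := by
  have : (2 * Real.pi * Complex.I * x * ζ : ℂ) = ((2 * Real.pi * x * ζ : ℝ) : ℂ) * Complex.I := by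
    push_cast; ring
  rw [this, Complex.norm_exp_ofReal_mul_I]

theorem hasDerivAt_modulation (P Q : 𝓢(ℝ, ℂ)) (x ζ : ℝ) :
    HasDerivAt (modulation P Q x) (modulationDeriv P Q x ζ) ζ := by
  have h1 : HasDerivAt (fun ζ : ℝ => Complex.exp (2 * Real.pi * Complex.I * x * ζ))
      (Complex.exp (2 * Real.pi * Complex.I * x * ζ) * (2 * Real.pi * Complex.I * x)) ζ := by
    have := (Complex.ofRealCLM.hasDerivAt (x := ζ)).const_mul (2 * Real.pi * Complex.I * x : ℂ)
    simpa using this.cexp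
  have h2 : HasDerivAt (fun ζ : ℝ => P ζ + x * Q ζ) (deriv P ζ + x * deriv Q ζ) ζ :=
    (P.differentiableAt.hasDerivAt).add (Q.differentiableAt.hasDerivAt.const_mul _)
  refine (h1.mul h2).congr_deriv ?_
  unfold modulationDeriv
  ring

theorem continuous_deriv_schwartz (P : 𝓢(ℝ, ℂ)) : Continuous (deriv P) :=
  (SchwartzMap.derivCLM ℂ ℂ P).continuous

theorem measurable_modulationDeriv (P Q : 𝓢(ℝ, ℂ)) (x : ℝ) : Measurable
    (modulationDeriv P Q x) := by
  have h1 := continuous_deriv_schwartz P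
  have h2 := continuous_deriv_schwartz Q
  have h3 := P.continuous
  have h4 := Q.continuous
  unfold modulationDeriv
  exact Continuous.measurable (by fun_prop)

theorem measurable_modulationBound (P Q : 𝓢(ℝ, ℂ)) : Measurable (modulationBound P Q) := by
  have h1 := continuous_deriv_schwartz P
  have h2 := continuous_deriv_schwartz Q
  have h3 := P.continuous
  have h4 := Q.continuous
  unfold modulationBound
  exact Continuous.measurable (by fun_prop)

theorem norm_add_mul_le_of_abs_le_one {a b : ℂ} {x : ℝ} (hx : |x| ≤ 1) :
    ‖a + x * b‖ ≤ ‖a‖ + ‖b‖ := by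
  refine (norm_add_le _ _).trans (add_le_add le_rfl ?_)
  rw [norm_mul, Complex.norm_real]
  exact mul_le_of_le_one_left (norm_nonneg _) hx

theorem norm_modulationDeriv_le (P Q : 𝓢(ℝ, ℂ)) {x : ℝ} (hx : |x| ≤ 1) (ζ : ℝ) :
    ‖modulationDeriv P Q x ζ‖ ≤ modulationBound P Q ζ := by
  unfold modulationDeriv modulationBound
  rw [norm_mul, norm_exp_two_pi_I_mul_mul, one_mul]
  refine (norm_add_le _ _).trans (add_le_add ?_ (norm_add_mul_le_of_abs_le_one hx))
  rw [norm_mul]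
  refine mul_le_mul ?_ (norm_add_mul_le_of_abs_le_one hx) (norm_nonneg _) Real.two_pi_pos.le
  rw [norm_mul, Complex.norm_real]
  have : ‖(2 * Real.pi * Complex.I : ℂ)‖ = 2 * Real.pi := by
    simp [abs_of_pos Real.pi_pos]
  rw [this]
  exact mul_le_of_le_one_right Real.two_pi_pos.le hx

theorem integrable_modulationBound (P Q : 𝓢(ℝ, ℂ)) : Integrable (modulationBound P Q) := by
  have h := fun P : 𝓢(ℝ, ℂ) => (P.integrable (μ := volume)).norm
  have h' := fun P : 𝓢(ℝ, ℂ) => ((SchwartzMap.derivCLM ℂ ℂ P).integrable (μ := volume)).norm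
  exact (((h P).add (h Q)).const_mul _).add ((h' P).add (h' Q))

theorem integrable_abs_mul_modulationBound (P Q : 𝓢(ℝ, ℂ)) :
    Integrable fun σ => |σ| * modulationBound P Q σ := by
  have h := fun P : 𝓢(ℝ, ℂ) => P.integrable_pow_mul volume 1
  have h' := fun P : 𝓢(ℝ, ℂ) => (SchwartzMap.derivCLM ℂ ℂ P).integrable_pow_mul volume 1
  refine ((((h P).add (h Q)).const_mul (2 * Real.pi)).add ((h' P).add (h' Q))).congr
    (Eventually.of_forall fun σ => ?_)
  simp only [modulationBound, Pi.add_apply, pow_one, Real.norm_eq_abs, SchwartzMap.derivCLM_apply]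
  ring

theorem tendsto_modulation_cocompact (P Q : 𝓢(ℝ, ℂ)) (x : ℝ) :
    Tendsto (modulation P Q x) (cocompact ℝ) (𝓝 0) := by
  have h := fun P : 𝓢(ℝ, ℂ) => zero_at_infty P
  have h2 : Tendsto (fun ζ => P ζ + x * Q ζ) (cocompact ℝ) (𝓝 (0 + x * 0)) :=
    (h P).add ((h Q).const_mul _)
  rw [mul_zero, add_zero] at h2
  have h3 := h2.norm
  rw [norm_zero] at h3
  refine squeeze_zero_norm (fun ζ => le_of_eq ?_) h3
  rw [modulation, norm_mul, norm_exp_two_pi_I_mul_mul, one_mul]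

theorem tendsto_modulation_atTop (P Q : 𝓢(ℝ, ℂ)) (x : ℝ) :
    Tendsto (modulation P Q x) atTop (𝓝 0) :=
  (tendsto_modulation_cocompact P Q x).mono_left
      (by rw [cocompact_eq_atBot_atTop]; exact le_sup_right)

theorem tendsto_modulation_atBot (P Q : 𝓢(ℝ, ℂ)) (x : ℝ) :
    Tendsto (modulation P Q x) atBot (𝓝 0) :=
  (tendsto_modulation_cocompact P Q x).mono_left
      (by rw [cocompact_eq_atBot_atTop]; exact le_sup_left)

end Modulation

section TripleFubini

open Set

variable {n : ℕ}

/-- The measure `dr du` on `(0, 1] × ℝⁿ`. -/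
noncomputable def segMeasure (n : ℕ) : Measure (ℝ × EuclideanSpace ℝ (Fin n)) :=
  (volume.restrict (Ioc 0 1)).prod volume

instance : SFinite (segMeasure n) := by unfold segMeasure; infer_instance

theorem integrable_segMeasure_snd {κ : EuclideanSpace ℝ (Fin n) → ℂ} (hκ : Integrable κ) :
    Integrable (fun z => κ z.2) (segMeasure n) := by
  have h1 : Integrable (fun _ : ℝ => (1 : ℂ)) (volume.restrict (Ioc 0 1)) :=
    integrable_const _
  simpa [segMeasure] using h1.mul_prod hκ

theorem integral_mul_fourierInv_translate {κ ψ : EuclideanSpace ℝ (Fin n) → ℂ} (hκ : Integrable κ)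
    (hψ : Integrable ψ) (x : EuclideanSpace ℝ (Fin n)) :
    ∫ z, κ z.2 * 𝓕⁻ ψ (x - z.1 • z.2) ∂(segMeasure n) =
      ∫ ξ, 𝐞 (inner ℝ ξ x) • (ψ ξ * ∫ r in (0 : ℝ)..1, 𝓕 κ (r • ξ)) := by
  have hInt : Integrable (Function.uncurry fun (z : ℝ × EuclideanSpace ℝ (Fin n))
      (ξ : EuclideanSpace ℝ (Fin n)) => κ z.2 * 𝐞 (inner ℝ ξ (x - z.1 • z.2)) • ψ ξ)
      ((segMeasure n).prod volume) := by
    have h := (integrable_segMeasure_snd hκ).mul_prod hψ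
    have hc : Continuous fun w : (ℝ × EuclideanSpace ℝ (Fin n)) × EuclideanSpace ℝ (Fin n) =>
        ((𝐞 (inner ℝ w.2 (x - w.1.1 • w.1.2)) : Circle) : ℂ) := by
      have := Real.continuous_fourierChar
      fun_prop
    refine (h.bdd_mul (c := 1) hc.aestronglyMeasurable
      (Filter.Eventually.of_forall fun w => (Circle.norm_coe _).le)).congr
      (Filter.Eventually.of_forall fun w => ?_)
    simp only [Function.uncurry, Circle.smul_def, smul_eq_mul]
    ring
  have h1 : ∀ z : ℝ × EuclideanSpace ℝ (Fin n), κ z.2 * 𝓕⁻ ψ (x - z.1 • z.2) =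
      ∫ ξ, κ z.2 * 𝐞 (inner ℝ ξ (x - z.1 • z.2)) • ψ ξ := fun z => by
    rw [Real.fourierInv_eq, integral_const_mul]
  simp only [h1]
  rw [integral_integral_swap hInt]
  congr 1
  ext ξ
  have h2 : ∀ z : ℝ × EuclideanSpace ℝ (Fin n), κ z.2 * 𝐞 (inner ℝ ξ (x - z.1 • z.2)) • ψ ξ =
      ((𝐞 (inner ℝ ξ x) : Circle) : ℂ) * ψ ξ * (𝐞 (-inner ℝ z.2 (z.1 • ξ)) • κ z.2) := fun z => by
    rw [inner_sub_right, sub_eq_add_neg, AddChar.map_add_eq_mul, inner_smul_right,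
      inner_smul_right, real_inner_comm ξ]
    simp only [Circle.smul_def, smul_eq_mul, Circle.coe_mul]
    ring
  simp only [h2]
  rw [integral_const_mul, Circle.smul_def, smul_eq_mul, mul_assoc]
  congr 2
  have hint2 : Integrable (fun z : ℝ × EuclideanSpace ℝ (Fin n) =>
      𝐞 (-inner ℝ z.2 (z.1 • ξ)) • κ z.2) (segMeasure n) := by
    have hc : Continuous fun z : ℝ × EuclideanSpace ℝ (Fin n) =>
        ((𝐞 (-inner ℝ z.2 (z.1 • ξ)) : Circle) : ℂ) := by
      have := Real.continuous_fourierChar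
      fun_prop
    exact (integrable_segMeasure_snd hκ).bdd_mul (c := 1) hc.aestronglyMeasurable
      (Filter.Eventually.of_forall fun w => (Circle.norm_coe _).le)
  unfold segMeasure at hint2 ⊢
  rw [integral_prod _ hint2, intervalIntegral.integral_of_le zero_le_one]
  simp only [Real.fourier_eq]

end TripleFubini

section ConeBound

open Filter Topology Set

variable {n : ℕ}

local notation "E" => EuclideanSpace ℝ (Fin n)

/-- The set `coneSet j l` as a subset of Euclidean space. -/
def euclideanCone (j : Fin n) (l : ℝ × (Fin n → ℝ)) : Set (EuclideanSpace ℝ (Fin n)) :=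
  {ξ | (fun k => ξ k) ∈ coneSet j l}

theorem measurableSet_uncurry_euclideanCone (j : Fin n) :
    MeasurableSet {z : E × (ℝ × (Fin n → ℝ)) | z.1 ∈ euclideanCone j z.2} := by
  have h : Measurable fun z : E × (ℝ × (Fin n → ℝ)) => ((fun k => z.1 k : Fin n → ℝ), z.2) := by
    fun_prop
  exact (measurableSet_coneSet j).preimage h

/-- The normals of the half-spaces cutting out `euclideanCone j l`. -/
noncomputable def coneNormal (j : Fin n) (l : ℝ × (Fin n → ℝ)) :
    Option (Fin n × Bool) → EuclideanSpace ℝ (Fin n)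
  | none => (SignType.sign (l.2 j) : ℝ) • EuclideanSpace.single j 1
  | some (k, false) => l.2 k • EuclideanSpace.single k 1
  | some (k, true) => (|l.2 k| * (SignType.sign (l.2 j) : ℝ)) • EuclideanSpace.single j 1 -
      (l.1 * (SignType.sign (l.2 k) : ℝ)) • EuclideanSpace.single k 1

theorem euclideanCone_eq (j : Fin n) (l : ℝ × (Fin n → ℝ)) :
    euclideanCone j l = {ξ | ∀ a ∈ (Finset.univ : Finset (Option (Fin n × Bool))),
      (if a = none then l.1 else 0) < inner ℝ ξ (coneNormal j l a)} := by
  ext ξ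
  have hi : ∀ k, inner ℝ ξ (EuclideanSpace.single k (1 : ℝ)) = ξ k := fun k => by
    rw [EuclideanSpace.inner_single_right]; simp
  simp only [euclideanCone, coneSet, mem_ofPred_eq, Finset.mem_univ, true_imp_iff, Option.forall,
    Prod.forall, Bool.forall_bool, coneNormal, if_true, reduceCtorEq, if_false, inner_smul_right,
    inner_sub_right, hi, sub_pos, mul_assoc]

theorem exists_eLpNorm_fourierInv_euclideanCone_le (n : ℕ) {p : ℝ} (hp : 1 < p) :
    ∃ C : ℝ≥0, ∀ (j : Fin n) (l : ℝ × (Fin n → ℝ)) (ψ : EuclideanSpace ℝ (Fin n) → ℂ),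
      RapidDecay ψ → eLpNorm (𝓕⁻ ((euclideanCone j l).indicator ψ)) (ENNReal.ofReal p) ≤
        C * eLpNorm (𝓕⁻ ψ) (ENNReal.ofReal p) := by
  obtain ⟨C, hC⟩ := exists_eLpNorm_fourierInv_iInter_halfSpace_le
    (V := EuclideanSpace ℝ (Fin n)) hp
  refine ⟨C ^ (Finset.univ : Finset (Option (Fin n × Bool))).card, fun j l ψ hψ => ?_⟩
  have := hC Finset.univ (coneNormal j l) (fun a => if a = none then l.1 else 0) ψ hψ
  rw [← euclideanCone_eq] at this
  push_cast
  exact this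

theorem integral_mul_prod_eq_integral_boxKernel {Φ Φ' : Fin n → ℝ → ℂ}
    (hΦ : ∀ k ζ, HasDerivAt (Φ k) (Φ' k ζ) ζ) (hm : ∀ k, Measurable (Φ' k))
    (ht : ∀ k, Tendsto (Φ k) atTop (𝓝 0)) (hb : ∀ k, Tendsto (Φ k) atBot (𝓝 0))
    {A : ℝ → ℝ} (hAm : Measurable A) (hA : Integrable A) (hA' : Integrable fun σ => |σ| * A σ)
    (hΦA : ∀ k σ, ‖Φ' k σ‖ ≤ A σ) {ψ : E → ℂ} (hψ : Integrable ψ) (j : Fin n) (x : E) :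
    ∫ ξ, 𝐞 (inner ℝ ξ x) • (ψ ξ * ((ξ j : ℂ) * ∫ r in (0 : ℝ)..1, ∏ k, Φ k (r * ξ k))) =
      ∫ l, boxKernel Φ' j l * 𝓕⁻ ((euclideanCone j l).indicator ψ) x ∂(boxMeasure n) := by
  have hA0 : ∀ σ, 0 ≤ A σ := fun σ => (norm_nonneg _).trans (hΦA j σ)
  have hne : ∀ᵐ ξ : E, ∀ k, ξ k ≠ 0 := by
    rw [ae_all_iff]
    intro k
    have h0 : (EuclideanSpace.single k (1 : ℝ) : E) ≠ 0 := by simp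
    have := volume_inner_eq_zero h0
    rw [ae_iff]
    simpa [EuclideanSpace.inner_single_right] using this
  have h1 : ∫ ξ, 𝐞 (inner ℝ ξ x) • (ψ ξ * ((ξ j : ℂ) * ∫ r in (0 : ℝ)..1, ∏ k, Φ k (r * ξ k))) =
      ∫ ξ, ∫ l, boxKernel Φ' j l * (𝐞 (inner ℝ ξ x) • (euclideanCone j l).indicator ψ ξ)
        ∂(boxMeasure n) := by
    refine integral_congr_ae (hne.mono fun ξ hξ => ?_)
    simp only
    rw [mul_integral_prod_eq_integral_coneSet hΦ hm ht hb hAm hA hA' hΦA (ξ := fun k => ξ k) hξ j,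
      Circle.smul_def, smul_eq_mul, ← mul_assoc, ← integral_const_mul]
    congr 1
    ext l
    by_cases h : ξ ∈ euclideanCone j l
    · rw [indicator_of_mem h, indicator_of_mem (show (fun k => ξ k) ∈ coneSet j l from h),
        Circle.smul_def, smul_eq_mul]
      ring
    · rw [indicator_of_notMem h, indicator_of_notMem (show (fun k => ξ k) ∉ coneSet j l from h)]
      simp
  rw [h1, integral_integral_swap]
  · congr 1
    ext l
    rw [Real.fourierInv_eq, integral_const_mul]
  have hWi : Integrable (boxKernel Φ' j) (boxMeasure n) :=
    (integrable_boxWeight hA0 hAm hA hA' j).mono' (measurable_boxKernel hm j).aestronglyMeasurable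
      (Eventually.of_forall fun l => norm_boxKernel_le hΦA j l)
  have h := hψ.mul_prod hWi
  have hc : Continuous fun z : E × (ℝ × (Fin n → ℝ)) => ((𝐞 (inner ℝ z.1 x) : Circle) : ℂ) := by
    have := Real.continuous_fourierChar
    fun_prop
  have h2 := (h.bdd_mul (c := 1) hc.aestronglyMeasurable
      (Eventually.of_forall fun w => (Circle.norm_coe _).le)).indicator
      (measurableSet_uncurry_euclideanCone j)
  refine h2.congr (Eventually.of_forall fun z => ?_)
  simp only [Function.uncurry]
  by_cases hz : z.1 ∈ euclideanCone j z.2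
  · rw [indicator_of_mem hz, indicator_of_mem (show z ∈ {z : E × (ℝ × (Fin n → ℝ)) |
      z.1 ∈ euclideanCone j z.2} from hz), Circle.smul_def, smul_eq_mul]
    ring
  · rw [indicator_of_notMem hz, indicator_of_notMem (show z ∉ {z : E × (ℝ × (Fin n → ℝ)) |
      z.1 ∈ euclideanCone j z.2} from hz)]
    simp

theorem measurable_fourierInv_indicator_euclideanCone {ψ : E → ℂ} (hψ : Continuous ψ)
    (j : Fin n) :
    Measurable (Function.uncurry fun (x : E) (l : ℝ × (Fin n → ℝ)) =>
      ‖𝓕⁻ ((euclideanCone j l).indicator ψ) x‖ₑ) := by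
  have hm : StronglyMeasurable fun w : (E × (ℝ × (Fin n → ℝ))) × E =>
      𝐞 (inner ℝ w.2 w.1.1) • (euclideanCone j w.1.2).indicator ψ w.2 := by
    have hc : Continuous fun w : (E × (ℝ × (Fin n → ℝ))) × E => 𝐞 (inner ℝ w.2 w.1.1) • ψ w.2 := by
      have := Real.continuous_fourierChar
      simp only [Circle.smul_def]
      fun_prop
    have hms : MeasurableSet {w : (E × (ℝ × (Fin n → ℝ))) × E | w.2 ∈ euclideanCone j w.1.2} :=
      (measurableSet_uncurry_euclideanCone j).preimage
        (show Measurable fun w : (E × (ℝ × (Fin n → ℝ))) × E => (w.2, w.1.2) by fun_prop)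
    convert hc.stronglyMeasurable.indicator hms using 1
    ext w
    by_cases hw : w.2 ∈ euclideanCone j w.1.2
    · rw [indicator_of_mem hw, indicator_of_mem (show w ∈
        {w : (E × (ℝ × (Fin n → ℝ))) × E | w.2 ∈ euclideanCone j w.1.2} from hw)]
    · rw [indicator_of_notMem hw, indicator_of_notMem (show w ∉
        {w : (E × (ℝ × (Fin n → ℝ))) × E | w.2 ∈ euclideanCone j w.1.2} from hw), smul_zero]
  have := (StronglyMeasurable.integral_prod_right' (ν := (volume : Measure E)) hm).measurable.enorm
  simp only [Real.fourierInv_eq]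
  exact this

end ConeBound

section SingularPart

open Filter Topology Set
open scoped SchwartzMap LineDeriv

variable {n : ℕ}

local notation "E" => EuclideanSpace ℝ (Fin n)

theorem rapidDecay_schwartz {V : Type*} [NormedAddCommGroup V] [InnerProductSpace ℝ V]
    [FiniteDimensional ℝ V] [MeasurableSpace V] [BorelSpace V] (f : 𝓢(V, ℂ)) : RapidDecay f := by
  refine ⟨f.continuous.aestronglyMeasurable, fun N =>
    ⟨2 ^ N * ((Finset.Iic (N, 0)).sup fun m => SchwartzMap.seminorm ℝ m.1 m.2) f, fun ξ => ?_⟩⟩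
  have := SchwartzMap.one_add_le_sup_seminorm_apply (𝕜 := ℝ) (m := (N, 0)) le_rfl le_rfl f ξ
  rw [norm_iteratedFDeriv_zero, mul_comm] at this
  exact this

theorem integrable_euclidean_prod {φ : Fin n → ℝ → ℂ} (hφ : ∀ k, Integrable (φ k)) :
    Integrable fun u : E => ∏ k, φ k (u k) :=
  ((PiLp.volume_preserving_ofLp (Fin n)).integrable_comp_emb
    (MeasurableEquiv.toLp 2 (Fin n → ℝ)).symm.measurableEmbedding).2 (Integrable.fintype_prod hφ)

theorem fourier_euclidean_prod (φ : Fin n → ℝ → ℂ) (ζ : E) :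
    𝓕 (fun u : E => ∏ k, φ k (u k)) ζ = ∏ k, 𝓕 (φ k) (ζ k) := by
  have h1 : ∀ u : E, 𝐞 (-inner ℝ u ζ) • ∏ k, φ k (u k) = ∏ k, 𝐞 (-(u k * ζ k)) • φ k (u k) := by
    intro u
    have h0 : -inner ℝ u ζ = ∑ k, -(u k * ζ k) := by
      rw [Finset.sum_neg_distrib, PiLp.inner_apply]
      congr 1
      refine Finset.sum_congr rfl fun k _ => ?_
      simp [mul_comm]
    have h2 : ∀ s : Finset (Fin n), ((𝐞 (∑ k ∈ s, -(u k * ζ k)) : Circle) : ℂ) =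
        ∏ k ∈ s, ((𝐞 (-(u k * ζ k)) : Circle) : ℂ) := fun s => by
      induction s using Finset.cons_induction with
      | empty => simp
      | cons a s ha ih =>
        rw [Finset.sum_cons, Finset.prod_cons, AddChar.map_add_eq_mul, Circle.coe_mul, ih]
    rw [h0, Circle.smul_def, h2]
    simp only [Circle.smul_def, smul_eq_mul, Finset.prod_mul_distrib]
  have h3 := (PiLp.volume_preserving_ofLp (Fin n)).integral_comp
    (MeasurableEquiv.toLp 2 (Fin n → ℝ)).symm.measurableEmbedding
    (fun u : Fin n → ℝ => ∏ k, 𝐞 (-(u k * ζ k)) • φ k (u k))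
  rw [Real.fourier_eq]
  simp only [h1]
  refine h3.trans ?_
  rw [integral_fintype_prod_volume_eq_prod (fun k t => 𝐞 (-(t * ζ k)) • φ k t)]
  refine Finset.prod_congr rfl fun k _ => ?_
  rw [Real.fourier_eq]
  refine integral_congr_ae (Eventually.of_forall fun t => ?_)
  simp [mul_comm]

theorem fourier_translate_eq_modulation (f q : 𝓢(ℝ, ℂ)) (x ζ : ℝ) :
    𝓕 (fun t : ℝ => f (x + t) + x * q (x + t)) ζ = modulation (𝓕 f) (𝓕 q) x ζ := by
  have hi := fun f : 𝓢(ℝ, ℂ) => (Real.fourierIntegral_convergent_iff (μ := volume) (f := f) ζ).2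
    f.integrable
  have h1 : ∀ t : ℝ, 𝐞 (-inner ℝ t ζ) • (f (x + t) + x * q (x + t)) =
      (fun s : ℝ => ((𝐞 (x * ζ) : Circle) : ℂ) *
        (𝐞 (-inner ℝ s ζ) • f s + x * 𝐞 (-inner ℝ s ζ) • q s)) (x + t) := fun t => by
    have : -inner ℝ t ζ = x * ζ + -inner ℝ (x + t) ζ := by
      simp only [RCLike.inner_apply, conj_trivial]; ring
    rw [this, AddChar.map_add_eq_mul]
    simp only [Circle.smul_def, smul_eq_mul, Circle.coe_mul]
    ring
  rw [Real.fourier_eq]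
  simp only [h1]
  rw [integral_add_left_eq_self (fun s : ℝ => ((𝐞 (x * ζ) : Circle) : ℂ) *
        (𝐞 (-inner ℝ s ζ) • f s + x * 𝐞 (-inner ℝ s ζ) • q s)) x, integral_const_mul,
    integral_add (hi f) ((hi q).const_mul _), integral_const_mul, modulation,
    SchwartzMap.fourier_coe, SchwartzMap.fourier_coe, Real.fourier_eq, Real.fourier_eq,
    Real.fourierChar_apply]
  congr 2
  push_cast
  ring

/-- The singular part of the gradient of the Bogovskiĭ potential. -/
noncomputable def singularPart (ω₀ : ℝ → ℝ) (g : E → ℝ) (i j : Fin n) (x : E) : ℝ :=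
  ∫ z, z.2 i * fderiv ℝ g (x - z.1 • z.2) (EuclideanSpace.single j 1) *
    ∏ k, ω₀ (x k + z.2 k) ∂(segMeasure n)

theorem fourier_lineDeriv_apply (g : 𝓢(E, ℂ)) (j : Fin n) (ξ : E) :
    𝓕 (∂_{(EuclideanSpace.single j (1 : ℝ) : E)} g) ξ =
      2 * Real.pi * Complex.I * (ξ j * 𝓕 g ξ) := by
  have h : Function.HasTemperateGrowth
      fun ξ : E => inner ℝ ξ (EuclideanSpace.single j (1 : ℝ)) :=
    ((innerSL ℝ).flip (EuclideanSpace.single j (1 : ℝ) : E)).hasTemperateGrowth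
  rw [SchwartzMap.fourier_lineDerivOp_eq, smul_apply,
    SchwartzMap.smulLeftCLM_apply_apply h, EuclideanSpace.inner_single_right]
  simp

theorem singularPart_eq {ω₀ : ℝ → ℝ} {f q : Fin n → 𝓢(ℝ, ℂ)} {i j : Fin n}
    (hf : ∀ k (x t : ℝ), f k (x + t) + x * q k (x + t) =
      (if k = i then (t : ℂ) else 1) * ω₀ (x + t))
    {g : E → ℝ} (G : 𝓢(E, ℂ)) (hG : ∀ x, G x = g x) (hg : Differentiable ℝ g) (x : E) :
    (singularPart ω₀ g i j x : ℂ) = 2 * Real.pi * Complex.I *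
      ∫ ξ, 𝐞 (inner ℝ ξ x) • (𝓕 (G : E → ℂ) ξ * ((ξ j : ℂ) * ∫ r in (0 : ℝ)..1,
        ∏ k, modulation (𝓕 (f k)) (𝓕 (q k)) (x k) (r * ξ k))) := by
  have hκ : Integrable fun u : E => ∏ k, (f k (x k + u k) + x k * q k (x k + u k)) :=
    integrable_euclidean_prod (φ := fun k t => f k (x k + t) + x k * q k (x k + t)) fun k =>
      ((f k).integrable.comp_add_left _).add (((q k).integrable.comp_add_left _).const_mul _)
  set D := ∂_{(EuclideanSpace.single j (1 : ℝ) : E)} G with hD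
  have hDg : ∀ y, D y = (fderiv ℝ g y (EuclideanSpace.single j 1) : ℝ) := fun y => by
    rw [hD, SchwartzMap.lineDerivOp_apply_eq_fderiv]
    have h0 : (G : E → ℂ) = fun x => Complex.ofRealCLM (g x) := funext fun x => by
      simp [hG]
    have h1 : HasFDerivAt (G : E → ℂ) (Complex.ofRealCLM.comp (fderiv ℝ g y)) y := by
      rw [h0]
      exact Complex.ofRealCLM.hasFDerivAt.comp y (hg y).hasFDerivAt
    rw [h1.fderiv]
    rfl
  have hinv : ∀ y, 𝓕⁻ ((𝓕 D : 𝓢(E, ℂ)) : E → ℂ) y = D y := fun y => by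
    rw [← SchwartzMap.fourierInv_coe, FourierTransform.fourierInv_fourier_eq]
  have h1 : (singularPart ω₀ g i j x : ℂ) =
      ∫ z, (∏ k, (f k (x k + z.2 k) + x k * q k (x k + z.2 k))) *
        𝓕⁻ ((𝓕 D : 𝓢(E, ℂ)) : E → ℂ) (x - z.1 • z.2) ∂(segMeasure n) := by
    rw [singularPart, ← integral_complex_ofReal]
    congr 1
    ext z
    rw [hinv, hDg]
    simp only [hf, Finset.prod_mul_distrib, Finset.prod_ite_eq', Finset.mem_univ, if_true]
    push_cast
    ring
  rw [h1, integral_mul_fourierInv_translate hκ (𝓕 D : 𝓢(E, ℂ)).integrable, ← integral_const_mul]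
  congr 1
  ext ξ
  rw [fourier_lineDeriv_apply, Circle.smul_def, Circle.smul_def, smul_eq_mul, smul_eq_mul,
    SchwartzMap.fourier_coe]
  have h2 : ∀ r : ℝ, 𝓕 (fun u : E => ∏ k, (f k (x k + u k) + x k * q k (x k + u k))) (r • ξ) =
      ∏ k, modulation (𝓕 (f k)) (𝓕 (q k)) (x k) (r * ξ k) := fun r => by
    rw [fourier_euclidean_prod (fun k t => f k (x k + t) + x k * q k (x k + t))]
    refine Finset.prod_congr rfl fun k _ => ?_
    rw [fourier_translate_eq_modulation]
    simp
  simp only [h2]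
  ring

theorem exists_schwartz_translate_eq {ω₀ : ℝ → ℝ} (hω : ContDiff ℝ ∞ ω₀)
    (hc : HasCompactSupport ω₀) (i : Fin n) :
    ∃ f q : Fin n → 𝓢(ℝ, ℂ), ∀ k (x t : ℝ), f k (x + t) + x * q k (x + t) =
      (if k = i then (t : ℂ) else 1) * ω₀ (x + t) := by
  have hv : ContDiff ℝ ∞ fun t => (ω₀ t : ℂ) := Complex.ofRealCLM.contDiff.comp hω
  have hvc : HasCompactSupport fun t => (ω₀ t : ℂ) := hc.comp_left (g := fun t : ℝ => (t : ℂ))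
      (by simp)
  have hu : ContDiff ℝ ∞ fun t : ℝ => (t : ℂ) * ω₀ t := Complex.ofRealCLM.contDiff.mul hv
  have huc : HasCompactSupport fun t : ℝ => (t : ℂ) * ω₀ t := hvc.mul_left
  have hva : ∀ t, hvc.toSchwartzMap hv t = ω₀ t := fun t => rfl
  have hua : ∀ t, huc.toSchwartzMap hu t = t * ω₀ t := fun t => rfl
  refine ⟨fun k => if k = i then huc.toSchwartzMap hu else hvc.toSchwartzMap hv,
    fun k => if k = i then -hvc.toSchwartzMap hv else 0, fun k x t => ?_⟩
  by_cases h : k = i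
  · simp only [h, if_true, neg_apply, hva, hua]
    push_cast; ring
  · simp [h, hva]

theorem exists_lintegral_singularPart_le {p : ℝ} (hp : 1 < p) {ω₀ : ℝ → ℝ}
    (hω : ContDiff ℝ ∞ ω₀) (hc : HasCompactSupport ω₀) (i j : Fin n) :
    ∃ C : ℝ≥0, ∀ g : E → ℝ, ContDiff ℝ ∞ g → HasCompactSupport g →
      ∫⁻ x in closedBall 0 1, ‖singularPart ω₀ g i j x‖ₑ ^ p ≤ C * ∫⁻ x, ‖g x‖ₑ ^ p := by
  have hp0 : 0 < p := by linarith
  obtain ⟨K, hK⟩ := exists_eLpNorm_fourierInv_euclideanCone_le n hp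
  obtain ⟨f, q, hf⟩ := exists_schwartz_translate_eq hω hc i
  obtain ⟨A, hAd⟩ : ∃ A : ℝ → ℝ, A = fun σ => ∑ k, modulationBound (𝓕 (f k)) (𝓕 (q k)) σ :=
    ⟨_, rfl⟩
  have hb0 : ∀ k σ, 0 ≤ modulationBound (𝓕 (f k)) (𝓕 (q k)) σ := fun k σ => by
    unfold modulationBound; have := Real.pi_pos; positivity
  have hA0 : ∀ σ, 0 ≤ A σ := fun σ => by
    rw [hAd]; exact Finset.sum_nonneg fun k _ => hb0 k σ
  have hAm : Measurable A := hAd ▸ Finset.measurable_fun_sum _ fun k _ => measurable_modulationBound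
      _ _
  have hA : Integrable A := hAd ▸ integrable_finsetSum _ fun k _ => integrable_modulationBound _ _
  have hA' : Integrable fun σ => |σ| * A σ := by
    simp only [hAd, Finset.mul_sum]
    exact integrable_finsetSum _ fun k _ => integrable_abs_mul_modulationBound _ _
  have hW := integrable_boxWeight hA0 hAm hA hA' j
  obtain ⟨w, hw⟩ : ∃ w : ℝ × (Fin n → ℝ) → ℝ, w = fun l =>
    {l : ℝ × (Fin n → ℝ) | l.1 < |l.2 j|}.indicator (fun l => ∏ k, A (l.2 k)) l := ⟨_, rfl⟩
  rw [← hw] at hW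
  have hwm : Measurable w := by
    rw [hw]
    refine Measurable.indicator ?_ (measurableSet_lt measurable_fst (by fun_prop))
    fun_prop
  have hWfin : ∫⁻ l, ‖w l‖ₑ ∂(boxMeasure n) < ⊤ := hW.2
  set M : ℝ≥0∞ := ENNReal.ofReal (2 * Real.pi) ^ p *
    ((∫⁻ l, ‖w l‖ₑ ∂(boxMeasure n)) ^ p * (K : ℝ≥0∞) ^ p) with hM
  have hMfin : M ≠ ⊤ := by
    rw [hM]
    refine ENNReal.mul_ne_top (by finiteness) (ENNReal.mul_ne_top ?_ (by finiteness))
    exact ENNReal.rpow_ne_top_of_nonneg hp0.le hWfin.ne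
  refine ⟨M.toNNReal, fun g hg hgc => ?_⟩
  rw [ENNReal.coe_toNNReal hMfin]
  have hG : ContDiff ℝ ∞ fun t => (g t : ℂ) := Complex.ofRealCLM.contDiff.comp hg
  have hGc : HasCompactSupport fun t => (g t : ℂ) := hgc.comp_left (g := fun t : ℝ => (t : ℂ))
      (by simp)
  obtain ⟨G, hGa⟩ : ∃ G : 𝓢(E, ℂ), ∀ t, G t = g t := ⟨hGc.toSchwartzMap hG, fun t => rfl⟩
  obtain ⟨ψ, hψ⟩ : ∃ ψ : E → ℂ, ψ = 𝓕 (G : E → ℂ) := ⟨_, rfl⟩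
  have hψd : RapidDecay ψ := by rw [hψ, ← SchwartzMap.fourier_coe]; exact rapidDecay_schwartz _
  have hψc : Continuous ψ := by rw [hψ, ← SchwartzMap.fourier_coe]; exact (𝓕 G : 𝓢(E, ℂ)).continuous
  have hψinv : ∀ y, 𝓕⁻ ψ y = g y := fun y => by
    rw [hψ, ← SchwartzMap.fourier_coe, ← SchwartzMap.fourierInv_coe,
      FourierTransform.fourierInv_fourier_eq, hGa]
  set H : E → ℝ × (Fin n → ℝ) → ℝ≥0∞ := fun x l =>
    ‖𝓕⁻ ((euclideanCone j l).indicator ψ) x‖ₑ with hH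
  have hHm : Measurable (Function.uncurry H) :=
    measurable_fourierInv_indicator_euclideanCone hψc j
  have hpow : ∀ χ : E → ℂ, eLpNorm χ (ENNReal.ofReal p) volume ^ p = ∫⁻ x, ‖χ x‖ₑ ^ p := fun χ => by
    rw [eLpNorm_eq_lintegral_rpow_enorm_toReal (by simpa using hp0) (by simp),
      ENNReal.toReal_ofReal hp0.le, ← ENNReal.rpow_mul, one_div_mul_cancel hp0.ne',
      ENNReal.rpow_one]
  have hHK : ∀ l, ∫⁻ x, H x l ^ p ≤ (K : ℝ≥0∞) ^ p * ∫⁻ x, ‖g x‖ₑ ^ p := fun l => by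
    have h1 := ENNReal.rpow_le_rpow (hK j l ψ hψd) hp0.le
    rw [ENNReal.mul_rpow_of_nonneg _ _ hp0.le, hpow, hpow] at h1
    refine h1.trans_eq ?_
    simp only [hψinv, enorm, Complex.nnnorm_real]
  have hmain := lintegral_rpow_lintegral_mul_le (μ := (volume : Measure E)) (ν := boxMeasure n)
    hwm.enorm hHm hp hHK
  have hpt : ∀ x ∈ closedBall (0 : E) 1, ‖singularPart ω₀ g i j x‖ₑ ^ p ≤
      ENNReal.ofReal (2 * Real.pi) ^ p * (∫⁻ l, ‖w l‖ₑ * H x l ∂(boxMeasure n)) ^ p := by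
    intro x hx
    rw [← ENNReal.mul_rpow_of_nonneg _ _ hp0.le]
    refine ENNReal.rpow_le_rpow ?_ hp0.le
    have hxk : ∀ k, |x k| ≤ 1 := fun k =>
      (PiLp.norm_apply_le x k).trans (by simpa using hx)
    have hΦA : ∀ k σ, ‖modulationDeriv (𝓕 (f k)) (𝓕 (q k)) (x k) σ‖ ≤ A σ := fun k σ =>
      (norm_modulationDeriv_le _ _ (hxk k) σ).trans
          (hAd ▸ Finset.single_le_sum (f := fun k => modulationBound (𝓕 (f k)) (𝓕 (q k)) σ)
          (fun k _ => hb0 k σ) (Finset.mem_univ k))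
    have h1 := singularPart_eq (j := j) hf G hGa (hg.differentiable (by simp)) x
    rw [← hψ, integral_mul_prod_eq_integral_boxKernel
      (fun k ζ => hasDerivAt_modulation (𝓕 (f k)) (𝓕 (q k)) (x k) ζ)
      (fun k => measurable_modulationDeriv _ _ _) (fun k => tendsto_modulation_atTop _ _ _)
      (fun k => tendsto_modulation_atBot _ _ _) hAm hA hA' hΦA hψd.integrable j x] at h1
    have h2 : ‖singularPart ω₀ g i j x‖ₑ = ‖(singularPart ω₀ g i j x : ℂ)‖ₑ := by
      simp only [enorm, Complex.nnnorm_real]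
    rw [h2, h1, enorm_mul]
    have h3 : ‖(2 * Real.pi * Complex.I : ℂ)‖ₑ = ENNReal.ofReal (2 * Real.pi) := by
      rw [← ofReal_norm]
      simp [abs_of_pos Real.pi_pos]
    rw [h3]
    gcongr
    refine (enorm_integral_le_lintegral_enorm _).trans (lintegral_mono fun l => ?_)
    rw [enorm_mul]
    refine mul_le_mul' ?_ le_rfl
    rw [← ofReal_norm, ← ofReal_norm]
    rw [hw]
    exact ENNReal.ofReal_le_ofReal ((norm_boxKernel_le hΦA j l).trans (le_abs_self _))
  have h4 := (setLIntegral_mono' (μ := volume) measurableSet_closedBall hpt).trans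
      (setLIntegral_le_lintegral _ _)
  refine h4.trans ?_
  rw [lintegral_const_mul' _ _ (by finiteness), hM, mul_assoc, mul_assoc]
  gcongr

end SingularPart

section ParametricIntegral

open Filter Topology Set

theorem integrable_of_continuous_of_ae_eq_zero {X Z F : Type} [NormedAddCommGroup X]
    [NormedAddCommGroup Z] [MeasurableSpace Z] [BorelSpace Z] {μ : Measure Z}
    [IsFiniteMeasureOnCompacts μ] [NormedAddCommGroup F] {K : X × Z → F} (hK : Continuous K)
        {k : Set Z}
    (hk : IsCompact k) (h0 : ∀ᵐ z ∂μ, z ∉ k → ∀ x, K (x, z) = 0) (x : X) :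
    Integrable (fun z => K (x, z)) μ := by
  have hc : Continuous fun z => K (x, z) := hK.comp (by fun_prop)
  refine ((integrable_indicator_iff hk.measurableSet).2
    (hc.continuousOn.integrableOn_compact hk)).congr ?_
  filter_upwards [h0] with z hz
  by_cases hzk : z ∈ k
  · exact indicator_of_mem hzk _
  · rw [indicator_of_notMem hzk, hz hzk]

variable {X Z F : Type} [NormedAddCommGroup X] [NormedSpace ℝ X] [FiniteDimensional ℝ X]
  [NormedAddCommGroup Z] [NormedSpace ℝ Z] [MeasurableSpace Z] [BorelSpace Z]
  [SecondCountableTopology Z] {μ : Measure Z} [IsFiniteMeasureOnCompacts μ]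
  [NormedAddCommGroup F] [NormedSpace ℝ F]

theorem hasFDerivAt_integral_of_ae_eq_zero {K : X × Z → F} (hK : ContDiff ℝ 1 K) {k : Set Z}
    (hk : IsCompact k) (h0 : ∀ᵐ z ∂μ, z ∉ k → ∀ x, K (x, z) = 0) (x : X) :
    HasFDerivAt (fun x => ∫ z, K (x, z) ∂μ)
      (∫ z, (fderiv ℝ K (x, z)).comp (ContinuousLinearMap.inl ℝ X Z) ∂μ) x := by
  have hcd : Continuous fun y : X × Z =>
      (fderiv ℝ K y).comp (ContinuousLinearMap.inl ℝ X Z) :=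
    (hK.continuous_fderiv (by norm_num)).clm_comp continuous_const
  have hd : ∀ z x, HasFDerivAt (fun x => K (x, z))
      ((fderiv ℝ K (x, z)).comp (ContinuousLinearMap.inl ℝ X Z)) x := fun z x =>
    ((hK.differentiable (by norm_num) (x, z)).hasFDerivAt).comp x (hasFDerivAt_prodMk_left x z)
  obtain ⟨C, hC⟩ := ((isCompact_closedBall x 1).prod hk).exists_bound_of_continuousOn
    hcd.continuousOn
  refine hasFDerivAt_integral_of_dominated_of_fderiv_le (bound := k.indicator fun _ => C)
    (F' := fun x z => (fderiv ℝ K (x, z)).comp (ContinuousLinearMap.inl ℝ X Z))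
    (closedBall_mem_nhds x one_pos) (Eventually.of_forall fun y =>
      (integrable_of_continuous_of_ae_eq_zero hK.continuous hk h0 y).aestronglyMeasurable)
    (integrable_of_continuous_of_ae_eq_zero hK.continuous hk h0 x)
    (Continuous.aestronglyMeasurable (hcd.comp (Continuous.prodMk_right x) :
      Continuous fun z => (fderiv ℝ K (x, z)).comp (ContinuousLinearMap.inl ℝ X Z))) ?_ ?_ ?_
  · filter_upwards [h0] with z hz y hy
    by_cases hzk : z ∈ k
    · rw [indicator_of_mem hzk]
      exact hC (y, z) ⟨hy, hzk⟩
    · rw [indicator_of_notMem hzk, ← (hd z y).fderiv]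
      simp [hz hzk]
  · exact (integrable_indicator_iff hk.measurableSet).2 (integrableOn_const hk.measure_lt_top.ne)
  · exact Eventually.of_forall fun z y _ => hd z y

theorem contDiff_integral_of_ae_eq_zero {K : X × Z → F} (hK : ContDiff ℝ ∞ K) {k : Set Z}
    (hk : IsCompact k) (h0 : ∀ᵐ z ∂μ, z ∉ k → ∀ x, K (x, z) = 0) :
    ContDiff ℝ ∞ fun x => ∫ z, K (x, z) ∂μ := by
  rw [contDiff_infty]
  intro m
  induction m generalizing F with
  | zero =>
    exact contDiff_zero.2 (continuous_iff_continuousAt.2 fun x =>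
      (hasFDerivAt_integral_of_ae_eq_zero (hK.of_le (by simp)) hk h0 x).continuousAt)
  | succ m ih =>
    have h1 : ContDiff ℝ 1 K := hK.of_le (by simp)
    push_cast
    rw [contDiff_succ_iff_fderiv]
    refine ⟨fun x => (hasFDerivAt_integral_of_ae_eq_zero h1 hk h0 x).differentiableAt,
      by simp, ?_⟩
    have h2 : fderiv ℝ (fun x => ∫ z, K (x, z) ∂μ) = fun x =>
        ∫ z, (fderiv ℝ K (x, z)).comp (ContinuousLinearMap.inl ℝ X Z) ∂μ :=
      funext fun x => (hasFDerivAt_integral_of_ae_eq_zero h1 hk h0 x).fderiv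
    rw [h2]
    refine ih (K := fun y => (fderiv ℝ K y).comp (ContinuousLinearMap.inl ℝ X Z))
      ((hK.fderiv_right (by simp)).clm_comp contDiff_const) ?_
    filter_upwards [h0] with z hz hzk x
    have := ((hK.differentiable (by simp) (x, z)).hasFDerivAt).comp x
      (hasFDerivAt_prodMk_left (𝕜 := ℝ) x z)
    change fderiv ℝ K (x, z) ∘L _ = 0
    rw [← this.fderiv]
    have h3 : (K ∘ fun e => (e, z)) = fun _ => (0 : F) := funext fun y => hz hzk y
    rw [h3]
    simp

end ParametricIntegral

section Potential

open Filter Topology Set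

variable {n : ℕ}

local notation "E" => EuclideanSpace ℝ (Fin n)

instance : IsFiniteMeasureOnCompacts (segMeasure n) := by unfold segMeasure; infer_instance

/-- A component of the Bogovskiĭ potential with density `a` and weight `b`. -/
noncomputable def segPotential (i : Fin n) (a b : E → ℝ) (x : E) : ℝ :=
  ∫ z, z.2 i * a (x - z.1 • z.2) * b (x + (1 - z.1) • z.2) ∂(segMeasure n)

theorem ae_segMeasure_mem : ∀ᵐ z ∂(segMeasure n), z.1 ∈ Ioc (0 : ℝ) 1 := by
  have : segMeasure n = (volume : Measure (ℝ × E)).restrict (Ioc 0 1 ×ˢ univ) := by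
    rw [segMeasure, Measure.volume_eq_prod, ← Measure.prod_restrict, Measure.restrict_univ]
  rw [this]
  filter_upwards [ae_restrict_mem (measurableSet_Ioc.prod MeasurableSet.univ)] with z hz
  exact hz.1

theorem mul_eq_zero_of_two_lt_norm {a b : E → ℝ} (ha : ∀ x, 1 < ‖x‖ → a x = 0)
    (hb : ∀ x, 1 < ‖x‖ → b x = 0) {r : ℝ} {u : E} (hu : 2 < ‖u‖) (x : E) :
    a (x - r • u) * b (x + (1 - r) • u) = 0 := by
  by_contra h
  have h1 : ‖x - r • u‖ ≤ 1 := not_lt.1 fun h' => h (by rw [ha _ h', zero_mul])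
  have h2 : ‖x + (1 - r) • u‖ ≤ 1 := not_lt.1 fun h' => h (by rw [hb _ h', mul_zero])
  have h3 : u = (x + (1 - r) • u) - (x - r • u) := by module
  have := norm_sub_le (x + (1 - r) • u) (x - r • u)
  rw [← h3] at this
  linarith

theorem mul_eq_zero_of_one_lt_norm {a b : E → ℝ} (ha : ∀ x, 1 < ‖x‖ → a x = 0)
    (hb : ∀ x, 1 < ‖x‖ → b x = 0) {r : ℝ} (hr : r ∈ Ioc (0 : ℝ) 1) (u : E) {x : E}
    (hx : 1 < ‖x‖) : a (x - r • u) * b (x + (1 - r) • u) = 0 := by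
  by_contra h
  have h1 : ‖x - r • u‖ ≤ 1 := not_lt.1 fun h' => h (by rw [ha _ h', zero_mul])
  have h2 : ‖x + (1 - r) • u‖ ≤ 1 := not_lt.1 fun h' => h (by rw [hb _ h', mul_zero])
  have h3 : x = (1 - r) • (x - r • u) + r • (x + (1 - r) • u) := by module
  have := norm_add_le ((1 - r) • (x - r • u)) (r • (x + (1 - r) • u))
  rw [← h3, norm_smul, norm_smul, Real.norm_of_nonneg hr.1.le,
    Real.norm_of_nonneg (sub_nonneg.2 hr.2)] at this
  nlinarith [hr.1, hr.2]

/-- The compact set carrying the integrands of `segPotential`. -/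
def segBox (n : ℕ) : Set (ℝ × EuclideanSpace ℝ (Fin n)) := Icc 0 1 ×ˢ closedBall 0 2

theorem isCompact_segBox : IsCompact (segBox n) := isCompact_Icc.prod (isCompact_closedBall 0 2)

theorem two_lt_norm_of_notMem_segBox {z : ℝ × E} (hz : z.1 ∈ Ioc (0 : ℝ) 1)
    (h : z ∉ segBox n) : 2 < ‖z.2‖ := by
  by_contra h'
  exact h ⟨Ioc_subset_Icc_self hz, by simpa using h'⟩

theorem ae_segPotential_eq_zero (m : ℝ × E → ℝ) {a b : E → ℝ} (ha : ∀ x, 1 < ‖x‖ → a x = 0)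
    (hb : ∀ x, 1 < ‖x‖ → b x = 0) : ∀ᵐ z ∂(segMeasure n), z ∉ segBox n → ∀ x,
      m z * a (x - z.1 • z.2) * b (x + (1 - z.1) • z.2) = 0 := by
  filter_upwards [ae_segMeasure_mem] with z hz hzk x
  rw [mul_assoc, mul_eq_zero_of_two_lt_norm ha hb (two_lt_norm_of_notMem_segBox hz hzk), mul_zero]

theorem integrable_segPotential {m : ℝ × E → ℝ} (hm : Continuous m) {a b : E → ℝ}
    (hac : Continuous a) (hbc : Continuous b)
    (ha : ∀ x, 1 < ‖x‖ → a x = 0) (hb : ∀ x, 1 < ‖x‖ → b x = 0) (x : E) :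
    Integrable (fun z => m z * a (x - z.1 • z.2) * b (x + (1 - z.1) • z.2)) (segMeasure n) :=
  integrable_of_continuous_of_ae_eq_zero
    (K := fun y : E × (ℝ × E) => m y.2 * a (y.1 - y.2.1 • y.2.2) * b (y.1 + (1 - y.2.1) • y.2.2))
    (by fun_prop) isCompact_segBox (ae_segPotential_eq_zero m ha hb) x

theorem contDiff_segPotential (i : Fin n) {a b : E → ℝ} (hac : ContDiff ℝ ∞ a)
    (hbc : ContDiff ℝ ∞ b) (ha : ∀ x, 1 < ‖x‖ → a x = 0) (hb : ∀ x, 1 < ‖x‖ → b x = 0) :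
    ContDiff ℝ ∞ (segPotential i a b) :=
  contDiff_integral_of_ae_eq_zero
    (K := fun y : E × (ℝ × E) => y.2.2 i * a (y.1 - y.2.1 • y.2.2) * b (y.1 + (1 - y.2.1) • y.2.2))
    (by fun_prop) isCompact_segBox (ae_segPotential_eq_zero (fun z => z.2 i) ha hb)

theorem segPotential_eq_zero (i : Fin n) {a b : E → ℝ} (ha : ∀ x, 1 < ‖x‖ → a x = 0)
    (hb : ∀ x, 1 < ‖x‖ → b x = 0) {x : E} (hx : 1 < ‖x‖) : segPotential i a b x = 0 := by
  rw [segPotential, integral_eq_zero_of_ae]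
  filter_upwards [ae_segMeasure_mem] with z hz
  rw [mul_assoc, mul_eq_zero_of_one_lt_norm ha hb hz z.2 hx, mul_zero]
  rfl

theorem fderiv_eq_zero_of_one_lt_norm {a : E → ℝ} (ha : ∀ x, 1 < ‖x‖ → a x = 0) {x : E}
    (hx : 1 < ‖x‖) : fderiv ℝ a x = 0 := by
  have : a =ᶠ[𝓝 x] fun _ => 0 := by
    filter_upwards [(isOpen_lt continuous_const continuous_norm).mem_nhds hx] with y hy
    exact ha y hy
  rw [this.fderiv_eq]
  simp

theorem fderiv_segPotential (i : Fin n) {a b : E → ℝ} (hac : ContDiff ℝ ∞ a)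
    (hbc : ContDiff ℝ ∞ b) (ha : ∀ x, 1 < ‖x‖ → a x = 0) (hb : ∀ x, 1 < ‖x‖ → b x = 0) (x v : E) :
    fderiv ℝ (segPotential i a b) x v =
      segPotential i (fun y => fderiv ℝ a y v) b x + segPotential i a (fun y => fderiv ℝ b y v)
          x := by
  have hK : ContDiff ℝ ∞ fun y : E × (ℝ × E) =>
    y.2.2 i * a (y.1 - y.2.1 • y.2.2) * b (y.1 + (1 - y.2.1) • y.2.2) := by fun_prop
  have h0 := ae_segPotential_eq_zero (fun z => z.2 i) ha hb
  have h1 := hasFDerivAt_integral_of_ae_eq_zero (μ := segMeasure n) (hK.of_le (by simp))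
    isCompact_segBox h0 x
  have h2 : segPotential i a b = fun x => ∫ z, z.2 i * a (x - z.1 • z.2) *
    b (x + (1 - z.1) • z.2) ∂(segMeasure n) := rfl
  have h3 : ∀ z : ℝ × E, (fderiv ℝ (fun y : E × (ℝ × E) =>
      y.2.2 i * a (y.1 - y.2.1 • y.2.2) * b (y.1 + (1 - y.2.1) • y.2.2)) (x, z)).comp
        (ContinuousLinearMap.inl ℝ E (ℝ × E)) =
      fderiv ℝ (fun x => z.2 i * a (x - z.1 • z.2) * b (x + (1 - z.1) • z.2)) x := fun z =>
    (((hK.differentiable (by simp) (x, z)).hasFDerivAt).comp x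
      (hasFDerivAt_prodMk_left (𝕜 := ℝ) x z)).fderiv.symm
  have hInt : Integrable (fun z : ℝ × E => (fderiv ℝ (fun y : E × (ℝ × E) =>
      y.2.2 i * a (y.1 - y.2.1 • y.2.2) * b (y.1 + (1 - y.2.1) • y.2.2)) (x, z)).comp
        (ContinuousLinearMap.inl ℝ E (ℝ × E))) (segMeasure n) := by
    refine integrable_of_continuous_of_ae_eq_zero (K := fun y => (fderiv ℝ (fun y : E × (ℝ × E) =>
      y.2.2 i * a (y.1 - y.2.1 • y.2.2) * b (y.1 + (1 - y.2.1) • y.2.2)) y).comp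
        (ContinuousLinearMap.inl ℝ E (ℝ × E)))
      ((hK.continuous_fderiv (by simp)).clm_comp continuous_const) isCompact_segBox ?_ x
    filter_upwards [h0] with z hz hzk x
    have := ((hK.differentiable (by simp) (x, z)).hasFDerivAt).comp x
      (hasFDerivAt_prodMk_left (𝕜 := ℝ) x z)
    rw [← this.fderiv]
    have h3 : ((fun y : E × (ℝ × E) => y.2.2 i * a (y.1 - y.2.1 • y.2.2) *
      b (y.1 + (1 - y.2.1) • y.2.2)) ∘ fun e => (e, z)) = fun _ => (0 : ℝ) :=
      funext fun y => hz hzk y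
    rw [h3]
    simp
  have hda := hac.continuous_fderiv (by simp)
  have hdb := hbc.continuous_fderiv (by simp)
  rw [h2, h1.fderiv, ContinuousLinearMap.integral_apply hInt]
  simp only [h3]
  rw [segPotential, segPotential, ← integral_add
    (integrable_segPotential (m := fun z => z.2 i) (a := fun y => fderiv ℝ a y v) (b := b)
      (by fun_prop) (by fun_prop) (by fun_prop)
      (fun x hx => by rw [fderiv_eq_zero_of_one_lt_norm ha hx]; rfl) hb x)
    (integrable_segPotential (m := fun z => z.2 i) (a := a) (b := fun y => fderiv ℝ b y v)
      (by fun_prop) (by fun_prop) (by fun_prop)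
      ha (fun x hx => by rw [fderiv_eq_zero_of_one_lt_norm hb hx]; rfl) x)]
  congr 1
  funext z
  have e1 : HasFDerivAt (fun x => a (x - z.1 • z.2)) (fderiv ℝ a (x - z.1 • z.2)) x := by
    simpa [Function.comp_def] using (hac.differentiable (by simp) (x - z.1 • z.2)).hasFDerivAt.comp
        x
      ((hasFDerivAt_id x).sub_const (z.1 • z.2))
  have e2 : HasFDerivAt (fun x => b (x + (1 - z.1) • z.2)) (fderiv ℝ b (x + (1 - z.1) • z.2))
      x := by
    simpa [Function.comp_def] using
        (hbc.differentiable (by simp) (x + (1 - z.1) • z.2)).hasFDerivAt.comp x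
      ((hasFDerivAt_id x).add_const ((1 - z.1) • z.2))
  have e3 : HasFDerivAt (fun x => z.2 i * a (x - z.1 • z.2) * b (x + (1 - z.1) • z.2)) _ x :=
    (e1.const_mul (z.2 i)).mul e2
  rw [e3.fderiv]
  simp only [add_apply, smul_apply, smul_eq_mul]
  ring

theorem sum_mul_clm_single (L : E →L[ℝ] ℝ) (u : E) :
    ∑ i, u i * L (EuclideanSpace.single i 1) = L u := by
  conv_rhs => rw [← (EuclideanSpace.basisFun (Fin n) ℝ).sum_repr u]
  simp

theorem sum_fderiv_segPotential {a b : E → ℝ} (hac : ContDiff ℝ ∞ a)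
    (hbc : ContDiff ℝ ∞ b) (ha : ∀ x, 1 < ‖x‖ → a x = 0) (hb : ∀ x, 1 < ‖x‖ → b x = 0) (x : E) :
    ∑ i, fderiv ℝ (segPotential i a b) x (EuclideanSpace.single i 1) =
      a x * (∫ u, b u) - (∫ u, a u) * b x := by
  have hda := hac.continuous_fderiv (by simp)
  have hdb := hbc.continuous_fderiv (by simp)
  have hac' := hac.continuous
  have hbc' := hbc.continuous
  have hia : Integrable a := hac'.integrable_of_hasCompactSupport
    (HasCompactSupport.of_support_subset_isCompact (isCompact_closedBall 0 1) fun x hx => by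
      by_contra h; exact hx (ha x (by simpa using h)))
  have hib : Integrable b := hbc'.integrable_of_hasCompactSupport
    (HasCompactSupport.of_support_subset_isCompact (isCompact_closedBall 0 1) fun x hx => by
      by_contra h; exact hx (hb x (by simpa using h)))
  have i1 := fun (i : Fin n) => integrable_segPotential (m := fun z => z.2 i)
    (a := fun y => fderiv ℝ a y (EuclideanSpace.single i 1)) (b := b)
      (by fun_prop) (by fun_prop) (by fun_prop)
      (fun x hx => by rw [fderiv_eq_zero_of_one_lt_norm ha hx]; rfl) hb x
  have i2 := fun (i : Fin n) => integrable_segPotential (m := fun z => z.2 i) (a := a)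
    (b := fun y => fderiv ℝ b y (EuclideanSpace.single i 1))
      (by fun_prop) (by fun_prop) (by fun_prop)
      ha (fun x hx => by rw [fderiv_eq_zero_of_one_lt_norm hb hx]; rfl) x
  have hsum : ∀ z : ℝ × E, (∑ i, (z.2 i * fderiv ℝ a (x - z.1 • z.2) (EuclideanSpace.single i 1) *
      b (x + (1 - z.1) • z.2) + z.2 i * a (x - z.1 • z.2) *
        fderiv ℝ b (x + (1 - z.1) • z.2) (EuclideanSpace.single i 1))) =
      fderiv ℝ a (x - z.1 • z.2) z.2 * b (x + (1 - z.1) • z.2) + a (x - z.1 • z.2) *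
        fderiv ℝ b (x + (1 - z.1) • z.2) z.2 := fun z => by
    rw [← sum_mul_clm_single (fderiv ℝ a (x - z.1 • z.2)) z.2,
      ← sum_mul_clm_single (fderiv ℝ b (x + (1 - z.1) • z.2)) z.2, Finset.sum_mul, Finset.mul_sum,
      ← Finset.sum_add_distrib]
    exact Finset.sum_congr rfl fun i _ => by ring
  have hInt := integrable_finsetSum Finset.univ fun i _ => (i1 i).add (i2 i)
  simp only [Pi.add_apply, hsum] at hInt
  have e1 : ∑ i, fderiv ℝ (segPotential i a b) x (EuclideanSpace.single i 1) =
      ∫ z, (fderiv ℝ a (x - z.1 • z.2) z.2 * b (x + (1 - z.1) • z.2) + a (x - z.1 • z.2) *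
        fderiv ℝ b (x + (1 - z.1) • z.2) z.2) ∂(segMeasure n) := by
    simp only [fderiv_segPotential _ hac hbc ha hb, segPotential]
    refine ((integral_congr_ae (Eventually.of_forall hsum)).symm.trans
      ((integral_finsetSum _ fun i _ => (i1 i).add (i2 i)).trans
        (Finset.sum_congr rfl fun i _ => integral_add (i1 i) (i2 i)))).symm
  have e2 : ∀ u : E, ∫ r in Ioc (0 : ℝ) 1, (fderiv ℝ a (x - r • u) u * b (x + (1 - r) • u) +
      a (x - r • u) * fderiv ℝ b (x + (1 - r) • u) u) = a x * b (x + u) - a (x - u) * b x := by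
    intro u
    rw [← intervalIntegral.integral_of_le zero_le_one]
    have hd : ∀ r : ℝ, HasDerivAt (fun r : ℝ => -(a (x - r • u) * b (x + (1 - r) • u)))
        (fderiv ℝ a (x - r • u) u * b (x + (1 - r) • u) +
          a (x - r • u) * fderiv ℝ b (x + (1 - r) • u) u) r := fun r => by
      have d1 : HasDerivAt (fun r : ℝ => x - r • u) (-u) r := by
        simpa using ((hasDerivAt_id r).smul_const u).const_sub x
      have d2 : HasDerivAt (fun r : ℝ => x + (1 - r) • u) (-u) r := by
        simpa using (((hasDerivAt_id r).const_sub 1).smul_const u).const_add x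
      have d3 := (hac.differentiable (by simp) (x - r • u)).hasFDerivAt.comp_hasDerivAt r d1
      have d4 := (hbc.differentiable (by simp) (x + (1 - r) • u)).hasFDerivAt.comp_hasDerivAt r d2
      refine HasDerivAt.congr_deriv (d3.mul d4).neg ?_
      simp only [map_neg, Function.comp_apply]
      ring
    rw [intervalIntegral.integral_eq_sub_of_hasDerivAt (fun r _ => hd r)
      (Continuous.intervalIntegrable (by fun_prop) _ _)]
    simp
    ring
  rw [e1, segMeasure, integral_prod_symm _ hInt]
  simp only [e2]
  rw [integral_sub ((hib.comp_add_left x).const_mul _) ((hia.comp_sub_left x).mul_const _),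
    integral_const_mul, integral_mul_const, integral_add_left_eq_self, integral_sub_left_eq_self]

end Potential

section PotentialBound

open Filter Topology Set

variable {n : ℕ}

local notation "E" => EuclideanSpace ℝ (Fin n)

theorem hasCompactSupport_of_one_lt_norm {b : E → ℝ} (hb : ∀ x, 1 < ‖x‖ → b x = 0) :
    HasCompactSupport b :=
  HasCompactSupport.of_support_subset_isCompact (isCompact_closedBall 0 1) fun x hx => by
    by_contra h
    exact hx (hb x (by simpa using h))

/-- The derivative in `u` of the difference `u i * (b (x + (1 - r) • u) - b (x + u))`. -/
noncomputable def segDiffDeriv (b : E → ℝ) (i j : Fin n) (x : E) (r : ℝ) (u : E) : ℝ :=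
  (EuclideanSpace.single j (1 : ℝ) : E) i * (b (x + (1 - r) • u) - b (x + u)) +
    u i * ((1 - r) * fderiv ℝ b (x + (1 - r) • u) (EuclideanSpace.single j 1) -
      fderiv ℝ b (x + u) (EuclideanSpace.single j 1))

theorem fderiv_segDiff {b : E → ℝ} (hb : ContDiff ℝ ∞ b) (i j : Fin n) (x : E) (r : ℝ) (u : E) :
    fderiv ℝ (fun u : E => u i * (b (x + (1 - r) • u) - b (x + u))) u (EuclideanSpace.single j 1) =
      segDiffDeriv b i j x r u := by
  have hd := hb.differentiable (by simp)
  have e1 : HasFDerivAt (fun u : E => b (x + (1 - r) • u))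
      ((1 - r) • fderiv ℝ b (x + (1 - r) • u)) u := by
    have h1 : HasFDerivAt (fun u : E => x + (1 - r) • u) ((1 - r) • ContinuousLinearMap.id ℝ E) u :=
      ((hasFDerivAt_id u).const_smul (1 - r)).const_add x
    refine ((hd (x + (1 - r) • u)).hasFDerivAt.comp u h1).congr_fderiv ?_
    ext v
    simp
  have e2 : HasFDerivAt (fun u : E => b (x + u)) (fderiv ℝ b (x + u)) u := by
    refine ((hd (x + u)).hasFDerivAt.comp u ((hasFDerivAt_id u).const_add x)).congr_fderiv ?_
    ext v
    simp
  have e3 : HasFDerivAt (fun u : E => u i) (EuclideanSpace.proj i : E →L[ℝ] ℝ) u :=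
    (EuclideanSpace.proj i : E →L[ℝ] ℝ).hasFDerivAt
  have e4 : HasFDerivAt (fun u : E => u i * (b (x + (1 - r) • u) - b (x + u))) _ u :=
    e3.mul (e1.sub e2)
  rw [e4.fderiv, segDiffDeriv]
  simp only [add_apply, smul_apply, smul_eq_mul, sub_apply]
  rw [show (EuclideanSpace.proj i : E →L[ℝ] ℝ) (EuclideanSpace.single j 1) =
    (EuclideanSpace.single j (1 : ℝ) : E) i from rfl]
  ring

theorem exists_abs_segDiffDeriv_le {b : E → ℝ} (hb : ContDiff ℝ ∞ b)
    (hb0 : ∀ x, 1 < ‖x‖ → b x = 0) (i j : Fin n) :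
    ∃ M : ℝ≥0, (∀ x, |fderiv ℝ b x (EuclideanSpace.single j 1)| ≤ M) ∧
      ∀ x : E, ∀ r ∈ Ioc (0 : ℝ) 1, ∀ u : E, ‖u‖ ≤ 2 → |segDiffDeriv b i j x r u| ≤ M * r := by
  have hbc := hasCompactSupport_of_one_lt_norm hb0
  have hd : ContDiff ℝ ∞ fun y => fderiv ℝ b y (EuclideanSpace.single j 1) :=
    (hb.fderiv_right (by simp)).clm_apply contDiff_const
  have hdc : HasCompactSupport fun y => fderiv ℝ b y (EuclideanSpace.single j 1) :=
    hasCompactSupport_of_one_lt_norm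
      fun x hx => by rw [fderiv_eq_zero_of_one_lt_norm hb0 hx]; rfl
  obtain ⟨C₁, h1⟩ := hb.lipschitzWith_of_hasCompactSupport hbc (by simp)
  obtain ⟨C₂, h2⟩ := hd.lipschitzWith_of_hasCompactSupport hdc (by simp)
  obtain ⟨M₁, h3⟩ := hdc.exists_bound_of_continuous hd.continuous
  have hM1 : 0 ≤ M₁ := (norm_nonneg _).trans (h3 0)
  refine ⟨2 * C₁ + 2 * M₁.toNNReal + 4 * C₂ + M₁.toNNReal, fun x => ?_, fun x r hr u hu => ?_⟩
  · refine (h3 x).trans ?_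
    push_cast
    rw [Real.coe_toNNReal _ hM1]
    have := C₁.2
    have := C₂.2
    linarith
  · have hdist : dist (x + (1 - r) • u) (x + u) ≤ 2 * r := by
      rw [dist_eq_norm, show x + (1 - r) • u - (x + u) = (-r) • u by module, norm_smul, norm_neg,
        Real.norm_of_nonneg hr.1.le, mul_comm]
      exact mul_le_mul_of_nonneg_right hu hr.1.le
    have k1 : |b (x + (1 - r) • u) - b (x + u)| ≤ C₁ * (2 * r) :=
      (h1.dist_le_mul _ _).trans (mul_le_mul_of_nonneg_left hdist C₁.2)
    have k2 : |fderiv ℝ b (x + (1 - r) • u) (EuclideanSpace.single j 1) -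
        fderiv ℝ b (x + u) (EuclideanSpace.single j 1)| ≤ C₂ * (2 * r) :=
      (h2.dist_le_mul _ _).trans (mul_le_mul_of_nonneg_left hdist C₂.2)
    have k3 : |fderiv ℝ b (x + (1 - r) • u) (EuclideanSpace.single j 1)| ≤ M₁ := h3 _
    have k4 : |(EuclideanSpace.single j (1 : ℝ) : E) i| ≤ 1 := by
      rw [PiLp.single_apply]
      split_ifs <;> simp
    have k5 : |u i| ≤ 2 := (PiLp.norm_apply_le u i).trans hu
    rw [segDiffDeriv]
    have e : ∀ s t : ℝ, (1 - r) * s - t = (s - t) + -(r * s) := fun s t => by ring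
    rw [e]
    refine (abs_add_le _ _).trans ?_
    rw [abs_mul, abs_mul]
    have k6 := mul_le_mul k4 k1 (abs_nonneg _) zero_le_one
    have k7 : |(fderiv ℝ b (x + (1 - r) • u) (EuclideanSpace.single j 1) -
        fderiv ℝ b (x + u) (EuclideanSpace.single j 1)) +
        -(r * fderiv ℝ b (x + (1 - r) • u) (EuclideanSpace.single j 1))| ≤
        C₂ * (2 * r) + r * M₁ := by
      refine (abs_add_le _ _).trans (add_le_add k2 ?_)
      rw [abs_neg, abs_mul, abs_of_pos hr.1]
      exact mul_le_mul_of_nonneg_left k3 hr.1.le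
    have k8 := mul_le_mul k5 k7 (abs_nonneg _) zero_le_two
    push_cast
    rw [Real.coe_toNNReal _ hM1]
    have := mul_nonneg hM1 hr.1.le
    linarith

theorem segDiffDeriv_mul_eq_zero {a b : E → ℝ} (ha : ∀ x, 1 < ‖x‖ → a x = 0)
    (hb : ∀ x, 1 < ‖x‖ → b x = 0) (i j : Fin n) {x : E} (hx : ‖x‖ ≤ 1) {r : ℝ} {u : E}
    (hu : 2 < ‖u‖) : segDiffDeriv b i j x r u * a (x - r • u) = 0 := by
  have h2 : 1 < ‖x + u‖ := by
    have := norm_sub_le (x + u) x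
    rw [add_sub_cancel_left] at this
    linarith
  by_cases h : 1 < ‖x - r • u‖
  · rw [ha _ h, mul_zero]
  have h1 : 1 < ‖x + (1 - r) • u‖ := by
    have := norm_sub_le (x + (1 - r) • u) (x - r • u)
    rw [show x + (1 - r) • u - (x - r • u) = u by module] at this
    linarith
  rw [segDiffDeriv, hb _ h1, hb _ h2, fderiv_eq_zero_of_one_lt_norm hb h1,
    fderiv_eq_zero_of_one_lt_norm hb h2]
  simp

theorem integral_segDiff_eq {a b : E → ℝ} (hac : ContDiff ℝ ∞ a) (hbc : ContDiff ℝ ∞ b)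
    (ha : ∀ x, 1 < ‖x‖ → a x = 0) (i j : Fin n) (x : E) {r : ℝ} (hr : r ∈ Ioc (0 : ℝ) 1) :
    ∫ u : E, u i * fderiv ℝ a (x - r • u) (EuclideanSpace.single j 1) *
        (b (x + (1 - r) • u) - b (x + u)) =
      ∫ u : E, r⁻¹ * (segDiffDeriv b i j x r u * a (x - r • u)) := by
  have hda := hac.continuous_fderiv (by simp)
  have hdb := hbc.continuous_fderiv (by simp)
  have hac' := hac.continuous
  have hbc' := hbc.continuous
  have hs : ∀ c : E → ℝ, (∀ x, 1 < ‖x‖ → c x = 0) →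
      HasCompactSupport fun u : E => c (x - r • u) := fun c hc => by
    refine HasCompactSupport.of_support_subset_isCompact
      (isCompact_closedBall 0 (r⁻¹ * (1 + ‖x‖))) fun u hu => ?_
    by_contra h
    refine hu (hc _ ?_)
    rw [mem_closedBall, dist_zero_right, not_le, inv_mul_lt_iff₀ hr.1] at h
    have := norm_sub_le (x - r • u) x
    rw [sub_sub_cancel_left, norm_neg, norm_smul, Real.norm_of_nonneg hr.1.le] at this
    linarith
  have hf : ContDiff ℝ ∞ fun u : E => u i * (b (x + (1 - r) • u) - b (x + u)) := by fun_prop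
  have hh : ContDiff ℝ ∞ fun u : E => a (x - r • u) := by fun_prop
  have hfd := hf.continuous_fderiv (by simp)
  have hhd : ∀ u : E, fderiv ℝ (fun u : E => a (x - r • u)) u (EuclideanSpace.single j 1) =
      -r * fderiv ℝ a (x - r • u) (EuclideanSpace.single j 1) := fun u => by
    have h1 : HasFDerivAt (fun u : E => x - r • u) (-(r • ContinuousLinearMap.id ℝ E)) u :=
      ((hasFDerivAt_id u).const_smul r).const_sub x
    have h2 : HasFDerivAt (fun u : E => a (x - r • u)) _ u :=
      ((hac.differentiable (by simp) (x - r • u)).hasFDerivAt.comp u h1)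
    rw [h2.fderiv]
    simp
  have hsd := hs (fun y => fderiv ℝ a y (EuclideanSpace.single j 1))
    fun x hx => by rw [fderiv_eq_zero_of_one_lt_norm ha hx]; rfl
  have key := integral_mul_fderiv_eq_neg_fderiv_mul_of_integrable (μ := (volume : Measure E))
    (f := fun u : E => u i * (b (x + (1 - r) • u) - b (x + u))) (g := fun u : E => a (x - r • u))
    (v := EuclideanSpace.single j 1)
    (Continuous.integrable_of_hasCompactSupport (by fun_prop) ((hs a ha).mul_left))
    (by
      simp only [hhd]
      exact Continuous.integrable_of_hasCompactSupport (by fun_prop)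
        ((hsd.mul_left (f := fun _ => -r)).mul_left))
    (Continuous.integrable_of_hasCompactSupport (by fun_prop) ((hs a ha).mul_left))
    (fun u _ => hf.differentiable (by simp) u) (fun u _ => hh.differentiable (by simp) u)
  simp only [hhd, fderiv_segDiff hbc] at key
  rw [integral_const_mul, eq_inv_mul_iff_mul_eq₀ hr.1.ne', ← integral_const_mul, ← neg_inj, ← key,
    ← integral_neg]
  congr 1
  funext u
  ring

/-- The weight dominating the regular part of the gradient of `segPotential`. -/
noncomputable def segWeight (n : ℕ) (C : ℝ≥0∞) : ℝ × EuclideanSpace ℝ (Fin n) → ℝ≥0∞ :=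
  fun z => (closedBall (0 : EuclideanSpace ℝ (Fin n)) 2).indicator (fun _ => C) z.2

theorem measurable_segWeight (C : ℝ≥0∞) : Measurable (segWeight n C) :=
  (measurable_const.indicator measurableSet_closedBall).comp measurable_snd

theorem lintegral_segWeight_lt_top {C : ℝ≥0∞} (hC : C ≠ ⊤) :
    ∫⁻ z, segWeight n C z ∂(segMeasure n) < ⊤ := by
  rw [segMeasure, lintegral_prod _ (measurable_segWeight C).aemeasurable]
  simp only [segWeight, lintegral_indicator measurableSet_closedBall, lintegral_const,
    Measure.restrict_apply MeasurableSet.univ, univ_inter]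
  exact ENNReal.mul_lt_top (ENNReal.mul_lt_top hC.lt_top measure_closedBall_lt_top) (by simp)

theorem measurable_segWeight_mul (C : ℝ≥0∞) {a : E → ℝ} (ha : Continuous a) (x : E) :
    Measurable fun z : ℝ × E => segWeight n C z * ‖a (x - z.1 • z.2)‖ₑ := by
  have h : Measurable fun z : ℝ × E => ‖a (x - z.1 • z.2)‖ₑ :=
    (Continuous.measurable (by fun_prop)).enorm
  exact (measurable_segWeight C).mul h

theorem enorm_segPotential_le {a b : E → ℝ} {M : ℝ≥0}
    (ha : ∀ x, 1 < ‖x‖ → a x = 0) (hb : ∀ x, 1 < ‖x‖ → b x = 0)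
    (hM : ∀ x, |b x| ≤ M) (i : Fin n) (x : E) :
    ‖segPotential i a b x‖ₑ ≤
      ∫⁻ z, segWeight n (2 * M) z * ‖a (x - z.1 • z.2)‖ₑ ∂(segMeasure n) := by
  refine (enorm_integral_le_lintegral_enorm _).trans (lintegral_mono fun z => ?_)
  rw [segWeight]
  by_cases hu : z.2 ∈ closedBall (0 : E) 2
  · rw [indicator_of_mem hu, enorm_mul, enorm_mul, mul_right_comm]
    refine mul_le_mul_left (mul_le_mul' ?_ ?_) _
    · rw [← ofReal_norm]
      refine ENNReal.ofReal_le_of_le_toReal ((PiLp.norm_apply_le z.2 i).trans (by simpa using hu))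
    · rw [← ofReal_norm, ← ENNReal.ofReal_coe_nnreal]
      exact ENNReal.ofReal_le_ofReal (hM _)
  · rw [mul_assoc, mul_eq_zero_of_two_lt_norm ha hb (by simpa using hu)]
    simp

theorem enorm_integral_segDiff_le {a b : E → ℝ} (hac : ContDiff ℝ ∞ a) (hbc : ContDiff ℝ ∞ b)
    (ha : ∀ x, 1 < ‖x‖ → a x = 0) (hb : ∀ x, 1 < ‖x‖ → b x = 0) {i j : Fin n} {M : ℝ≥0}
    {x : E} (hx : ‖x‖ ≤ 1)
    (hM : ∀ r ∈ Ioc (0 : ℝ) 1, ∀ u : E, ‖u‖ ≤ 2 → |segDiffDeriv b i j x r u| ≤ M * r)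
    (hi : Integrable (fun z : ℝ × E => z.2 i * fderiv ℝ a (x - z.1 • z.2)
        (EuclideanSpace.single j 1) *
        (b (x + (1 - z.1) • z.2) - b (x + z.2))) (segMeasure n)) :
    ‖∫ z, z.2 i * fderiv ℝ a (x - z.1 • z.2) (EuclideanSpace.single j 1) *
        (b (x + (1 - z.1) • z.2) - b (x + z.2)) ∂(segMeasure n)‖ₑ ≤
      ∫⁻ z, segWeight n M z * ‖a (x - z.1 • z.2)‖ₑ ∂(segMeasure n) := by
  have hac' := hac.continuous
  rw [segMeasure, integral_prod _ hi, lintegral_prod _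
    (measurable_segWeight_mul _ hac' x).aemeasurable]
  refine (enorm_integral_le_lintegral_enorm _).trans
    (setLIntegral_mono' (μ := volume) measurableSet_Ioc fun r hr => ?_)
  rw [integral_segDiff_eq hac hbc ha i j x hr]
  refine (enorm_integral_le_lintegral_enorm _).trans (lintegral_mono fun u => ?_)
  rw [segWeight]
  by_cases hu : u ∈ closedBall (0 : E) 2
  · rw [indicator_of_mem hu, ← mul_assoc, enorm_mul]
    refine mul_le_mul_left ?_ _
    rw [← ofReal_norm, ← ENNReal.ofReal_coe_nnreal]
    refine ENNReal.ofReal_le_ofReal ?_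
    rw [norm_mul, norm_inv, Real.norm_of_nonneg hr.1.le, inv_mul_le_iff₀ hr.1, mul_comm]
    exact hM r hr u (by simpa using hu)
  · rw [segDiffDeriv_mul_eq_zero ha hb i j hx (by simpa using hu)]
    simp

theorem exists_enorm_fderiv_segPotential_le {ω₀ : ℝ → ℝ} {b : E → ℝ}
    (hω : ∀ x, b x = ∏ k, ω₀ (x k)) (hbc : ContDiff ℝ ∞ b) (hb : ∀ x, 1 < ‖x‖ → b x = 0)
    (i j : Fin n) : ∃ C : ℝ≥0, ∀ a : E → ℝ, ContDiff ℝ ∞ a → (∀ x, 1 < ‖x‖ → a x = 0) →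
      ∀ x : E, ‖x‖ ≤ 1 → ‖fderiv ℝ (segPotential i a b) x (EuclideanSpace.single j 1)‖ₑ ≤
        ‖singularPart ω₀ a i j x‖ₑ +
          ∫⁻ z, segWeight n C z * ‖a (x - z.1 • z.2)‖ₑ ∂(segMeasure n) := by
  obtain ⟨M, hM1, hM2⟩ := exists_abs_segDiffDeriv_le hbc hb i j
  refine ⟨M + 2 * M, fun a hac ha x hx => ?_⟩
  have hac' := hac.continuous
  have hbc' := hbc.continuous
  have hda := hac.continuous_fderiv (by simp)
  have ha' : ∀ y : E, 1 < ‖y‖ → fderiv ℝ a y (EuclideanSpace.single j 1) = 0 :=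
    fun y hy => by rw [fderiv_eq_zero_of_one_lt_norm ha hy]; rfl
  have hb' : ∀ y : E, 1 < ‖y‖ → fderiv ℝ b y (EuclideanSpace.single j 1) = 0 :=
    fun y hy => by rw [fderiv_eq_zero_of_one_lt_norm hb hy]; rfl
  have i1 := integrable_segPotential (n := n) (m := fun z => z.2 i)
    (a := fun y => fderiv ℝ a y (EuclideanSpace.single j 1)) (b := b)
    (by fun_prop) (by fun_prop) (by fun_prop) ha' hb x
  have i2 : Integrable (fun z : ℝ × E => z.2 i *
      fderiv ℝ a (x - z.1 • z.2) (EuclideanSpace.single j 1) * b (x + z.2)) (segMeasure n) := by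
    have := integrable_of_continuous_of_ae_eq_zero (μ := segMeasure n) (X := Unit)
      (K := fun y : Unit × (ℝ × E) => y.2.2 i *
        fderiv ℝ a (x - y.2.1 • y.2.2) (EuclideanSpace.single j 1) * b (x + y.2.2))
      (by fun_prop) isCompact_segBox ?_ ()
    · exact this
    filter_upwards [ae_segMeasure_mem] with z hz hzk _
    have h1 := two_lt_norm_of_notMem_segBox hz hzk
    have h2 := norm_sub_le (x + z.2) x
    rw [add_sub_cancel_left] at h2
    change _ * b (x + z.2) = 0
    rw [hb _ (by linarith), mul_zero]
  have i3 : Integrable (fun z : ℝ × E => z.2 i *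
      fderiv ℝ a (x - z.1 • z.2) (EuclideanSpace.single j 1) *
        (b (x + (1 - z.1) • z.2) - b (x + z.2))) (segMeasure n) := by
    simp only [mul_sub]
    exact i1.sub i2
  have e1 : segPotential i (fun y => fderiv ℝ a y (EuclideanSpace.single j 1)) b x =
      singularPart ω₀ a i j x +
        ∫ z, z.2 i * fderiv ℝ a (x - z.1 • z.2) (EuclideanSpace.single j 1) *
          (b (x + (1 - z.1) • z.2) - b (x + z.2)) ∂(segMeasure n) := by
    have e2 : singularPart ω₀ a i j x = ∫ z, z.2 i *
      fderiv ℝ a (x - z.1 • z.2) (EuclideanSpace.single j 1) * b (x + z.2) ∂(segMeasure n) := by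
      simp only [singularPart, hω, PiLp.add_apply]
    rw [e2, ← integral_add i2 i3, segPotential]
    congr 1
    funext z
    ring
  rw [fderiv_segPotential i hac hbc ha hb, e1, add_assoc]
  refine (enorm_add_le _ _).trans (add_le_add le_rfl ?_)
  refine (enorm_add_le _ _).trans ((add_le_add
    (enorm_integral_segDiff_le hac hbc ha hb hx (hM2 x) i3)
    (enorm_segPotential_le ha hb' hM1 i x)).trans_eq ?_)
  rw [← lintegral_add_left (measurable_segWeight_mul _ hac' x)]
  refine lintegral_congr fun z => ?_
  rw [← add_mul]
  congr 1
  by_cases hu : z.2 ∈ closedBall (0 : E) 2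
  · simp only [segWeight, indicator_of_mem hu]
    push_cast
    rfl
  · simp only [segWeight, indicator_of_notMem hu, add_zero]

end PotentialBound

section UnitBall

open Filter Topology Set

variable {n : ℕ}

local notation "E" => EuclideanSpace ℝ (Fin n)

theorem exists_lintegral_fderiv_segPotential_le {p : ℝ} (hp : 1 < p) {ω₀ : ℝ → ℝ} {b : E → ℝ}
    (hω₀ : ContDiff ℝ ∞ ω₀) (hωc : HasCompactSupport ω₀)
    (hω : ∀ x, b x = ∏ k, ω₀ (x k)) (hbc : ContDiff ℝ ∞ b) (hb : ∀ x, 1 < ‖x‖ → b x = 0)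
    (i j : Fin n) : ∃ C : ℝ≥0, ∀ a : E → ℝ, ContDiff ℝ ∞ a → (∀ x, 1 < ‖x‖ → a x = 0) →
      ∫⁻ x, ‖fderiv ℝ (segPotential i a b) x (EuclideanSpace.single j 1)‖ₑ ^ p ≤
        C * ∫⁻ x, ‖a x‖ₑ ^ p := by
  obtain ⟨C₁, h1⟩ := exists_lintegral_singularPart_le hp hω₀ hωc i j
  obtain ⟨C₂, h2⟩ := exists_enorm_fderiv_segPotential_le hω hbc hb i j
  have hW : ∫⁻ z, segWeight n C₂ z ∂(segMeasure n) ≠ ⊤ :=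
    (lintegral_segWeight_lt_top ENNReal.coe_ne_top).ne
  refine ⟨2 ^ (p - 1) * (C₁ + (∫⁻ z, segWeight n C₂ z ∂(segMeasure n)).toNNReal ^ p),
    fun a hac ha => ?_⟩
  have hac' := hac.continuous
  have hH : Measurable fun y : E × (ℝ × E) => ‖a (y.1 - y.2.1 • y.2.2)‖ₑ :=
    (Continuous.measurable (by fun_prop)).enorm
  have hK : ∀ l : ℝ × E, ∫⁻ x, ‖a (x - l.1 • l.2)‖ₑ ^ p ≤ ∫⁻ x, ‖a x‖ₑ ^ p := fun l =>
    (lintegral_sub_right_eq_self (fun x => ‖a x‖ₑ ^ p) _).le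
  have h3 := lintegral_rpow_lintegral_mul_le (μ := (volume : Measure E)) (ν := segMeasure n)
    (measurable_segWeight (n := n) C₂) (H := fun x z => ‖a (x - z.1 • z.2)‖ₑ) hH hp hK
  have h4 := h1 a hac (hasCompactSupport_of_one_lt_norm ha)
  have hm : Measurable fun x => ∫⁻ z, segWeight n C₂ z * ‖a (x - z.1 • z.2)‖ₑ ∂(segMeasure n) :=
    Measurable.lintegral_prod_right' (f := fun y : E × (ℝ × E) =>
      segWeight n C₂ y.2 * ‖a (y.1 - y.2.1 • y.2.2)‖ₑ)
      (((measurable_segWeight _).comp measurable_snd).mul hH)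
  have hsub : ∫⁻ x, ‖fderiv ℝ (segPotential i a b) x (EuclideanSpace.single j 1)‖ₑ ^ p =
      ∫⁻ x in closedBall 0 1,
        ‖fderiv ℝ (segPotential i a b) x (EuclideanSpace.single j 1)‖ₑ ^ p := by
    refine (setLIntegral_eq_of_support_subset fun x hx => ?_).symm
    by_contra h
    refine hx ?_
    have h' : fderiv ℝ (segPotential i a b) x = 0 :=
      fderiv_eq_zero_of_one_lt_norm (fun y hy => segPotential_eq_zero i ha hb hy)
        (by simpa using h)
    simp only [h']
    simp [zero_lt_one.trans hp]
  have h5 : ∫⁻ x in closedBall 0 1,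
      ‖fderiv ℝ (segPotential i a b) x (EuclideanSpace.single j 1)‖ₑ ^ p ≤
      ∫⁻ x in closedBall 0 1, 2 ^ (p - 1) * (‖singularPart ω₀ a i j x‖ₑ ^ p +
        (∫⁻ z, segWeight n C₂ z * ‖a (x - z.1 • z.2)‖ₑ ∂(segMeasure n)) ^ p) := by
    refine setLIntegral_mono' (μ := volume) measurableSet_closedBall fun x hx => ?_
    refine (ENNReal.rpow_le_rpow (h2 a hac ha x (by simpa using hx)) (by linarith)).trans ?_
    exact ENNReal.rpow_add_le_mul_rpow_add_rpow _ _ hp.le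
  rw [hsub]
  refine h5.trans ?_
  rw [lintegral_const_mul' _ _ (by finiteness), lintegral_add_right _ (hm.pow_const p)]
  have h6 : ∫⁻ x in closedBall 0 1,
      (∫⁻ z, segWeight n C₂ z * ‖a (x - z.1 • z.2)‖ₑ ∂(segMeasure n)) ^ p ≤
      (∫⁻ z, segWeight n C₂ z ∂(segMeasure n)) ^ p * ∫⁻ x, ‖a x‖ₑ ^ p :=
    (setLIntegral_le_lintegral _ _).trans h3
  refine (mul_le_mul_right (add_le_add h4 h6) _).trans_eq ?_
  rw [← add_mul, ← mul_assoc]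
  congr 1
  push_cast
  rw [ENNReal.coe_rpow_of_nonneg _ (by linarith : (0 : ℝ) ≤ p - 1),
    ENNReal.coe_rpow_of_nonneg _ (by linarith : (0 : ℝ) ≤ p), ENNReal.coe_toNNReal hW]
  rfl

/-- A smooth probability density on `ℝⁿ` of product form supported in the unit ball. -/
theorem exists_prod_density (n : ℕ) : ∃ (ω₀ : ℝ → ℝ) (b : EuclideanSpace ℝ (Fin n) → ℝ),
    ContDiff ℝ ∞ ω₀ ∧ HasCompactSupport ω₀ ∧ (∀ x, b x = ∏ k, ω₀ (x k)) ∧ ContDiff ℝ ∞ b ∧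
      (∀ x, 1 < ‖x‖ → b x = 0) ∧ ∫ x, b x = 1 := by
  have hn : (0 : ℝ) < 1 / (n + 1) := by positivity
  let φ : ContDiffBump (0 : ℝ) := ⟨1 / (n + 1) / 2, 1 / (n + 1), by positivity, by linarith⟩
  have hφ : ContDiff ℝ ∞ (φ.normed volume) := φ.contDiff_normed
  refine ⟨φ.normed volume, fun x => ∏ k, φ.normed volume (x k), hφ,
    φ.hasCompactSupport_normed, fun _ => rfl, ?_, fun x hx => ?_, ?_⟩
  · exact contDiff_prod fun k _ => hφ.comp (by fun_prop)
  · by_contra h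
    have h1 : ∀ k, |x k| < 1 / (n + 1) := fun k => by
      have h2 : x k ∈ Function.support (φ.normed volume) := fun h3 =>
        h (Finset.prod_eq_zero (Finset.mem_univ k) h3)
      rw [φ.support_normed_eq] at h2
      rwa [mem_ball_zero_iff] at h2
    have h2 : ‖x‖ ^ 2 ≤ 1 := by
      rw [EuclideanSpace.norm_sq_eq]
      have h3 : ∀ k ∈ Finset.univ, ‖x k‖ ^ 2 ≤ (1 / ((n : ℝ) + 1)) ^ 2 := fun k _ =>
        pow_le_pow_left₀ (norm_nonneg _) (h1 k).le 2
      refine (Finset.sum_le_sum h3).trans ?_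
      rw [Finset.sum_const, Finset.card_univ, Fintype.card_fin, nsmul_eq_mul, div_pow, one_pow,
        mul_one_div, div_le_one (by positivity)]
      nlinarith [(Nat.cast_nonneg n : (0 : ℝ) ≤ n)]
    nlinarith
  · refine ((PiLp.volume_preserving_ofLp (Fin n)).integral_comp
      (MeasurableEquiv.toLp 2 (Fin n → ℝ)).symm.measurableEmbedding
      (fun u : Fin n → ℝ => ∏ k, φ.normed volume (u k))).trans ?_
    rw [integral_fintype_prod_volume_eq_prod (fun _ t => φ.normed volume t)]
    simp [φ.integral_normed]

theorem exists_bogovskii_unit (n : ℕ) {p : ℝ} (hp : 1 < p) : ∃ C : ℝ≥0,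
    ∀ a : EuclideanSpace ℝ (Fin n) → ℝ, ContDiff ℝ ∞ a → (∀ x, 1 < ‖x‖ → a x = 0) →
      ∫ x, a x = 0 → ∃ w : Fin n → EuclideanSpace ℝ (Fin n) → ℝ,
        (∀ i, ContDiff ℝ ∞ (w i)) ∧ (∀ i x, 1 < ‖x‖ → w i x = 0) ∧
        (∀ x, ∑ i, fderiv ℝ (w i) x (EuclideanSpace.single i 1) = a x) ∧
        ∀ i j, ∫⁻ x, ‖fderiv ℝ (w i) x (EuclideanSpace.single j 1)‖ₑ ^ p ≤
          C * ∫⁻ x, ‖a x‖ₑ ^ p := by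
  obtain ⟨ω₀, b, hω₀, hωc, hω, hbc, hb, hInt⟩ := exists_prod_density n
  choose C hC using fun i j => exists_lintegral_fderiv_segPotential_le hp hω₀ hωc hω hbc hb i j
  refine ⟨∑ i, ∑ j, C i j, fun a hac ha ha0 => ⟨fun i => segPotential i a b,
    fun i => contDiff_segPotential i hac hbc ha hb, fun i x hx => segPotential_eq_zero i ha hb hx,
    fun x => ?_, fun i j => (hC i j a hac ha).trans ?_⟩⟩
  · rw [sum_fderiv_segPotential hac hbc ha hb, hInt, ha0]
    ring
  · gcongr
    exact (Finset.single_le_sum (f := fun j => C i j) (fun _ _ => zero_le)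
      (Finset.mem_univ j)).trans (Finset.single_le_sum (f := fun i => ∑ j, C i j)
        (fun _ _ => zero_le) (Finset.mem_univ i))

end UnitBall

section Scaling

open Filter Topology Set

variable {n : ℕ}

local notation "E" => EuclideanSpace ℝ (Fin n)

theorem frob_rpow_le {p : ℝ} (hp : 1 ≤ p) (M : Matrix (Fin n) (Fin n) ℝ) :
    frob M ^ p ≤ ((n * n : ℕ) : ℝ) ^ (p - 1) * ∑ y : Fin n × Fin n, |M y.1 y.2| ^ p := by
  have h1 : frob M ≤ ∑ y : Fin n × Fin n, |M y.1 y.2| := by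
    rw [frob]
    refine Real.sqrt_le_iff.2 ⟨Finset.sum_nonneg fun _ _ => abs_nonneg _, ?_⟩
    rw [← Fintype.sum_prod_type']
    simpa using Finset.sum_sq_le_sq_sum_of_nonneg (s := Finset.univ)
      (f := fun y : Fin n × Fin n => |M y.1 y.2|) fun _ _ => abs_nonneg _
  refine (Real.rpow_le_rpow (Real.sqrt_nonneg _) h1 (by linarith)).trans ?_
  simpa using Real.rpow_sum_le_const_mul_sum_rpow (s := Finset.univ)
    (f := fun y : Fin n × Fin n => M y.1 y.2) hp

/-- The vector field with components `w`, rescaled from the unit ball to `ball x₀ ρ`. -/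
noncomputable def rescaledField (w : Fin n → E → ℝ) (x₀ : E) (ρ : ℝ) (x : E) : E :=
  WithLp.toLp 2 fun i => ρ * w i (ρ⁻¹ • (x - x₀))

theorem contDiff_rescaledField {w : Fin n → E → ℝ} (hw : ∀ i, ContDiff ℝ ∞ (w i)) (x₀ : E) (ρ : ℝ) :
    ContDiff ℝ ∞ (rescaledField w x₀ ρ) :=
  contDiff_euclidean.2 fun i => contDiff_const.mul ((hw i).comp (by fun_prop))

theorem fderiv_rescaledField {w : Fin n → E → ℝ} (hw : ∀ i, ContDiff ℝ ∞ (w i)) (x₀ : E) {ρ : ℝ}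
    (hρ : ρ ≠ 0) (x v : E) (i : Fin n) :
    fderiv ℝ (rescaledField w x₀ ρ) x v i = fderiv ℝ (w i) (ρ⁻¹ • (x - x₀)) v := by
  have h1 := ((contDiff_rescaledField hw x₀ ρ).differentiable (by simp) x).hasFDerivAt
  rw [← hasFDerivWithinAt_univ, hasFDerivWithinAt_euclidean] at h1
  replace h1 := hasFDerivWithinAt_univ.1 (h1 i)
  have h2 : HasFDerivAt (fun x => ρ⁻¹ • (x - x₀)) (ρ⁻¹ • ContinuousLinearMap.id ℝ E) x :=
    ((hasFDerivAt_id x).sub_const x₀).const_smul ρ⁻¹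
  have h3 : HasFDerivAt (fun x => rescaledField w x₀ ρ x i) _ x :=
    ((((hw i).differentiable (by simp) (ρ⁻¹ • (x - x₀))).hasFDerivAt.comp x h2).const_mul ρ)
  have h4 := congrArg (fun L : E →L[ℝ] ℝ => L v) (h1.unique h3)
  simp only [ContinuousLinearMap.comp_apply, smul_apply, ContinuousLinearMap.id_apply, map_smul,
    smul_eq_mul] at h4
  rw [← mul_assoc, mul_inv_cancel₀ hρ, one_mul] at h4
  exact h4

theorem integral_comp_inv_smul_sub (F : E → ℝ) (x₀ : E) (ρ : ℝ) :
    ∫ x, F (ρ⁻¹ • (x - x₀)) = |((ρ⁻¹) ^ n)⁻¹| * ∫ x, F x := by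
  rw [integral_sub_right_eq_self (fun x => F (ρ⁻¹ • x)) x₀, Measure.integral_comp_smul,
    finrank_euclideanSpace_fin, smul_eq_mul]

theorem integral_rpow_le_of_lintegral_le {p : ℝ} (hp : 0 < p) {f g : E → ℝ} (hf : Continuous f)
    (hg : Continuous g) (hgc : HasCompactSupport g) {C : ℝ≥0}
    (h : ∫⁻ x, ‖f x‖ₑ ^ p ≤ C * ∫⁻ x, ‖g x‖ₑ ^ p) :
    ∫ x, |f x| ^ p ≤ C * ∫ x, |g x| ^ p := by
  have e1 : ∀ t : ℝ, ‖t‖ₑ ^ p = ENNReal.ofReal (|t| ^ p) := fun t => by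
    rw [← ofReal_norm, ENNReal.ofReal_rpow_of_nonneg (norm_nonneg _) hp.le, Real.norm_eq_abs]
  have hgi : Integrable fun x => |g x| ^ p := by
    refine Continuous.integrable_of_hasCompactSupport
      (hg.abs.rpow_const fun _ => Or.inr hp.le) (hgc.comp_left (g := fun t => |t| ^ p) ?_)
    simp [hp.ne']
  simp only [e1] at h
  rw [← ofReal_integral_eq_lintegral_ofReal hgi
    (Eventually.of_forall fun x => by positivity), ← ENNReal.ofReal_coe_nnreal,
    ← ENNReal.ofReal_mul (NNReal.coe_nonneg C)] at h
  rw [integral_eq_lintegral_of_nonneg_ae (Eventually.of_forall fun x => by positivity)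
    (hf.abs.rpow_const fun _ => Or.inr hp.le).aestronglyMeasurable]
  exact ENNReal.toReal_le_of_le_ofReal
    (mul_nonneg (NNReal.coe_nonneg C) (integral_nonneg fun x => by positivity)) h

theorem exists_bogovskii_closedBall (n : ℕ) {p : ℝ} (hp : 1 < p) : ∃ c : ℝ, 0 < c ∧
    ∀ (x₀ : EuclideanSpace ℝ (Fin n)) (ρ : ℝ), 0 < ρ → ∀ g : EuclideanSpace ℝ (Fin n) → ℝ,
      ContDiff ℝ ∞ g → (∀ x, ρ < ‖x - x₀‖ → g x = 0) → ∫ x, g x = 0 →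
      ∃ w : EuclideanSpace ℝ (Fin n) → EuclideanSpace ℝ (Fin n),
        ContDiff ℝ ∞ w ∧ (∀ x, ρ < ‖x - x₀‖ → w x = 0) ∧ (∀ x, diverg w x = g x) ∧
        ∀ s : Set (EuclideanSpace ℝ (Fin n)),
          ∫ x in s, frob (jacobian w x) ^ p ≤ c * ∫ x, |g x| ^ p := by
  obtain ⟨C, hC⟩ := exists_bogovskii_unit n hp
  have hp0 : 0 < p := by linarith
  refine ⟨((n * n : ℕ) : ℝ) ^ (p - 1) * ∑ _y : Fin n × Fin n, (C : ℝ) + 1, by positivity,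
    fun x₀ ρ hρ g hg hg0 hgi => ?_⟩
  obtain ⟨a, ha⟩ : ∃ a : EuclideanSpace ℝ (Fin n) → ℝ, a = fun y => g (x₀ + ρ • y) := ⟨_, rfl⟩
  have hga : ∀ x, g x = a (ρ⁻¹ • (x - x₀)) := fun x => by
    rw [ha]
    simp only [smul_smul, mul_inv_cancel₀ hρ.ne', one_smul, add_sub_cancel]
  have hac : ContDiff ℝ ∞ a := by
    rw [ha]
    exact hg.comp (by fun_prop)
  have ha1 : ∀ y, 1 < ‖y‖ → a y = 0 := fun y hy => by
    rw [ha]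
    refine hg0 _ ?_
    rw [add_sub_cancel_left, norm_smul, Real.norm_of_nonneg hρ.le]
    exact lt_mul_of_one_lt_right hρ hy
  have hκ : 0 < |((ρ⁻¹) ^ n)⁻¹| := abs_pos.2 (by positivity)
  have hai : ∫ y, a y = 0 := by
    simp only [hga, integral_comp_inv_smul_sub] at hgi
    exact (mul_eq_zero.1 hgi).resolve_left hκ.ne'
  obtain ⟨w, hw, hw0, hdiv, hbd⟩ := hC a hac ha1 hai
  have hfd := fderiv_rescaledField hw x₀ hρ.ne'
  have hfar : ∀ x, ρ < ‖x - x₀‖ → 1 < ‖ρ⁻¹ • (x - x₀)‖ := fun x hx => by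
    rw [norm_smul, norm_inv, Real.norm_of_nonneg hρ.le, lt_inv_mul_iff₀ hρ, mul_one]
    exact hx
  refine ⟨rescaledField w x₀ ρ, contDiff_rescaledField hw x₀ ρ, fun x hx => ?_, fun x => ?_,
    fun s => ?_⟩
  · ext i
    simp [rescaledField, hw0 i _ (hfar x hx)]
  · simp only [diverg, hfd, hdiv, hga]
  · have hcont : ∀ i j, Continuous fun x => fderiv ℝ (w i) x (EuclideanSpace.single j 1) :=
      fun i j => ((hw i).continuous_fderiv (by simp)).clm_apply continuous_const
    have hb : ∀ i j, ∫ x, |fderiv ℝ (w i) x (EuclideanSpace.single j 1)| ^ p ≤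
        C * ∫ x, |a x| ^ p := fun i j =>
      integral_rpow_le_of_lintegral_le hp0 (hcont i j) hac.continuous
        (hasCompactSupport_of_one_lt_norm ha1) (hbd i j)
    have hInt : ∀ i j, Integrable fun x =>
        |fderiv ℝ (w i) (ρ⁻¹ • (x - x₀)) (EuclideanSpace.single j 1)| ^ p := fun i j => by
      have hc := hcont i j
      refine Continuous.integrable_of_hasCompactSupport
        (Continuous.rpow_const (by fun_prop) fun _ => Or.inr hp0.le)
        (HasCompactSupport.of_support_subset_isCompact (isCompact_closedBall x₀ ρ) fun x hx => ?_)
      by_contra h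
      refine hx ?_
      rw [mem_closedBall, dist_eq_norm, not_le] at h
      simp only [fderiv_eq_zero_of_one_lt_norm (hw0 i) (hfar x h)]
      simp [hp0.ne']
    have hsum : Integrable fun x => ((n * n : ℕ) : ℝ) ^ (p - 1) * ∑ y : Fin n × Fin n,
        |fderiv ℝ (w y.1) (ρ⁻¹ • (x - x₀)) (EuclideanSpace.single y.2 1)| ^ p :=
      (integrable_finsetSum _ fun y _ => hInt y.1 y.2).const_mul _
    have h1 : ∫ x in s, frob (jacobian (rescaledField w x₀ ρ) x) ^ p ≤
        ∫ x in s, ((n * n : ℕ) : ℝ) ^ (p - 1) * ∑ y : Fin n × Fin n,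
          |fderiv ℝ (w y.1) (ρ⁻¹ • (x - x₀)) (EuclideanSpace.single y.2 1)| ^ p := by
      refine integral_mono_of_nonneg (Eventually.of_forall fun x =>
        Real.rpow_nonneg (Real.sqrt_nonneg _) _) hsum.integrableOn
            (Eventually.of_forall fun x => ?_)
      refine (frob_rpow_le hp.le _).trans_eq ?_
      simp only [jacobian, hfd]
    refine h1.trans ((setIntegral_le_integral hsum (Eventually.of_forall fun x => ?_)).trans ?_)
    · exact mul_nonneg (by positivity) (Finset.sum_nonneg fun y _ => by positivity)
    rw [integral_const_mul, integral_finsetSum _ fun y _ => hInt y.1 y.2]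
    have hgp : ∫ x, |g x| ^ p = |((ρ⁻¹) ^ n)⁻¹| * ∫ x, |a x| ^ p := by
      simp only [hga]
      exact integral_comp_inv_smul_sub (fun x => |a x| ^ p) x₀ ρ
    have hg_nonneg : 0 ≤ ∫ x, |g x| ^ p := integral_nonneg fun x => by positivity
    have h2 : ∀ y ∈ (Finset.univ : Finset (Fin n × Fin n)),
        ∫ x, |fderiv ℝ (w y.1) (ρ⁻¹ • (x - x₀)) (EuclideanSpace.single y.2 1)| ^ p ≤
          C * ∫ x, |g x| ^ p := fun y _ => by
      rw [integral_comp_inv_smul_sub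
        (fun x => |fderiv ℝ (w y.1) x (EuclideanSpace.single y.2 1)| ^ p) x₀ ρ, hgp,
        mul_left_comm]
      exact mul_le_mul_of_nonneg_left (hb y.1 y.2) hκ.le
    refine (mul_le_mul_of_nonneg_left (Finset.sum_le_sum h2) (by positivity)).trans ?_
    rw [← Finset.sum_mul, ← mul_assoc, add_mul, one_mul]
    exact le_add_of_nonneg_right hg_nonneg

end Scaling

theorem tsupport_subset_closedBall_of_lt_norm {X Y : Type*} [NormedAddCommGroup X] [Zero Y]
    {f : X → Y}
    {x₀ : X} {ρ : ℝ} (h : ∀ x, ρ < ‖x - x₀‖ → f x = 0) : tsupport f ⊆ closedBall x₀ ρ :=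
  closure_minimal (fun x hx => by
    by_contra h'
    rw [mem_closedBall, dist_eq_norm, not_le] at h'
    exact hx (h x h')) isClosed_closedBall

/-- **Bogovskiĭ lemma, smooth data.** For `n ≥ 2`, `1 < p < ∞` there is
`c = c(n,p) > 0` (independent of `g` and `R`) such that: for every ball `B_R(x₀)` and every
`g ∈ C_c^∞(B_R(x₀))` with `∫_{B_R(x₀)} g = 0` there is `w ∈ C_c^∞(B_R(x₀), ℝⁿ)` with
`div w = g` on `B_R(x₀)` and `∫_{B_R(x₀)} |Dw|^p ≤ c ∫_{B_R(x₀)} |g|^p`; moreover `w` can be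
chosen so that whenever `supp g ⊆ B_r(x₀)` with `0 < r < R`, also `supp w ⊆ B_r(x₀)`. -/
theorem stmt_8 (n : ℕ) (hn : 2 ≤ n) (p : ℝ) (hp₁ : 1 < p) :
    ∃ c : ℝ, 0 < c ∧
      ∀ (x₀ : EuclideanSpace ℝ (Fin n)) (R : ℝ), 0 < R →
      ∀ g : EuclideanSpace ℝ (Fin n) → ℝ,
        ContDiff ℝ (⊤ : ℕ∞) g → HasCompactSupport g → tsupport g ⊆ ball x₀ R →
        (∫ x in ball x₀ R, g x) = 0 →
        ∃ w : EuclideanSpace ℝ (Fin n) → EuclideanSpace ℝ (Fin n),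
          ContDiff ℝ (⊤ : ℕ∞) w ∧ HasCompactSupport w ∧ tsupport w ⊆ ball x₀ R ∧
          (∀ x ∈ ball x₀ R, diverg w x = g x) ∧
          ((∫ x in ball x₀ R, frob (jacobian w x) ^ p) ≤ c * ∫ x in ball x₀ R, |g x| ^ p) ∧
          (∀ r : ℝ, 0 < r → r < R → tsupport g ⊆ ball x₀ r → tsupport w ⊆ ball x₀ r) := by
  obtain ⟨c, hc, H⟩ := exists_bogovskii_closedBall n hp₁
  refine ⟨c, hc, fun x₀ R hR g hg hgc hgR hg0 => ?_⟩
  have : Nonempty (Fin n) := ⟨⟨0, by omega⟩⟩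
  have hzero : ∀ x, x ∉ ball x₀ R → g x = 0 := fun x hx =>
    image_eq_zero_of_notMem_tsupport fun h => hx (hgR h)
  have e1 : ∫ x in ball x₀ R, g x = ∫ x, g x :=
    setIntegral_eq_integral_of_forall_compl_eq_zero hzero
  have e2 : ∫ x in ball x₀ R, |g x| ^ p = ∫ x, |g x| ^ p :=
    setIntegral_eq_integral_of_forall_compl_eq_zero fun x hx => by
      rw [hzero x hx, abs_zero, Real.zero_rpow (by linarith)]
  obtain ⟨ρ, hρ, hρg, hρmax⟩ : ∃ ρ : ℝ, 0 ≤ ρ ∧ (∀ x, ρ < ‖x - x₀‖ → g x = 0) ∧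
      ∀ r, 0 < r → tsupport g ⊆ ball x₀ r → ρ < r := by
    rcases (tsupport g).eq_empty_or_nonempty with h | h
    · exact ⟨0, le_rfl, fun x _ => image_eq_zero_of_notMem_tsupport (by simp [h]),
        fun r hr _ => hr⟩
    · obtain ⟨y, hy, hmax⟩ := hgc.isCompact.exists_isMaxOn h
        (f := fun x => ‖x - x₀‖) (by fun_prop)
      refine ⟨‖y - x₀‖, norm_nonneg _, fun x hx =>
        image_eq_zero_of_notMem_tsupport fun h' => hx.not_ge (hmax h'), fun r _ hr => ?_⟩
      simpa [dist_eq_norm] using hr hy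
  rcases hρ.eq_or_lt with rfl | hρ
  · have hg_ae : g =ᵐ[volume] fun _ => 0 := by
      filter_upwards [compl_mem_ae_iff.2 (measure_singleton (μ := volume) x₀)] with x hx
      exact hρg x (norm_pos_iff.2 (sub_ne_zero.2 hx))
    have hg_zero : g = fun _ => 0 :=
      (hg.continuous.ae_eq_iff_eq volume continuous_const).1 hg_ae
    refine ⟨fun _ => 0, contDiff_const, HasCompactSupport.zero, ?_, fun x _ => ?_, ?_,
      fun r _ _ _ => ?_⟩
    · simp [tsupport]
    · simp [diverg, hg_zero]
    · have : (1 : ℝ) ≤ p := hp₁.le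
      simp [jacobian, frob, hg_zero, Real.zero_rpow (by linarith : p ≠ 0)]
    · simp [tsupport]
  · obtain ⟨w, hw, hw0, hdiv, hbd⟩ := H x₀ ρ hρ g hg hρg (e1.symm.trans hg0)
    have hsupp := tsupport_subset_closedBall_of_lt_norm hw0
    refine ⟨w, hw, (isCompact_closedBall x₀ ρ).of_isClosed_subset (isClosed_tsupport w) hsupp,
      hsupp.trans (closedBall_subset_ball (hρmax R hR hgR)), fun x _ => hdiv x, ?_,
      fun r hr _ hgr => hsupp.trans (closedBall_subset_ball (hρmax r hr hgr))⟩
    rw [e2]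
    exact hbd _
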